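/- arXiv:1511.08239 — 6 statements merged into one kernel-verified Lean document; each statement's English description precedes it below -/
import Mathlib

section
/- Let M be a finite monoid that is inherently non-finitely based, i.e., there exists no finite set Σ of identities such that M satisfies every identity of Σ and every finitely generated monoid satisfying Σ is finite. Then the set of Birkhoff-closed sets of identities containing Th(M) has cardinality 2^ℵ₀; that is, the monoid variety generated by M has continuum many subvarieties. -/
/-- Words over the countably infinite alphabet `A = ℕ`: elements of the free monoid `A*`. -/
abbrev Word : Type := FreeMonoid ℕ

/-- A monoid `M` satisfies the identity `u ≈ v` if every monoid homomorphism
from the free monoid `A*` to `M` identifies `u` and `v`. -/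
def Satisfies (M : Type*) [Monoid M] (u v : Word) : Prop :=
  ∀ f : Word →* M, f u = f v

/-- A word `w` is an isoterm for a monoid `M` if the only word `w'` with
`M ⊨ w ≈ w'` is `w' = w`. -/
def Isoterm (M : Type*) [Monoid M] (w : Word) : Prop :=
  ∀ w' : Word, Satisfies M w w' → w' = w

/-- The set of identities satisfied by the monoid `M`. -/
def Th (M : Type*) [Monoid M] : Set (Word × Word) :=
  {p | Satisfies M p.1 p.2}

/-- A set `E` of identities is Birkhoff-closed if every identity satisfied by
every monoid satisfying all identities of `E` already belongs to `E`. -/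
def BirkhoffClosed (E : Set (Word × Word)) : Prop :=
  ∀ u v : Word,
    (∀ (M : Type) [Monoid M], (∀ p ∈ E, Satisfies M p.1 p.2) → Satisfies M u v) →
    (u, v) ∈ E

/-- A monoid is finitely generated if it is generated (as a monoid) by a finite subset. -/
def MonoidFG (M : Type*) [Monoid M] : Prop :=
  ∃ s : Set M, s.Finite ∧ Submonoid.closure s = ⊤

/-! ### Finitely generated periodic monoids whose regular elements lie in subgroups -/

/-- `JLe x y` says that `x` lies in the two-sided ideal generated by `y`. -/
def JLe {M : Type*} [Monoid M] (x y : M) : Prop := ∃ p q, x = p * y * q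

theorem JLe.trans {M : Type*} [Monoid M] {x y z : M} (h : JLe x y) (h' : JLe y z) : JLe x z := by
  obtain ⟨p, q, rfl⟩ := h
  obtain ⟨r, s, rfl⟩ := h'
  exact ⟨p * r, s * q, by simp only [mul_assoc]⟩

theorem JLe.refl {M : Type*} [Monoid M] (x : M) : JLe x x := ⟨1, 1, by simp⟩

theorem JLe.of_mul_left {M : Type*} [Monoid M] {x y z : M} (h : JLe x (y * z)) : JLe x z :=
  h.trans ⟨y, 1, by simp⟩

theorem JLe.of_mul_right {M : Type*} [Monoid M] {x y z : M} (h : JLe x (y * z)) : JLe x y :=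
  h.trans ⟨1, z, by simp⟩

theorem JLe.pow {M : Type*} [Monoid M] (x : M) {n : ℕ} (hn : 0 < n) : JLe (x ^ n) x := by
  obtain ⟨n, rfl⟩ := Nat.exists_eq_succ_of_ne_zero hn.ne'
  exact ⟨x ^ n, 1, by simp [pow_succ]⟩

/-- The value of the Zimin word on `u, t 0, …, t (k - 1)`. -/
def zim {M : Type*} [Mul M] (u : M) (t : ℕ → M) : ℕ → M
  | 0 => u
  | k + 1 => zim u t k * t k * zim u t k

/-- Every value of a Zimin word is a multiple of the square of its first argument. -/
def ZimBelowSquare (M : Type*) [Monoid M] (k : ℕ) : Prop :=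
  ∀ (u : M) (t : ℕ → M), JLe (zim u t k) (u * u)

theorem ZimBelowSquare.jLe_of_regular {M : Type*} [Monoid M] {k : ℕ} (hk : ZimBelowSquare M k)
    {u v : M} (h : u * v * u = u) : JLe u (u * u) := by
  have hz : ∀ n, zim u (fun _ => v) n = u := by
    intro n
    induction n with
    | zero => rfl
    | succ n ih => simp [zim, ih, h]
  simpa [hz] using hk u fun _ => v

theorem IsUnit.of_mul_mul_eq_one {M : Type*} [Monoid M] {E : ℕ} (hE : 0 < E)
    (hper : ∀ x : M, IsIdempotentElem (x ^ E)) {x y z : M} (h : x * y * z = 1) : IsUnit y := by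
  have key : ∀ a b : M, a * b = 1 → IsUnit a := by
    intro a b hab
    have h1 := pow_mul_pow_eq_one E hab
    have h2 : a ^ E = 1 := by
      calc a ^ E = a ^ E * (a ^ E * b ^ E) := by rw [h1, mul_one]
        _ = 1 := by rw [← mul_assoc, (hper a).eq, h1]
    exact IsUnit.of_pow_eq_one h2 hE.ne'
  rw [mul_assoc] at h
  obtain ⟨w, rfl⟩ := key _ _ h
  refine key y (z * w) ?_
  rw [← mul_assoc, ← Units.inv_eq_of_mul_eq_one_right h, Units.inv_mul]

/-- The local submonoid `eMe` at an idempotent `e`. -/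
@[ext]
structure Corner {M : Type*} [Monoid M] {e : M} (_ : IsIdempotentElem e) where
  /-- The underlying element. -/
  val : M
  left_mul : e * val = val
  mul_right : val * e = val

namespace Corner

variable {M : Type*} [Monoid M] {e : M} {he : IsIdempotentElem e}

instance : Monoid (Corner he) where
  mul x y := ⟨x.val * y.val, by rw [← mul_assoc, x.left_mul], by rw [mul_assoc, y.mul_right]⟩
  one := ⟨e, he, he⟩
  mul_assoc x y z := Corner.ext (mul_assoc x.val y.val z.val)
  one_mul x := Corner.ext x.left_mul
  mul_one x := Corner.ext x.mul_right

theorem val_mul (x y : Corner he) : (x * y).val = x.val * y.val := rfl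

theorem val_one : (1 : Corner he).val = e := rfl

theorem val_pow (x : Corner he) {n : ℕ} (hn : 0 < n) : (x ^ n).val = x.val ^ n := by
  induction n, hn using Nat.le_induction with
  | base => simp
  | succ n _ ih => rw [pow_succ, pow_succ, val_mul, ih]

/-- The element `eae` of the local submonoid. -/
def of (he : IsIdempotentElem e) (a : M) : Corner he :=
  ⟨e * a * e, by rw [← mul_assoc, ← mul_assoc, he.eq], by rw [mul_assoc, he.eq]⟩

theorem val_of (a : M) : (of he a).val = e * a * e := rfl

theorem of_val (x : Corner he) : of he x.val = x :=
  Corner.ext (by rw [val_of, x.left_mul, x.mul_right])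

theorem isIdempotentElem_pow {E : ℕ} (hE : 0 < E) (hper : ∀ x : M, IsIdempotentElem (x ^ E))
    (x : Corner he) : IsIdempotentElem (x ^ E) :=
  Corner.ext (by rw [val_mul, val_pow x hE, (hper _).eq])

theorem isUnit_of_jLe {E : ℕ} (hE : 0 < E) (hper : ∀ x : M, IsIdempotentElem (x ^ E)) {a : M}
    (h : JLe e (e * a * e)) : IsUnit (of he a) := by
  obtain ⟨p, q, h⟩ := h
  refine IsUnit.of_mul_mul_eq_one hE (isIdempotentElem_pow hE hper) (x := of he p) (z := of he q) ?_
  apply Corner.ext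
  simp only [val_mul, val_of, val_one]
  calc e * p * e * (e * a * e) * (e * q * e) = e * (p * ((e * e) * a * (e * e)) * q) * e := by
        simp only [mul_assoc]
    _ = e := by rw [he.eq, ← h, he.eq, he.eq]

end Corner

section LocalSubmonoid

variable {M : Type*} [Monoid M] {k E : ℕ}

theorem ZimBelowSquare.exists_mul_right (hk : ZimBelowSquare M k) (hE : 0 < E)
    (hper : ∀ x : M, IsIdempotentElem (x ^ E)) {e g : M} (he : IsIdempotentElem e)
    (h : JLe e g) : ∃ y, e * g * y = e := by
  obtain ⟨s, t, hst⟩ := h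
  have he' := he.eq
  obtain ⟨p, q, hpq⟩ := hk.jLe_of_regular (u := g * t * e) (v := s) (by
    calc g * t * e * s * (g * t * e) = g * t * (e * (s * g * t) * e) := by simp only [mul_assoc]
      _ = g * t * e := by rw [← hst, he', he'])
  have : JLe e (e * (g * t) * e) := by
    refine ⟨s * p * g * t, q, ?_⟩
    calc e = (s * g * t) * e := by rw [← hst, he']
      _ = s * (g * t * e) := by simp only [mul_assoc]
      _ = _ := by rw [hpq]; simp only [mul_assoc]
  obtain ⟨w, hw⟩ := (Corner.isUnit_of_jLe (he := he) hE hper this).exists_right_inv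
  refine ⟨t * e * w.val, ?_⟩
  have := congrArg Corner.val hw
  rw [Corner.val_mul, Corner.val_of, Corner.val_one] at this
  refine Eq.trans ?_ this
  simp only [mul_assoc]

theorem ZimBelowSquare.exists_mul_left (hk : ZimBelowSquare M k) (hE : 0 < E)
    (hper : ∀ x : M, IsIdempotentElem (x ^ E)) {e g : M} (he : IsIdempotentElem e)
    (h : JLe e g) : ∃ x, x * (g * e) = e := by
  obtain ⟨s, t, hst⟩ := h
  have he' := he.eq
  obtain ⟨p, q, hpq⟩ := hk.jLe_of_regular (u := e * s * g) (v := t) (by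
    calc e * s * g * t * (e * s * g) = (e * (s * g * t) * e) * s * g := by simp only [mul_assoc]
      _ = e * s * g := by rw [← hst, he', he'])
  have : JLe e (e * (s * g) * e) := by
    refine ⟨p, s * g * q * t, ?_⟩
    calc e = e * (s * g * t) := by rw [← hst, he']
      _ = (e * s * g) * t := by simp only [mul_assoc]
      _ = _ := by rw [hpq]; simp only [mul_assoc]
  obtain ⟨w, hw⟩ := (Corner.isUnit_of_jLe (he := he) hE hper this).exists_left_inv
  refine ⟨w.val * (e * s), ?_⟩
  have := congrArg Corner.val hw
  rw [Corner.val_mul, Corner.val_of, Corner.val_one] at this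
  refine Eq.trans ?_ this
  simp only [mul_assoc]

theorem ZimBelowSquare.isUnit_of (hk : ZimBelowSquare M k) (hE : 0 < E)
    (hper : ∀ x : M, IsIdempotentElem (x ^ E)) {e g : M} (he : IsIdempotentElem e)
    (h : JLe e g) : IsUnit (Corner.of he g) := by
  obtain ⟨y, hy⟩ := hk.exists_mul_right hE hper he h
  obtain ⟨p, q, hpq⟩ := hk.jLe_of_regular (u := e * g) (v := y) (by
    rw [hy, ← mul_assoc, he.eq])
  refine Corner.isUnit_of_jLe hE hper ⟨p, g * q * y, ?_⟩
  conv_lhs => rw [← hy, hpq]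
  simp only [mul_assoc]

theorem ZimBelowSquare.jLe_mul (hk : ZimBelowSquare M k) (hE : 0 < E)
    (hper : ∀ x : M, IsIdempotentElem (x ^ E)) {e g h : M} (he : IsIdempotentElem e)
    (hg : JLe e g) (hh : JLe e h) : JLe e (g * h) := by
  obtain ⟨y, hy⟩ := hk.exists_mul_right hE hper he hg
  obtain ⟨x, hx⟩ := hk.exists_mul_left hE hper he hh
  have he' := he.eq
  obtain ⟨p, q, hpq⟩ := hk.jLe_of_regular (u := h * e * g) (v := y * x) (by
    calc h * e * g * (y * x) * (h * e * g) = h * (e * g * y) * (x * (h * e)) * g := by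
          simp only [mul_assoc]
      _ = h * e * g := by rw [hy, hx, mul_assoc h, he'])
  refine ⟨x * p * h * e, e * g * q * y, ?_⟩
  calc e = (x * (h * e)) * (e * g * y) := by rw [hx, hy, he']
    _ = x * (h * (e * e) * g) * y := by simp only [mul_assoc]
    _ = x * (h * e * g) * y := by rw [he']
    _ = _ := by rw [hpq]; simp only [mul_assoc]

theorem pow_mul_self_of_jLe (hE : 0 < E) (hper : ∀ x : M, IsIdempotentElem (x ^ E)) {a : M}
    (h : JLe a (a * a)) : a ^ E * a = a := by
  obtain ⟨p, q, h⟩ := h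
  have h1 : ∀ n, (p * a) ^ n * a * q ^ n = a := by
    intro n
    induction n with
    | zero => simp
    | succ n ih =>
      calc (p * a) ^ (n + 1) * a * q ^ (n + 1) = (p * a) ^ n * (p * (a * a) * q) * q ^ n := by
            rw [pow_succ, pow_succ']; simp only [mul_assoc]
        _ = a := by rw [← h, ih]
  have h2 : (p * a) ^ E * a = a := by
    have := h1 E
    calc (p * a) ^ E * a = (p * a) ^ E * ((p * a) ^ E * a * q ^ E) := by rw [this]
      _ = ((p * a) ^ E * (p * a) ^ E) * a * q ^ E := by simp only [mul_assoc]
      _ = a := by rw [(hper _).eq, this]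
  obtain ⟨x, hx⟩ : ∃ x, x * a * a = a := by
    obtain ⟨n, rfl⟩ := Nat.exists_eq_succ_of_ne_zero hE.ne'
    exact ⟨(p * a) ^ n * p, by rw [mul_assoc _ p a, ← pow_succ, h2]⟩
  have h3 : ∀ n, x ^ n * (a * a ^ n) = a := by
    intro n
    induction n with
    | zero => simp
    | succ n ih =>
      calc x ^ (n + 1) * (a * a ^ (n + 1)) = x ^ n * ((x * a * a) * a ^ n) := by
            rw [pow_succ, pow_succ']; simp only [mul_assoc]
        _ = a := by rw [hx, ih]
  calc a ^ E * a = a * a ^ E := ((Commute.refl a).pow_left E).eq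
    _ = x ^ E * (a * a ^ E) * a ^ E := by rw [h3]
    _ = x ^ E * (a * (a ^ E * a ^ E)) := by simp only [mul_assoc]
    _ = a := by rw [(hper _).eq, h3]

end LocalSubmonoid

theorem exists_finite_prefixes {M : Type*} [Monoid M] {X I : Set M} (hX : X.Finite)
    (hcl : Submonoid.closure X = ⊤) (hI : Iᶜ.Finite) :
    ∃ A ⊆ I, A.Finite ∧ ∀ y ∈ I, ∃ a ∈ A, ∃ r, y = a * r := by
  refine ⟨insert 1 (Set.image2 (· * ·) Iᶜ X) ∩ I, Set.inter_subset_right,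
    ((hI.image2 _ hX).insert 1).inter_of_left I, fun y => ?_⟩
  have hy : y ∈ Submonoid.closure X := hcl ▸ Submonoid.mem_top y
  induction hy using Submonoid.closure_induction_right with
  | one => exact fun h => ⟨1, ⟨Set.mem_insert _ _, h⟩, 1, by simp⟩
  | mul_right y _ g hg ih =>
    intro h
    by_cases hy : y ∈ I
    · obtain ⟨a, ha, r, rfl⟩ := ih hy
      exact ⟨a, ha, r * g, mul_assoc _ _ _⟩
    · exact ⟨y * g, ⟨Set.mem_insert_of_mem _ ⟨y, hy, g, hg, rfl⟩, h⟩, 1, by simp⟩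

theorem exists_finite_suffixes {M : Type*} [Monoid M] {X I : Set M} (hX : X.Finite)
    (hcl : Submonoid.closure X = ⊤) (hI : Iᶜ.Finite) :
    ∃ A ⊆ I, A.Finite ∧ ∀ y ∈ I, ∃ a ∈ A, ∃ r, y = r * a := by
  refine ⟨insert 1 (Set.image2 (· * ·) X Iᶜ) ∩ I, Set.inter_subset_right,
    ((hX.image2 _ hI).insert 1).inter_of_left I, fun y => ?_⟩
  have hy : y ∈ Submonoid.closure X := hcl ▸ Submonoid.mem_top y
  induction hy using Submonoid.closure_induction_left with
  | one => exact fun h => ⟨1, ⟨Set.mem_insert _ _, h⟩, 1, by simp⟩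
  | mul_left g hg y _ ih =>
    intro h
    by_cases hy : y ∈ I
    · obtain ⟨a, ha, r, rfl⟩ := ih hy
      exact ⟨a, ha, g * r, (mul_assoc _ _ _).symm⟩
    · exact ⟨g * y, ⟨Set.mem_insert_of_mem _ ⟨g, hg, y, hy, rfl⟩, h⟩, 1, by simp⟩

/-- A Schreier-type argument: if multiplying by `f` moves every element into a set whose elements
return to `f` along finitely many pairs `(s, t)`, then the local submonoid at `f` is finitely
generated. -/
theorem Corner.monoidFG {M : Type*} [Monoid M] {X P : Set M} (hX : X.Finite)
    (hcl : Submonoid.closure X = ⊤) (hP : P.Finite) {f : M} (hf : IsIdempotentElem f)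
    {s t : M → M} (h : ∀ w, ∃ p ∈ P, f * w = f * w * (s p * f * t p)) :
    MonoidFG (Corner hf) := by
  set Θ : Set M := insert 1 (t '' P)
  have hΘ : Θ.Finite := (hP.image t).insert 1
  set S : Set (Corner hf) := Corner.of hf ''
    (Θ ∪ Set.image2 (fun a b => a * b) (Set.image2 (fun a b => a * b) Θ X) (s '' P))
  have key : ∀ w : M, ∃ m ∈ Submonoid.closure S, ∃ τ ∈ Θ, f * w = m.val * (f * τ) := by
    intro w
    have hw : w ∈ Submonoid.closure X := hcl ▸ Submonoid.mem_top w
    induction hw using Submonoid.closure_induction_right with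
    | one => exact ⟨1, one_mem _, 1, Set.mem_insert _ _, by simp [Corner.val_one, hf.eq]⟩
    | mul_right w _ g hg ih =>
      obtain ⟨m, hm, τ, hτ, hw⟩ := ih
      obtain ⟨p, hp, hp'⟩ := h (τ * g)
      refine ⟨m * Corner.of hf (τ * g * s p), mul_mem hm (Submonoid.subset_closure ?_), t p,
        Set.mem_insert_of_mem _ ⟨p, hp, rfl⟩, ?_⟩
      · exact ⟨_, Or.inr ⟨_, ⟨τ, hτ, g, hg, rfl⟩, _, ⟨p, hp, rfl⟩, rfl⟩, rfl⟩
      · calc f * (w * g) = f * w * g := (mul_assoc _ _ _).symm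
          _ = m.val * (f * (τ * g)) := by rw [hw]; simp only [mul_assoc]
          _ = m.val * (f * (τ * g) * (s p * (f * f) * t p)) := by rw [hf.eq, ← hp']
          _ = _ := by rw [Corner.val_mul, Corner.val_of]; simp only [mul_assoc]
  refine ⟨S, (hΘ.union ((hΘ.image2 _ hX).image2 _ (hP.image s))).image _, ?_⟩
  refine eq_top_iff.2 fun x _ => ?_
  obtain ⟨m, hm, τ, hτ, hx⟩ := key x.val
  have : x = m * Corner.of hf τ := by
    apply Corner.ext
    rw [Corner.val_mul, Corner.val_of, ← mul_assoc, ← hx, x.left_mul, x.mul_right]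
  rw [this]
  exact mul_mem hm (Submonoid.subset_closure ⟨τ, Or.inl hτ, rfl⟩)

theorem ZimBelowSquare.exists_minimal_idempotent {M : Type*} [Monoid M] {k E : ℕ}
    (hk : ZimBelowSquare M k) (hE : 0 < E) (hper : ∀ x : M, IsIdempotentElem (x ^ E))
    {X : Set M} (hX : X.Finite) (hcl : Submonoid.closure X = ⊤) :
    ∃ e : M, IsIdempotentElem e ∧ ∀ y, JLe y e → JLe e y := by
  obtain ⟨C, ⟨⟨e, he, rfl⟩, hmax⟩⟩ := Set.Finite.exists_maximal
    (s := {C : Set M | ∃ e : M, IsIdempotentElem e ∧ C = {g ∈ X | JLe e g}})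
    (hX.finite_subsets.subset (by rintro _ ⟨e, -, rfl⟩; exact Set.sep_subset _ _))
    ⟨_, 1, IsIdempotentElem.one, rfl⟩
  have key : ∀ f : M, IsIdempotentElem f → JLe f e → ∀ w, JLe f w → JLe e w := by
    intro f hf hfe w
    have hw : w ∈ Submonoid.closure X := hcl ▸ Submonoid.mem_top w
    have hsub := hmax ⟨f, hf, rfl⟩ (fun g hg => ⟨hg.1, hfe.trans hg.2⟩)
    induction hw using Submonoid.closure_induction_right with
    | one => exact fun _ => ⟨e, 1, by simp⟩
    | mul_right w _ g hg ih =>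
      exact fun h => hk.jLe_mul hE hper he (ih h.of_mul_right) (hsub ⟨hg, h.of_mul_left⟩).2
  refine ⟨e, he, fun y hy => ?_⟩
  exact key (y ^ E) (hper y) ((JLe.pow y hE).trans hy) y (JLe.pow y hE)

/-- Finiteness criterion for a finitely generated periodic monoid all of whose nonempty ideals
are cofinite. -/
theorem ZimBelowSquare.finite_of_cofinite {M : Type*} [Monoid M] {k E : ℕ}
    (hk : ZimBelowSquare M k) (hE : 0 < E) (hper : ∀ x : M, IsIdempotentElem (x ^ E))
    (hfg : MonoidFG M) (hco : ∀ y : M, {x | JLe x y}ᶜ.Finite)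
    (hcor : ∀ (e : M) (he : IsIdempotentElem e), MonoidFG (Corner he) →
      (∀ x : Corner he, IsUnit x) → Finite (Corner he)) : Finite M := by
  obtain ⟨X, hX, hcl⟩ := hfg
  obtain ⟨e, he, hmin⟩ := hk.exists_minimal_idempotent hE hper hX hcl
  set I : Set M := {x | JLe x e} with hIdef
  have hsq : ∀ y ∈ I, y ^ E * y = y := by
    intro y hy
    have := hmin y hy
    exact pow_mul_self_of_jLe hE hper (hy.trans (hk.jLe_mul hE hper he this this))
  have hpowI : ∀ y ∈ I, y ^ E ∈ I := fun y hy => (JLe.pow y hE).trans hy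
  obtain ⟨A, hAI, hA, hApre⟩ := exists_finite_prefixes hX hcl (hco e)
  obtain ⟨B, hBI, hB, hBsuf⟩ := exists_finite_suffixes hX hcl (hco e)
  have hleft : ∀ y ∈ I, ∃ a ∈ A, a ^ E * y = y := by
    intro y hy
    obtain ⟨a, ha, r, rfl⟩ := hApre y hy
    exact ⟨a, ha, by rw [← mul_assoc, hsq a (hAI ha)]⟩
  have hright : ∀ y ∈ I, ∃ b ∈ B, y * b ^ E = y := by
    intro y hy
    obtain ⟨b, hb, r, rfl⟩ := hBsuf y hy
    exact ⟨b, hb, by rw [mul_assoc, ← pow_succ', pow_succ, hsq b (hBI hb)]⟩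
  have hcorner : ∀ a ∈ A, Finite (Corner (hper a)) := by
    intro a ha
    have hfI := hpowI a (hAI ha)
    refine hcor _ _ ?_ fun x => ?_
    · have hst : ∀ b, ∃ s t, b ∈ B → b ^ E = s * a ^ E * t := by
        intro b
        by_cases hb : b ∈ B
        · obtain ⟨s, t, h⟩ := (hpowI b (hBI hb)).trans (hmin _ hfI)
          exact ⟨s, t, fun _ => h⟩
        · exact ⟨1, 1, fun h => absurd h hb⟩
      choose s t hst using hst
      refine Corner.monoidFG hX hcl hB (hper a) (s := s) (t := t) fun w => ?_
      obtain ⟨b, hb, h⟩ := hright (a ^ E * w) (JLe.trans ⟨1, w, by simp⟩ hfI)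
      exact ⟨b, hb, by rw [← hst b hb, h]⟩
    · rw [← x.of_val]
      refine hk.isUnit_of hE hper (hper a) (hfI.trans (hmin _ (JLe.trans ?_ hfI)))
      exact ⟨1, x.val, by rw [one_mul, x.left_mul]⟩
  have hfin : ∀ a ∈ A, ∀ b ∈ B, {y | a ^ E * y = y ∧ y * b ^ E = y}.Finite := by
    intro a ha b hb
    have := hcorner a ha
    obtain ⟨s, t, h⟩ := (hpowI b (hBI hb)).trans (hmin _ (hpowI a (hAI ha)))
    let φ : {y | a ^ E * y = y ∧ y * b ^ E = y} → Corner (hper a) := fun y =>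
      ⟨y * s * a ^ E, by rw [← mul_assoc, ← mul_assoc, y.2.1], by rw [mul_assoc, (hper a).eq]⟩
    refine Set.finite_coe_iff.1 (Finite.of_injective φ fun y z hyz => ?_)
    have h1 : (y : M) * s * a ^ E = z * s * a ^ E := congrArg Corner.val hyz
    apply Subtype.ext
    have hst : ∀ y : M, y * b ^ E = y → y = y * s * a ^ E * t := by
      intro y hy
      conv_lhs => rw [← hy, h]
      simp only [mul_assoc]
    rw [hst y y.2.2, hst z z.2.2, h1]
  have hI : I.Finite := by
    refine (hA.biUnion fun a ha => hB.biUnion fun b hb => hfin a ha b hb).subset fun y hy => ?_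
    obtain ⟨a, ha, h1⟩ := hleft y hy
    obtain ⟨b, hb, h2⟩ := hright y hy
    exact Set.mem_biUnion ha (Set.mem_biUnion hb ⟨h1, h2⟩)
  refine Set.finite_univ_iff.1 ?_
  rw [← Set.union_compl_self I]
  exact hI.union (hco e)

/-! ### Reduction to monoids with cofinite ideals -/

theorem MonoidFG.of_surjective {M N : Type*} [Monoid M] [Monoid N] (h : MonoidFG M) (φ : M →* N)
    (hφ : Function.Surjective φ) : MonoidFG N := by
  obtain ⟨X, hX, hcl⟩ := h
  exact ⟨φ '' X, hX.image _, by rw [← MonoidHom.map_mclosure, hcl, ← MonoidHom.mrange_eq_map,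
    MonoidHom.mrange_eq_top.2 hφ]⟩

theorem map_zim {M N : Type*} [Monoid M] [Monoid N] (φ : M →* N) (u : M) (t : ℕ → M) (k : ℕ) :
    φ (zim u t k) = zim (φ u) (fun i => φ (t i)) k := by
  induction k with
  | zero => rfl
  | succ k ih => simp [zim, ih]

theorem zim_congr {M : Type*} [Mul M] (u : M) {t t' : ℕ → M} {k : ℕ} (h : ∀ i < k, t i = t' i) :
    zim u t k = zim u t' k := by
  induction k with
  | zero => rfl
  | succ k ih => rw [zim, zim, ih fun i hi => h i (hi.trans k.lt_succ_self), h k k.lt_succ_self]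

theorem ZimBelowSquare.of_surjective {M N : Type*} [Monoid M] [Monoid N] {k : ℕ}
    (h : ZimBelowSquare M k) (φ : M →* N) (hφ : Function.Surjective φ) : ZimBelowSquare N k := by
  intro u t
  obtain ⟨u, rfl⟩ := hφ u
  choose t' ht' using fun i => hφ (t i)
  obtain ⟨p, q, hpq⟩ := h u t'
  refine ⟨φ p, φ q, ?_⟩
  rw [← map_mul, ← map_mul, ← map_mul, ← hpq, map_zim]
  simp only [ht']

/-- A cofinite congruence on a finitely generated monoid is determined by finitely many pairs, up
to finiteness of the quotient. -/
theorem Con.exists_finite_of_finite_quotient {M : Type*} [Monoid M] (h : MonoidFG M) (c : Con M)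
    [Finite c.Quotient] : ∃ P : Set (M × M), P.Finite ∧ (∀ p ∈ P, c p.1 p.2) ∧
      ∀ d : Con M, (∀ p ∈ P, d p.1 p.2) → Finite d.Quotient := by
  obtain ⟨X, hX, hcl⟩ := h
  let ρ : M → M := fun x => Quotient.out (x : c.Quotient)
  have hρ : ∀ x, c x (ρ x) := fun x => c.symm (Quotient.mk_out (s := c.toSetoid) x)
  set R : Set M := insert 1 (Set.range fun q : c.Quotient => Quotient.out q)
  have hR : R.Finite := (Set.finite_range _).insert 1
  refine ⟨(fun p : M × M => (p.1 * p.2, ρ (p.1 * p.2))) '' (R ×ˢ X), (hR.prod hX).image _,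
    ?_, fun d hd => ?_⟩
  · rintro _ ⟨p, -, rfl⟩
    exact hρ _
  · have key : ∀ x, ∃ r ∈ R, d x r := by
      intro x
      have hx : x ∈ Submonoid.closure X := hcl ▸ Submonoid.mem_top x
      induction hx using Submonoid.closure_induction_right with
      | one => exact ⟨1, Set.mem_insert _ _, d.refl 1⟩
      | mul_right x _ g hg ih =>
        obtain ⟨r, hr, hxr⟩ := ih
        exact ⟨ρ (r * g), Set.mem_insert_of_mem _ ⟨_, rfl⟩,
          d.trans (d.mul hxr (d.refl g)) (hd _ ⟨(r, g), ⟨hr, hg⟩, rfl⟩)⟩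
    refine Set.finite_univ_iff.1 ((hR.image fun x : M => (x : d.Quotient)).subset ?_)
    rintro ⟨x⟩ -
    obtain ⟨r, hr, hxr⟩ := key x
    exact ⟨r, hr, ((d.eq).2 hxr).symm⟩

/-- Every infinite finitely generated monoid has a just-infinite quotient. -/
theorem MonoidFG.exists_justInfinite {M : Type*} [Monoid M] (h : MonoidFG M) [Infinite M] :
    ∃ c : Con M, Infinite c.Quotient ∧ ∀ d : Con c.Quotient, d ≠ ⊥ → Finite d.Quotient := by
  obtain ⟨c, hc⟩ := zorn_le₀ {c : Con M | Infinite c.Quotient} (by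
    intro C hC hchain
    rcases C.eq_empty_or_nonempty with rfl | ⟨c₀, hc₀⟩
    · refine ⟨⊥, ?_, by simp⟩
      exact Infinite.of_injective (fun x : M => (x : (⊥ : Con M).Quotient))
        fun x y hxy => (Con.eq _).1 hxy
    · let s : Con M :=
        { r := fun a b => ∃ c ∈ C, c a b
          iseqv := ⟨fun a => ⟨c₀, hc₀, c₀.refl a⟩, fun ⟨c, hc, h⟩ => ⟨c, hc, c.symm h⟩, by
            rintro a b d ⟨c, hc, h⟩ ⟨c', hc', h'⟩
            rcases hchain.total hc hc' with hcc | hcc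
            · exact ⟨c', hc', c'.trans (hcc h) h'⟩
            · exact ⟨c, hc, c.trans h (hcc h')⟩⟩
          mul' := by
            rintro a b d e ⟨c, hc, h⟩ ⟨c', hc', h'⟩
            rcases hchain.total hc hc' with hcc | hcc
            · exact ⟨c', hc', c'.mul (hcc h) h'⟩
            · exact ⟨c, hc, c.mul h (hcc h')⟩ }
      refine ⟨s, ?_, fun c hc a b hab => ⟨c, hc, hab⟩⟩
      by_contra hfin
      have : Finite s.Quotient := not_infinite_iff_finite.1 hfin
      obtain ⟨P, hP, hPs, hPd⟩ := s.exists_finite_of_finite_quotient h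
      have : ∃ c ∈ C, ∀ p ∈ P, c p.1 p.2 := by
        clear hPd
        induction P, hP using Set.Finite.induction_on with
        | empty => exact ⟨c₀, hc₀, by simp⟩
        | @insert p P _ _ ih =>
          obtain ⟨c, hc, hcp⟩ := hPs p (Set.mem_insert _ _)
          obtain ⟨c', hc', hcP⟩ := ih fun q hq => hPs q (Set.mem_insert_of_mem _ hq)
          rcases hchain.total hc hc' with hcc | hcc
          · exact ⟨c', hc', Set.forall_mem_insert.2 ⟨hcc hcp, hcP⟩⟩
          · exact ⟨c, hc, Set.forall_mem_insert.2 ⟨hcp, fun q hq => hcc (hcP q hq)⟩⟩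
      obtain ⟨c, hc, hcP⟩ := this
      exact not_finite_iff_infinite.2 (hC hc) (hPd c hcP))
  have hinf : Infinite c.Quotient := hc.1
  refine ⟨c, hinf, fun d hd => ?_⟩
  have hsurj : Function.Surjective (d.mk'.comp c.mk') := d.mk'_surjective.comp c.mk'_surjective
  have hle : c ≤ Con.ker (d.mk'.comp c.mk') := fun a b hab => by
    simp only [Con.ker_rel, MonoidHom.comp_apply]
    rw [show c.mk' a = c.mk' b from (Con.eq c).2 hab]
  by_contra hfin
  have hinf' : Infinite d.Quotient := not_finite_iff_infinite.1 hfin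
  have : Infinite (Con.ker (d.mk'.comp c.mk')).Quotient :=
    (Con.quotientKerEquivOfSurjective _ hsurj).toEquiv.infinite_iff.2 hinf'
  refine hd (eq_bot_iff.2 fun a b hab => ?_)
  obtain ⟨a, rfl⟩ := c.mk'_surjective a
  obtain ⟨b, rfl⟩ := c.mk'_surjective b
  refine (Con.eq c).2 (hc.2 this hle ?_)
  exact (Con.eq d).2 hab

/-- The Rees congruence of the principal ideal generated by `y`. -/
def reesCon {M : Type*} [Monoid M] (y : M) : Con M where
  r a b := a = b ∨ JLe a y ∧ JLe b y
  iseqv := ⟨fun _ => Or.inl rfl, fun h => h.imp Eq.symm And.symm, by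
    rintro a b c (rfl | h) (rfl | h')
    exacts [Or.inl rfl, Or.inr h', Or.inr h, Or.inr ⟨h.1, h'.2⟩]⟩
  mul' := by
    rintro a b c d (rfl | h) (rfl | h')
    · exact Or.inl rfl
    · exact Or.inr ⟨JLe.trans ⟨a, 1, by simp⟩ h'.1, JLe.trans ⟨a, 1, by simp⟩ h'.2⟩
    · exact Or.inr ⟨JLe.trans ⟨1, c, by simp⟩ h.1, JLe.trans ⟨1, c, by simp⟩ h.2⟩
    · exact Or.inr ⟨JLe.trans ⟨1, c, by simp⟩ h.1, JLe.trans ⟨1, d, by simp⟩ h.2⟩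

theorem finite_compl_or_zero_of_justInfinite {M : Type*} [Monoid M]
    (h : ∀ d : Con M, d ≠ ⊥ → Finite d.Quotient) (y : M) :
    {x | JLe x y}ᶜ.Finite ∨ ∀ p q, p * y * q = y := by
  by_cases hd : reesCon y = ⊥
  · refine Or.inr fun p q => ?_
    have : reesCon y (p * y * q) y := Or.inr ⟨⟨p, q, rfl⟩, JLe.refl y⟩
    rw [hd] at this
    exact this
  · have := h _ hd
    refine Or.inl (Set.Finite.of_finite_image (f := fun x : M => (x : (reesCon y).Quotient))
      (Set.toFinite _) fun a ha b hb hab => ?_)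
    rcases (Con.eq _).1 hab with hab | hab
    exacts [hab, absurd hab.1 ha]

theorem finite_of_forall_mul_mul_eq_zero {M : Type*} [Monoid M] (hfg : MonoidFG M) {z u v : M}
    (hz : ∀ p q, p * z * q = z) (hu : {x | JLe x u}ᶜ.Finite) (hv : {x | JLe x v}ᶜ.Finite)
    (huv : ∀ t, u * t * v = z) : Finite M := by
  obtain ⟨X, hX, hcl⟩ := hfg
  set K : Set M := {x | JLe x u} ∩ {x | JLe x v}
  have hK : Kᶜ.Finite := by
    rw [Set.compl_inter]
    exact hu.union hv
  obtain ⟨A, hAK, hA, hpre⟩ := exists_finite_prefixes hX hcl hK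
  have hKfin : K.Finite := by
    refine ((hA.image2 (fun a r => a * r) hK).insert z).subset fun y hy => ?_
    obtain ⟨a, ha, r, rfl⟩ := hpre y hy
    by_cases hr : r ∈ K
    · obtain ⟨p, q, rfl⟩ := (hAK ha).1
      obtain ⟨p', q', rfl⟩ := hr.2
      left
      calc p * u * q * (p' * v * q') = p * (u * (q * p') * v) * q' := by simp only [mul_assoc]
        _ = z := by rw [huv, hz]
    · exact Or.inr ⟨a, ha, r, hr, rfl⟩
  refine Set.finite_univ_iff.1 ?_
  rw [← Set.union_compl_self K]
  exact hKfin.union hK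

section Zero

variable {M : Type*} [Monoid M] {k : ℕ} {z : M}

theorem ZimBelowSquare.mul_self_ne_zero (hk : ZimBelowSquare M k) (hz : ∀ p q, p * z * q = z)
    (hprime : ∀ u v, u ≠ z → v ≠ z → ∃ t, u * t * v ≠ z) {u : M} (hu : u ≠ z) : u * u ≠ z := by
  intro huu
  have key : ∀ n, ∃ t, zim u t n ≠ z := by
    intro n
    induction n with
    | zero => exact ⟨1, hu⟩
    | succ n ih =>
      obtain ⟨t, ht⟩ := ih
      obtain ⟨s, hs⟩ := hprime _ _ ht ht
      refine ⟨Function.update t n s, ?_⟩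
      rwa [zim, Function.update_self, zim_congr u (t' := t)]
      exact fun i hi => Function.update_of_ne hi.ne _ _
  obtain ⟨t, ht⟩ := key k
  obtain ⟨p, q, hpq⟩ := hk u t
  exact ht (by rw [hpq, huu, hz])

theorem ZimBelowSquare.mul_ne_zero (hk : ZimBelowSquare M k) (hz : ∀ p q, p * z * q = z)
    (hprime : ∀ u v, u ≠ z → v ≠ z → ∃ t, u * t * v ≠ z) {x y : M} (hx : x ≠ z) (hy : y ≠ z) :
    x * y ≠ z := by
  intro hxy
  obtain ⟨t, ht⟩ := hprime y x hy hx
  refine hk.mul_self_ne_zero hz hprime ht ?_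
  calc y * t * x * (y * t * x) = y * t * (x * y) * (t * x) := by simp only [mul_assoc]
    _ = z := by rw [hxy, hz]

theorem ZimBelowSquare.exists_submonoid_cofinite [Infinite M] (hk : ZimBelowSquare M k)
    (hfg : MonoidFG M) (hji : ∀ d : Con M, d ≠ ⊥ → Finite d.Quotient)
    (hz : ∀ p q, p * z * q = z) :
    ∃ T : Submonoid M, Infinite T ∧ MonoidFG T ∧ ∀ y : T, {x | JLe x y}ᶜ.Finite := by
  have hco : ∀ y, y ≠ z → {x | JLe x y}ᶜ.Finite := fun y hy =>
    (finite_compl_or_zero_of_justInfinite hji y).resolve_right fun h => hy <| by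
      have h1 := h z 1
      have h2 := hz 1 y
      rw [mul_one] at h1
      rw [one_mul] at h2
      exact h1.symm.trans h2
  have hprime : ∀ u v, u ≠ z → v ≠ z → ∃ t, u * t * v ≠ z := by
    intro u v hu hv
    by_contra! h
    exact not_finite_iff_infinite.2 ‹_›
      (finite_of_forall_mul_mul_eq_zero hfg hz (hco u hu) (hco v hv) h)
  have h1 : (1 : M) ≠ z := by
    rintro rfl
    refine not_finite_iff_infinite.2 ‹Infinite M› ?_
    have : Subsingleton M := ⟨fun a b => by
      rw [← mul_one a, ← mul_one (a * 1), hz, ← hz b 1, mul_one, mul_one]⟩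
    infer_instance
  let T : Submonoid M :=
    { carrier := {z}ᶜ
      one_mem' := h1
      mul_mem' := fun hx hy => hk.mul_ne_zero hz hprime hx hy }
  refine ⟨T, (Set.finite_singleton z).infinite_compl.to_subtype, ?_, ?_⟩
  · obtain ⟨X, hX, hcl⟩ := hfg
    refine ⟨Subtype.val ⁻¹' X, hX.preimage Subtype.val_injective.injOn, ?_⟩
    refine eq_top_iff.2 fun ⟨x, hx⟩ _ => ?_
    have hxX : x ∈ Submonoid.closure X := hcl ▸ Submonoid.mem_top x
    induction hxX using Submonoid.closure_induction_right with
    | one => exact one_mem _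
    | mul_right x _ g hg ih =>
      have hx' : x ≠ z := by
        rintro rfl
        exact hx (by simpa using hz 1 g)
      have hg' : g ≠ z := by
        rintro rfl
        exact hx (by simpa using hz x 1)
      have hgT : (⟨g, hg'⟩ : T) ∈ Subtype.val ⁻¹' X := hg
      exact mul_mem (ih hx' trivial) (Submonoid.subset_closure hgT)
  · rintro ⟨y, hy⟩
    refine ((hco y hy).preimage (f := Subtype.val) Subtype.val_injective.injOn).subset ?_
    rintro ⟨x, hx⟩ hxy ⟨p, q, hpq⟩
    subst hpq
    have hp : p ≠ z := by
      rintro rfl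
      exact hx (by simpa [mul_assoc] using hz 1 (y * q))
    have hq : q ≠ z := by
      rintro rfl
      exact hx (by simpa using hz (p * y) 1)
    exact hxy ⟨⟨p, hp⟩, ⟨q, hq⟩, rfl⟩

end Zero

/-- An infinite finitely generated monoid satisfying `ZimBelowSquare` has an infinite finitely
generated divisor in which every nonempty ideal is cofinite. -/
theorem ZimBelowSquare.exists_cofinite {M : Type*} [Monoid M] {k : ℕ} (hk : ZimBelowSquare M k)
    (hfg : MonoidFG M) [Infinite M] :
    ∃ (c : Con M) (T : Submonoid c.Quotient),
      Infinite T ∧ MonoidFG T ∧ ∀ y : T, {x | JLe x y}ᶜ.Finite := by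
  obtain ⟨c, hinf, hji⟩ := hfg.exists_justInfinite
  have hsurj := c.mk'_surjective
  refine ⟨c, ?_⟩
  by_cases hz : ∃ z : c.Quotient, ∀ p q, p * z * q = z
  · obtain ⟨z, hz⟩ := hz
    exact (hk.of_surjective _ hsurj).exists_submonoid_cofinite (hfg.of_surjective _ hsurj) hji hz
  · have e : c.Quotient ≃* (⊤ : Submonoid c.Quotient) := Submonoid.topEquiv.symm
    refine ⟨⊤, e.toEquiv.infinite_iff.1 hinf,
      (hfg.of_surjective _ hsurj).of_surjective e.toMonoidHom e.surjective, fun y => ?_⟩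
    have := (finite_compl_or_zero_of_justInfinite hji (y : c.Quotient)).resolve_right
      fun h => hz ⟨y, h⟩
    refine (this.preimage (f := Subtype.val) Subtype.val_injective.injOn).subset ?_
    rintro ⟨x, hx⟩ hxy ⟨p, q, hpq⟩
    exact hxy ⟨⟨p, trivial⟩, ⟨q, trivial⟩, Subtype.ext hpq⟩

/-! ### The group law -/

/-- The iterated commutator `[…[[s, (x i⁻¹ x j)^(y i j)], (x i'⁻¹ x j')^(y i' j')], …]` over the
pairs `(i, j)` in a list, where inverses are written as `d`-th powers. -/
def commWord {M ι : Type*} [Monoid M] (d : ℕ) (s : M) (x : ι → M) (y : ι × ι → M) :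
    List (ι × ι) → M
  | [] => s
  | p :: L =>
    let a := commWord d s x y L
    let b := y p ^ d * (x p.1 ^ d * x p.2) * y p
    a ^ d * b ^ d * a * b

theorem map_commWord {M N ι : Type*} [Monoid M] [Monoid N] {d : ℕ} (φ : M → N)
    (hmul : ∀ a b, φ (a * b) = φ a * φ b) (hpow : ∀ a, φ (a ^ d) = φ a ^ d) (s : M) (x : ι → M)
    (y : ι × ι → M) (L : List (ι × ι)) :
    φ (commWord d s x y L) = commWord d (φ s) (fun i => φ (x i)) (fun p => φ (y p)) L := by
  induction L with
  | nil => rfl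
  | cons p L ih => simp only [commWord, hmul, hpow, ih]

theorem commWord_congr {M ι : Type*} [Monoid M] (d : ℕ) (s : M) (x : ι → M) {y y' : ι × ι → M}
    {L : List (ι × ι)} (h : ∀ p ∈ L, y p = y' p) :
    commWord d s x y L = commWord d s x y' L := by
  induction L with
  | nil => rfl
  | cons p L ih =>
    rw [List.forall_mem_cons] at h
    simp only [commWord, ih h.2, h.1]

theorem pow_pred_eq_inv {G : Type*} [Group G] {E : ℕ} (hE : 0 < E) (hexp : ∀ a : G, a ^ E = 1)
    (a : G) : a ^ (E - 1) = a⁻¹ :=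
  eq_inv_of_mul_eq_one_left (by rw [← pow_succ, Nat.sub_add_cancel hE, hexp])

theorem commWord_eq_one {G ι : Type*} [Group G] {E : ℕ} (hE : 0 < E) (hexp : ∀ a : G, a ^ E = 1)
    (s : G) (x : ι → G) (y : ι × ι → G) {L : List (ι × ι)} {p : ι × ι} (hp : p ∈ L)
    (hx : x p.1 = x p.2) : commWord (E - 1) s x y L = 1 := by
  induction L with
  | nil => simp at hp
  | cons q L ih =>
    simp only [commWord, pow_pred_eq_inv hE hexp]
    rcases List.mem_cons.1 hp with rfl | hp
    · simp [hx]
    · rw [ih hp]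
      group

theorem JustInfinite.finite_of_ne_bot {G : Type*} [Group G]
    (hji : ∀ d : Con G, d ≠ ⊥ → Finite d.Quotient) (N : Subgroup G) [N.Normal] (hN : N ≠ ⊥) :
    N.FiniteIndex := by
  have : Finite (G ⧸ N) := by
    refine hji (QuotientGroup.con N) fun h => hN (eq_bot_iff.2 fun a ha => ?_)
    have : QuotientGroup.con N 1 a := QuotientGroup.leftRel_apply.2 (by simpa using ha)
    rw [h] at this
    exact Subgroup.mem_bot.2 (Eq.symm this)
  exact N.finiteIndex_of_finite_quotient

theorem JustInfinite.exists_commutator_ne_one {G : Type*} [Group G] [Infinite G] [Group.FG G]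
    (htor : IsMulTorsion G) (hji : ∀ d : Con G, d ≠ ⊥ → Finite d.Quotient) {u v : G} (hu : u ≠ 1)
    (hv : v ≠ 1) : ∃ y, u⁻¹ * (y⁻¹ * v * y)⁻¹ * u * (y⁻¹ * v * y) ≠ 1 := by
  by_contra! h
  have hcomm : ∀ y, y * v * y⁻¹ * u = u * (y * v * y⁻¹) := by
    intro y
    have := h y⁻¹
    rw [inv_inv, mul_assoc, ← mul_inv_rev, inv_mul_eq_one] at this
    exact this
  set N := Subgroup.normalClosure {v}
  set C := Subgroup.centralizer (N : Set G)
  have hN : N.FiniteIndex := JustInfinite.finite_of_ne_bot hji N fun h =>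
    hv (Subgroup.mem_bot.1 (h ▸ Subgroup.subset_normalClosure rfl))
  have huC : u ∈ C := by
    rw [Subgroup.mem_centralizer_iff]
    intro g hg
    have hle : N ≤ Subgroup.centralizer {u} := by
      refine (Subgroup.closure_le _).2 fun g hg => ?_
      obtain ⟨w, rfl, hw⟩ := Group.mem_conjugatesOfSet_iff.1 hg
      obtain ⟨y, rfl⟩ := isConj_iff.1 hw
      exact Subgroup.mem_centralizer_singleton_iff.2 (hcomm y)
    exact (Subgroup.mem_centralizer_singleton_iff.1 (hle hg))
  have hC : C.FiniteIndex := JustInfinite.finite_of_ne_bot hji C fun h =>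
    hu (Subgroup.mem_bot.1 (h ▸ huC))
  let A : Subgroup G := N ⊓ C
  have hA : A.FiniteIndex := inferInstance
  let _ : CommGroup A :=
    { (inferInstance : Group A) with
      mul_comm := fun a b => Subtype.ext
        ((Subgroup.mem_centralizer_iff.1 b.2.2 a a.2.1)) }
  have : Finite A := CommGroup.finite_of_fg_isMulTorsion _ (htor.subgroup A)
  exact not_finite_iff_infinite.2 ‹Infinite G›
    (Finite.of_equiv _ (Subgroup.groupEquivQuotientProdSubgroup (s := A)).symm)

theorem JustInfinite.exists_commWord_ne_one {G ι : Type*} [Group G] [Infinite G] [Group.FG G]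
    [DecidableEq ι] {E : ℕ} (hE : 0 < E) (hexp : ∀ a : G, a ^ E = 1)
    (hji : ∀ d : Con G, d ≠ ⊥ → Finite d.Quotient) {s : G} (hs : s ≠ 1) {x : ι → G}
    (hx : Function.Injective x) {L : List (ι × ι)} (hL : L.Nodup) (hLne : ∀ p ∈ L, p.1 ≠ p.2) :
    ∃ y, commWord (E - 1) s x y L ≠ 1 := by
  have htor : IsMulTorsion G := fun a => isOfFinOrder_iff_pow_eq_one.2 ⟨E, hE, hexp a⟩
  induction L with
  | nil => exact ⟨1, hs⟩
  | cons p L ih =>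
    rw [List.nodup_cons] at hL
    rw [List.forall_mem_cons] at hLne
    obtain ⟨y, hy⟩ := ih hL.2 hLne.2
    obtain ⟨c, hc⟩ := JustInfinite.exists_commutator_ne_one htor hji hy
      (v := (x p.1)⁻¹ * x p.2) fun h => hLne.1 (hx (inv_mul_eq_one.1 h))
    refine ⟨Function.update y p c, ?_⟩
    have : commWord (E - 1) s x (Function.update y p c) L = commWord (E - 1) s x y L :=
      commWord_congr _ _ _ fun q hq => Function.update_of_ne (ne_of_mem_of_not_mem hq hL.1) _ _
    simpa only [commWord, this, pow_pred_eq_inv hE hexp, Function.update_self] using hc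

/-- The pairs of distinct indices below `n`. -/
noncomputable def offDiagList (n : ℕ) : List (Fin n × Fin n) :=
  (Finset.univ.filter fun p : Fin n × Fin n => p.1 ≠ p.2).toList

theorem mem_offDiagList {n : ℕ} {p : Fin n × Fin n} : p ∈ offDiagList n ↔ p.1 ≠ p.2 := by
  simp [offDiagList]

theorem finite_of_commWord {G : Type*} [Group G] (hfg : MonoidFG G) {E n : ℕ} (hE : 0 < E)
    (hexp : ∀ a : G, a ^ E = 1)
    (hlaw : ∀ s x y, commWord (E - 1) s x y (offDiagList n) = (1 : G)) : Finite G := by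
  by_contra hfin
  have : Infinite G := not_finite_iff_infinite.1 hfin
  obtain ⟨c, hinf, hji⟩ := hfg.exists_justInfinite
  have hsurj := c.mk'_surjective
  have hfgQ : Group.FG c.Quotient := by
    obtain ⟨X, hX, hcl⟩ := hfg.of_surjective _ hsurj
    exact Group.fg_iff_monoid_fg.2 (Monoid.fg_iff.2 ⟨X, hcl, hX⟩)
  have hexpQ : ∀ a : c.Quotient, a ^ E = 1 := by
    intro a
    obtain ⟨a, rfl⟩ := hsurj a
    rw [← map_pow, hexp, map_one]
  obtain ⟨s, hs⟩ := exists_ne (1 : c.Quotient)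
  obtain ⟨y, hy⟩ := JustInfinite.exists_commWord_ne_one hE hexpQ hji hs
    ((Infinite.natEmbedding c.Quotient).injective.comp Fin.val_injective) (Finset.nodup_toList _)
    (L := offDiagList n) fun p => mem_offDiagList.1
  obtain ⟨s, rfl⟩ := hsurj s
  choose x hx using fun i : Fin n => hsurj (Infinite.natEmbedding c.Quotient i)
  choose y' hy' using fun p => hsurj (y p)
  apply hy
  have := map_commWord c.mk' (map_mul _) (fun a => map_pow _ a (E - 1)) s x y' (offDiagList n)
  rw [hlaw, map_one] at this
  simp only [hx, hy'] at this
  exact this.symm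

/-! ### A finite set of identities forcing local finiteness -/

theorem Satisfies.of_surjective {M N : Type*} [Monoid M] [Monoid N] {u v : Word}
    (h : Satisfies M u v) (φ : M →* N) (hφ : Function.Surjective φ) : Satisfies N u v := by
  intro f
  choose g hg using fun i => hφ (f (FreeMonoid.of i))
  have : f = φ.comp (FreeMonoid.lift g) := FreeMonoid.hom_eq fun i => by simp [hg]
  rw [this, MonoidHom.comp_apply, MonoidHom.comp_apply, h]

theorem Satisfies.of_injective {M N : Type*} [Monoid M] [Monoid N] {u v : Word}
    (h : Satisfies N u v) (φ : M →* N) (hφ : Function.Injective φ) : Satisfies M u v :=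
  fun f => hφ (h (φ.comp f))

theorem Corner.mul_lift_apply {M : Type*} [Monoid M] {e : M} {he : IsIdempotentElem e}
    (f : Word →* Corner he) (w : Word) :
    e * FreeMonoid.lift (fun i => (f (FreeMonoid.of i)).val) w = (f w).val := by
  induction w using FreeMonoid.inductionOn' with
  | one => simp [Corner.val_one]
  | of_mul a w ih =>
    rw [map_mul, map_mul, Corner.val_mul, FreeMonoid.lift_eval_of, ← ih, ← mul_assoc, ← mul_assoc,
      (f _).left_mul, (f _).mul_right]

theorem Satisfies.corner {M : Type*} [Monoid M] {u v : Word} (h : Satisfies M u v) {e : M}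
    (he : IsIdempotentElem e) : Satisfies (Corner he) u v := fun f =>
  Corner.ext (by rw [← Corner.mul_lift_apply, h, Corner.mul_lift_apply])

/-- The Zimin word on `k + 1` letters. -/
def zimWord (k : ℕ) : Word := zim (FreeMonoid.of 0) (fun i => FreeMonoid.of (i + 1)) k

theorem ZimBelowSquare.of_satisfies {M : Type*} [Monoid M] {k : ℕ} {P Q : Word}
    (h : Satisfies M (zimWord k) (P * (FreeMonoid.of 0 * FreeMonoid.of 0) * Q)) :
    ZimBelowSquare M k := by
  intro u t
  let f : Word →* M := FreeMonoid.lift fun i => i.casesOn u t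
  have := h f
  rw [zimWord, map_zim] at this
  simp only [map_mul] at this
  exact ⟨f P, f Q, this⟩

/-- The variables of the group law. -/
abbrev LawVar (n : ℕ) : Type := Unit ⊕ Fin n ⊕ Fin n × Fin n

/-- A variable of the group law, as a word. -/
def lawVar {n : ℕ} (v : LawVar n) : Word := FreeMonoid.of (Encodable.encode v)

/-- A power of the product of all the variables of the group law. -/
noncomputable def lawUnit (n E : ℕ) : Word :=
  ((Finset.univ : Finset (LawVar n)).toList.map lawVar).prod ^ E

/-- The left-hand side of the group law, relativized to the local submonoid at `lawUnit n E`. -/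
noncomputable def lawWord (n E : ℕ) : Word :=
  commWord (E - 1) (lawUnit n E * lawVar (.inl () : LawVar n) * lawUnit n E)
    (fun i : Fin n => lawUnit n E * lawVar (.inr (.inl i)) * lawUnit n E)
    (fun p => lawUnit n E * lawVar (.inr (.inr p)) * lawUnit n E) (offDiagList n)

theorem exists_lift_lawVar {M : Type*} [Monoid M] {n : ℕ} (g : LawVar n → M) :
    ∃ f : Word →* M, ∀ v, f (lawVar v) = g v :=
  ⟨FreeMonoid.lift fun i => ((Encodable.decode (α := LawVar n) i).map g).getD 1,
    fun v => by rw [lawVar, FreeMonoid.lift_eval_of, Encodable.encodek]; rfl⟩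

theorem map_lawWord {M : Type*} [Monoid M] {n E : ℕ} (f : Word →* M) :
    f (lawWord n E) = commWord (E - 1)
      (f (lawUnit n E) * f (lawVar (.inl () : LawVar n)) * f (lawUnit n E))
      (fun i : Fin n => f (lawUnit n E) * f (lawVar (.inr (.inl i))) * f (lawUnit n E))
      (fun p => f (lawUnit n E) * f (lawVar (.inr (.inr p))) * f (lawUnit n E))
      (offDiagList n) := by
  rw [lawWord, map_commWord f (map_mul f) fun a => map_pow f a _]
  simp only [map_mul]

theorem commWord_eq_one_of_satisfies {G : Type*} [Group G] {n E : ℕ}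
    (hexp : ∀ a : G, a ^ E = 1) (h : Satisfies G (lawWord n E) (lawUnit n E)) (s : G)
    (x : Fin n → G) (y : Fin n × Fin n → G) :
    commWord (E - 1) s x y (offDiagList n) = 1 := by
  obtain ⟨f, hf⟩ := exists_lift_lawVar (Sum.elim (fun _ => s) (Sum.elim x y))
  have hu : f (lawUnit n E) = 1 := by rw [lawUnit, map_pow, hexp]
  have := h f
  rw [map_lawWord, hu] at this
  simpa [hf] using this

theorem satisfies_lawWord {M : Type*} [Monoid M] [Finite M] {k n E : ℕ} (hk : ZimBelowSquare M k)
    (hE : 1 < E) (hper : ∀ x : M, IsIdempotentElem (x ^ E)) (hn : Nat.card M < n) :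
    Satisfies M (lawWord n E) (lawUnit n E) := by
  intro f
  have hE0 : 0 < E := by omega
  obtain ⟨e, he, hfe⟩ : ∃ (e : M), IsIdempotentElem e ∧ f (lawUnit n E) = e :=
    ⟨_, by rw [lawUnit, map_pow]; exact hper _, rfl⟩
  have hle : ∀ v : LawVar n, JLe e (f (lawVar v)) := by
    intro v
    obtain ⟨l₁, l₂, hl⟩ := List.append_of_mem (Finset.mem_toList.2 (Finset.mem_univ v))
    rw [← hfe, lawUnit, map_pow]
    refine (JLe.pow _ hE0).trans ⟨f (l₁.map lawVar).prod, f (l₂.map lawVar).prod, ?_⟩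
    rw [hl]
    simp [mul_assoc]
  have hunit : ∀ v : LawVar n, IsUnit (Corner.of he (f (lawVar v))) := fun v =>
    hk.isUnit_of hE0 hper he (hle v)
  choose g hg using hunit
  have hexp : ∀ a : (Corner he)ˣ, a ^ E = 1 := fun a =>
    IsIdempotentElem.iff_eq_one.1 (Units.ext (Corner.isIdempotentElem_pow hE0 hper (a : Corner he)))
  have hval : ∀ v, e * f (lawVar v) * e = (g v : Corner he).val := fun v => by
    rw [hg, Corner.val_of]
  rw [map_lawWord, hfe]
  simp only [hval]
  rw [← map_commWord (fun a : (Corner he)ˣ => (a : Corner he).val) (fun a b => rfl) fun a => by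
    rw [Units.val_pow_eq_pow_val, Corner.val_pow _ (by omega)]]
  have hninj : ¬ Function.Injective fun i : Fin n => (g (.inr (.inl i)) : Corner he).val := by
    intro hinj
    have := Nat.card_le_card_of_injective _ hinj
    rw [Nat.card_fin] at this
    omega
  obtain ⟨i, j, hij, hne⟩ := Function.not_injective_iff.1 hninj
  rw [commWord_eq_one hE0 hexp _ _ _ (p := (i, j)) (mem_offDiagList.2 hne)
    (Units.ext (Corner.ext hij))]
  rfl

theorem finite_of_satisfies {T : Type} [Monoid T] (hfg : MonoidFG T) {k n E : ℕ} {P Q : Word}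
    (hE : 1 < E)
    (hzim : Satisfies T (zimWord k) (P * (FreeMonoid.of 0 * FreeMonoid.of 0) * Q))
    (hpow : Satisfies T (FreeMonoid.of 0 ^ E * FreeMonoid.of 0 ^ E) (FreeMonoid.of 0 ^ E))
    (hlaw : Satisfies T (lawWord n E) (lawUnit n E)) : Finite T := by
  by_contra hfin
  have : Infinite T := not_finite_iff_infinite.1 hfin
  obtain ⟨c, S, hinf, hfgS, hco⟩ := (ZimBelowSquare.of_satisfies hzim).exists_cofinite hfg
  have htrans : ∀ {u v : Word}, Satisfies T u v → Satisfies S u v := fun h =>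
    (h.of_surjective _ c.mk'_surjective).of_injective S.subtype Subtype.val_injective
  have hper : ∀ x : S, IsIdempotentElem (x ^ E) := fun x => by
    simpa [IsIdempotentElem] using htrans hpow (FreeMonoid.lift fun _ => x)
  have hE0 : 0 < E := by omega
  refine not_finite_iff_infinite.2 hinf ((ZimBelowSquare.of_satisfies
    (htrans hzim)).finite_of_cofinite hE0 hper hfgS hco fun e he hfge hunit => ?_)
  have hsat := (htrans hlaw).corner he
  have hexp : ∀ a : Corner he, a ^ E = 1 := fun a => by
    have := Corner.isIdempotentElem_pow hE0 hper a
    obtain ⟨b, hb⟩ := (hunit (a ^ E))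
    rw [← hb] at this ⊢
    rw [IsIdempotentElem.iff_eq_one.1 (Units.ext this), Units.val_one]
  let _ : Group (Corner he) := groupOfIsUnit hunit
  exact finite_of_commWord hfge hE0 hexp (commWord_eq_one_of_satisfies hexp hsat)

theorem exists_pow_isIdempotentElem (M : Type*) [Monoid M] [Finite M] :
    ∃ E, 1 < E ∧ ∀ x : M, IsIdempotentElem (x ^ E) := by
  refine ⟨(Nat.card M + 1).factorial, ?_, fun x => ?_⟩
  · exact lt_of_lt_of_le (by have := Nat.card_pos (α := M); omega) (Nat.self_le_factorial _)
  · have hninj : ¬ Function.Injective fun i : Fin (Nat.card M + 1) => x ^ (i : ℕ) := by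
      intro hinj
      have := Nat.card_le_card_of_injective _ hinj
      rw [Nat.card_fin] at this
      omega
    obtain ⟨i, j, hij, hlt⟩ : ∃ i j : Fin (Nat.card M + 1), x ^ (i : ℕ) = x ^ (j : ℕ) ∧ i < j := by
      obtain ⟨i, j, hij, hne⟩ := Function.not_injective_iff.1 hninj
      rcases hne.lt_or_gt with h | h
      exacts [⟨i, j, hij, h⟩, ⟨j, i, hij.symm, h⟩]
    have hj := j.is_lt
    have hlt' : (i : ℕ) < j := hlt
    have hper : ∀ q a : ℕ, i ≤ a → x ^ (a + (j - i) * q) = x ^ a := by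
      intro q
      induction q with
      | zero => simp
      | succ q ih =>
        intro a ha
        obtain ⟨b, rfl⟩ := Nat.exists_eq_add_of_le ha
        rw [Nat.mul_succ, ← ih _ ha,
          show i + b + ((j - i) * q + (j - i)) = j + (b + (j - i) * q) by omega,
          show i + b + (j - i) * q = i + (b + (j - i) * q) by omega, pow_add, ← hij, ← pow_add]
    obtain ⟨q, hq⟩ := Nat.dvd_factorial (m := (j - i : ℕ)) (n := Nat.card M + 1) (by omega)
      (by omega)
    have hle := Nat.self_le_factorial (Nat.card M + 1)
    rw [IsIdempotentElem, ← pow_add]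
    have := hper q (Nat.card M + 1).factorial (by omega)
    rwa [← hq] at this

/-! ### Zimin words are isoterms of inherently nonfinitely based monoids -/

theorem FreeMonoid.exists_jLe_zim (α : Type*) [Finite α] (k : ℕ) :
    ∃ L, ∀ l : FreeMonoid α, L ≤ l.length →
      ∃ (u : FreeMonoid α) (t : ℕ → FreeMonoid α), u ≠ 1 ∧ JLe l (zim u t k) := by
  induction k with
  | zero =>
    refine ⟨1, fun l hl => ?_⟩
    induction l using FreeMonoid.casesOn with
    | one => simp at hl
    | of_mul a l => exact ⟨FreeMonoid.of a, fun _ => 1, FreeMonoid.of_ne_one a, 1, l, by simp [zim]⟩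
  | succ k ih =>
    obtain ⟨L, hL⟩ := ih
    refine ⟨(Nat.card (List.Vector α L) + 1) * L, fun l hl => ?_⟩
    have hlen : ∀ i : Fin (Nat.card (List.Vector α L) + 1), i * L + L ≤ l.length := fun i =>
      (Nat.succ_mul i L).symm.le.trans ((Nat.mul_le_mul_right L i.is_lt).trans hl)
    let B (i : Fin (Nat.card (List.Vector α L) + 1)) : List.Vector α L :=
      ⟨(l.toList.drop (i * L)).take L, by
        have := hlen i
        rw [FreeMonoid.length] at this
        simp only [List.length_take, List.length_drop]
        omega⟩
    have hninj : ¬ Function.Injective B := by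
      intro hinj
      have := Nat.card_le_card_of_injective _ hinj
      rw [Nat.card_fin] at this
      omega
    obtain ⟨i, j, hij, hlt⟩ : ∃ i j, B i = B j ∧ i < j := by
      obtain ⟨i, j, hij, hne⟩ := Function.not_injective_iff.1 hninj
      rcases hne.lt_or_gt with h | h
      exacts [⟨i, j, hij, h⟩, ⟨j, i, hij.symm, h⟩]
    obtain ⟨d, hd⟩ := Nat.exists_eq_add_of_lt (Fin.lt_def.1 hlt)
    have hBij : (l.toList.drop (i * L)).take L = (l.toList.drop (j * L)).take L :=
      congrArg Subtype.val hij
    obtain ⟨m, hm⟩ : ∃ m, l.toList.drop (i * L + L) = m ++ l.toList.drop (j * L) := by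
      refine ⟨(l.toList.drop (i * L + L)).take (d * L), ?_⟩
      conv_lhs => rw [← List.take_append_drop (d * L) (l.toList.drop (i * L + L))]
      rw [List.drop_drop, hd]
      congr 2
      ring
    obtain ⟨u, t, hu, p, q, hpq⟩ := hL (FreeMonoid.ofList ((l.toList.drop (i * L)).take L)) (by
      have := hlen i
      rw [FreeMonoid.length] at this
      simp only [FreeMonoid.length, FreeMonoid.toList_ofList, List.length_take, List.length_drop]
      omega)
    have hsplit : l = FreeMonoid.ofList (l.toList.take (i * L)) *
        (FreeMonoid.ofList ((l.toList.drop (i * L)).take L) * (FreeMonoid.ofList m *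
        (FreeMonoid.ofList ((l.toList.drop (i * L)).take L) *
          FreeMonoid.ofList (l.toList.drop (j * L + L))))) := by
      apply FreeMonoid.toList.injective
      simp only [FreeMonoid.toList_mul, FreeMonoid.toList_ofList]
      conv_rhs => enter [2, 2, 2, 1]; rw [hBij]
      rw [← List.drop_drop (i := L), List.take_append_drop, ← hm, ← List.drop_drop,
        List.take_append_drop, List.take_append_drop]
    refine ⟨u, Function.update t k (q * FreeMonoid.ofList m * p), hu,
      FreeMonoid.ofList (l.toList.take (i * L)) * p,
      q * FreeMonoid.ofList (l.toList.drop (j * L + L)), ?_⟩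
    rw [zim, Function.update_self, zim_congr u (t' := t) fun n hn =>
      Function.update_of_ne hn.ne _ _]
    conv_lhs => rw [hsplit, hpq]
    simp only [mul_assoc]

/-- The word `0 b₁ 0 b₂ 0 … bₙ 0`. -/
def interleaveZero : List ℕ → List ℕ
  | [] => [0]
  | a :: b => 0 :: a :: interleaveZero b

theorem interleaveZero_append_cons (b c : List ℕ) (a : ℕ) :
    interleaveZero (b ++ a :: c) = interleaveZero b ++ a :: interleaveZero c := by
  induction b with
  | nil => rfl
  | cons _ _ ih => simp [interleaveZero, ih]

theorem interleaveZero_filter_zimWord (k : ℕ) :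
    interleaveZero ((zimWord k).toList.filter (· ≠ 0)) = (zimWord k).toList := by
  unfold zimWord
  induction k with
  | zero => rfl
  | succ k ih =>
    simp only [zim, FreeMonoid.toList_mul, FreeMonoid.toList_of, List.append_assoc,
      List.singleton_append, List.filter_append, ne_eq, Nat.add_eq_zero_iff, one_ne_zero, and_false,
      not_false_eq_true, decide_true, List.filter_cons_of_pos]
    rw [interleaveZero_append_cons]
    simp only [ne_eq] at ih
    rw [ih]

theorem sum_map_lt_interleaveZero {g : ℕ → ℕ} (hg : 0 < g 0) (w : List ℕ)
    (hw : ∀ p q, w ≠ p ++ 0 :: 0 :: q) :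
    w = interleaveZero (w.filter (· ≠ 0)) ∨
      (w.map g).sum < ((interleaveZero (w.filter (· ≠ 0))).map g).sum := by
  induction h : w.length using Nat.strong_induction_on generalizing w with
  | _ n ih =>
  subst h
  match w with
  | [] => simpa [interleaveZero] using hg
  | [0] => simp [interleaveZero]
  | 0 :: 0 :: w => exact absurd rfl (hw [] w)
  | 0 :: (a + 1) :: w =>
    have := ih _ (by simp) w (fun p q h => hw (0 :: (a + 1) :: p) q (by simp [h])) rfl
    simp only [ne_eq] at this
    simp only [interleaveZero, ne_eq, not_true_eq_false, decide_false, Bool.false_eq_true,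
      not_false_eq_true, List.filter_cons_of_neg, Nat.add_eq_zero_iff, one_ne_zero, and_false,
      decide_true, List.filter_cons_of_pos, List.cons.injEq, true_and, List.map_cons, List.sum_cons]
    rcases this with h | h
    · exact Or.inl h
    · right
      omega
  | (a + 1) :: w =>
    have := ih _ (by simp) w (fun p q h => hw ((a + 1) :: p) q (by simp [h])) rfl
    have hle : (w.map g).sum ≤ ((interleaveZero (w.filter (· ≠ 0))).map g).sum := by
      rcases this with h | h
      · exact (congrArg (fun w => (w.map g).sum) h).le
      · exact h.le
    right
    simp only [ne_eq] at hle
    simp only [interleaveZero, ne_eq, Nat.add_eq_zero_iff, one_ne_zero, and_false,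
      not_false_eq_true, decide_true, List.filter_cons_of_pos, List.map_cons, List.sum_cons]
    omega

theorem zim_succ' {M : Type*} [Monoid M] (u : M) (t : ℕ → M) (k : ℕ) :
    zim u t (k + 1) = zim (u * t 0 * u) (fun i => t (i + 1)) k := by
  induction k with
  | zero => rfl
  | succ k ih => rw [zim, ih, zim]

/-- The endomorphism erasing the letter `0` and decrementing all other letters. -/
def eraseZero : Word →* Word := FreeMonoid.lift fun i => i.casesOn 1 FreeMonoid.of

theorem eraseZero_zimWord_succ (k : ℕ) : eraseZero (zimWord (k + 1)) = zimWord k := by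
  rw [zimWord, map_zim, zim_succ']
  simp [eraseZero, zimWord]

theorem toList_eraseZero (w : Word) :
    (eraseZero w).toList.map (· + 1) = w.toList.filter (· ≠ 0) := by
  induction w using FreeMonoid.inductionOn' with
  | one => rfl
  | of_mul a w ih =>
    cases a <;> simp_all [eraseZero]

theorem FreeMonoid.length_map {α : Type*} (f : Word →* FreeMonoid α) (w : Word) :
    (f w).length = (w.toList.map fun i => (f (FreeMonoid.of i)).length).sum := by
  induction w using FreeMonoid.inductionOn' with
  | one => simp
  | of_mul a w ih => simp [FreeMonoid.length_mul, ih]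

theorem finite_of_satisfies_zimWord {T : Type*} [Monoid T] (hfg : MonoidFG T) {k : ℕ} {w : Word}
    (h : Satisfies T (zimWord k) w)
    (hlt : ∀ g : ℕ → ℕ, 0 < g 0 → (w.toList.map g).sum < ((zimWord k).toList.map g).sum) :
    Finite T := by
  obtain ⟨X, hX, hcl⟩ := hfg
  have := hX.to_subtype
  let π : FreeMonoid X →* T := FreeMonoid.lift Subtype.val
  have hπ : Function.Surjective π := by
    rw [← MonoidHom.mrange_eq_top, FreeMonoid.mrange_lift, Subtype.range_val, hcl]
  obtain ⟨L, hL⟩ := FreeMonoid.exists_jLe_zim X k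
  have hfin : Finite {l : FreeMonoid X // l.length < L} := (List.finite_length_lt X L).to_subtype
  refine Finite.of_surjective (fun l : {l : FreeMonoid X // l.length < L} => π l) fun a => ?_
  obtain ⟨l, rfl⟩ := hπ a
  induction hn : l.length using Nat.strong_induction_on generalizing l with
  | _ n ih =>
  subst hn
  by_cases hlen : l.length < L
  · exact ⟨⟨l, hlen⟩, rfl⟩
  obtain ⟨u, t, hu, p, q, hpq⟩ := hL l (not_lt.1 hlen)
  let f : Word →* FreeMonoid X := FreeMonoid.lift fun i => i.casesOn u t
  have hf : f (zimWord k) = zim u t k := by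
    rw [zimWord, map_zim]
    rfl
  have hl : π l = π (p * f w * q) := by
    have := h (π.comp f)
    simp only [MonoidHom.comp_apply, hf] at this
    simp only [hpq, map_mul, this]
  rw [hl]
  refine ih _ ?_ _ rfl
  rw [hpq, ← hf]
  have := hlt (fun i => (f (FreeMonoid.of i)).length) (Nat.pos_of_ne_zero fun h0 => hu (by
    simpa [f] using h0))
  rw [← FreeMonoid.length_map, ← FreeMonoid.length_map] at this
  simp only [FreeMonoid.length_mul]
  omega

theorem exists_pow_eq_self_of_satisfies_of {M : Type*} [Monoid M] {w : Word}
    (h : Satisfies M (FreeMonoid.of 0) w) (hne : w ≠ FreeMonoid.of 0) :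
    ∃ j, ∀ a : M, a ^ (j + 2) = a := by
  by_cases hw : ∀ i ∈ w.toList, i = 0
  · have hrep := List.eq_replicate_of_mem hw
    have hpow : ∀ a : M, a ^ w.toList.length = a := fun a => by
      have := h (FreeMonoid.lift fun _ => a)
      rw [FreeMonoid.lift_eval_of, FreeMonoid.lift_apply, List.map_const', List.prod_replicate]
        at this
      exact this.symm
    match hlen : w.toList.length with
    | 0 =>
      rw [hlen] at hpow
      exact ⟨0, fun a => by rw [← hpow a, pow_zero, one_pow]⟩
    | 1 =>
      rw [hlen] at hrep
      exact absurd (FreeMonoid.toList.injective hrep) hne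
    | j + 2 =>
      rw [hlen] at hpow
      exact ⟨j, hpow⟩
  · have hprod : ∀ (a : M) (l : List ℕ),
        (l.map fun i => if i = 0 then 1 else a).prod = a ^ l.countP (· ≠ 0) := fun a l => by
      induction l with
      | nil => simp
      | cons i l ih =>
        by_cases hi : i = 0 <;> simp [hi, ih, pow_succ']
    have hpos : 0 < w.toList.countP (· ≠ 0) := by
      rw [List.countP_pos_iff]
      push Not at hw
      simpa using hw
    refine ⟨w.toList.countP (· ≠ 0) - 1, fun a => ?_⟩
    have := h (FreeMonoid.lift fun i => if i = 0 then 1 else a)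
    rw [FreeMonoid.lift_eval_of, FreeMonoid.lift_apply, hprod, if_pos rfl] at this
    rw [show w.toList.countP (· ≠ 0) - 1 + 2 = w.toList.countP (· ≠ 0) + 1 by omega, pow_succ,
      ← this, one_mul]

theorem isoterm_zimWord {M : Type} [Monoid M] [Finite M]
    (h : ¬ ∃ Sig : Set (Word × Word), Sig.Finite ∧
        (∀ p ∈ Sig, Satisfies M p.1 p.2) ∧
        (∀ (N : Type) [Monoid N], MonoidFG N →
          (∀ p ∈ Sig, Satisfies N p.1 p.2) → Finite N)) (k : ℕ) : Isoterm M (zimWord k) := by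
  have hB : ∀ (k : ℕ) (P Q : Word),
      ¬ Satisfies M (zimWord k) (P * (FreeMonoid.of 0 * FreeMonoid.of 0) * Q) := by
    intro k P Q hsat
    obtain ⟨E, hE, hper⟩ := exists_pow_isIdempotentElem M
    refine h ⟨{(zimWord k, P * (FreeMonoid.of 0 * FreeMonoid.of 0) * Q),
      (FreeMonoid.of 0 ^ E * FreeMonoid.of 0 ^ E, FreeMonoid.of 0 ^ E),
      (lawWord (Nat.card M + 1) E, lawUnit (Nat.card M + 1) E)}, Set.toFinite _, ?_, ?_⟩
    · rintro _ (rfl | rfl | rfl)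
      · exact hsat
      · intro f
        simpa using (hper (f (FreeMonoid.of 0))).eq
      · exact satisfies_lawWord (ZimBelowSquare.of_satisfies hsat) hE hper (Nat.lt_succ_self _)
    · intro N _ hN hSig
      exact finite_of_satisfies hN hE (hSig (_, _) (Or.inl rfl))
        (hSig (_, _) (Or.inr (Or.inl rfl))) (hSig (_, _) (Or.inr (Or.inr rfl)))
  induction k with
  | zero =>
    intro w hw
    by_contra hne
    obtain ⟨j, hj⟩ := exists_pow_eq_self_of_satisfies_of hw hne
    refine hB 0 1 (FreeMonoid.of 0 ^ j) fun f => ?_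
    rw [one_mul, ← pow_two, ← pow_add, map_pow, add_comm, hj]
    rfl
  | succ k ih =>
    intro w hw
    have herase : eraseZero w = eraseZero (zimWord (k + 1)) := by
      rw [eraseZero_zimWord_succ]
      refine ih _ fun f => ?_
      rw [← eraseZero_zimWord_succ]
      exact hw (f.comp eraseZero)
    have hfilter : w.toList.filter (· ≠ 0) = (zimWord (k + 1)).toList.filter (· ≠ 0) := by
      rw [← toList_eraseZero, ← toList_eraseZero, herase]
    have hno : ∀ p q, w.toList ≠ p ++ 0 :: 0 :: q := by
      intro p q hpq
      refine hB (k + 1) (FreeMonoid.ofList p) (FreeMonoid.ofList q) ?_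
      convert hw
      apply FreeMonoid.toList.injective
      simp [hpq]
    by_contra hne
    refine h ⟨{(zimWord (k + 1), w)}, Set.toFinite _, by simpa using hw, fun N _ hN hSig => ?_⟩
    refine finite_of_satisfies_zimWord hN (hSig _ rfl) fun g hg => ?_
    have := sum_map_lt_interleaveZero hg _ hno
    rw [hfilter, interleaveZero_filter_zimWord] at this
    exact this.resolve_left fun h => hne (FreeMonoid.toList.injective h)

/-! ### Isoterms containing many linear letters -/

theorem Isoterm.of_factor {M : Type*} [Monoid M] {p w q : Word} (h : Isoterm M (p * w * q)) :
    Isoterm M w := fun w' hw => by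
  have := h (p * w' * q) fun f => by simp only [map_mul, hw f]
  exact mul_left_cancel (mul_right_cancel this)

theorem Isoterm.of_map {M : Type*} [Monoid M] {w : Word} {φ : Word →* Word}
    (hφ : Function.Injective φ) (h : Isoterm M (φ w)) : Isoterm M w := fun _ hw =>
  hφ (h _ fun f => hw (f.comp φ))

theorem FreeMonoid.lift_of_mul_injective {α : Type*} (g : α → FreeMonoid α) :
    Function.Injective (FreeMonoid.lift fun a => FreeMonoid.of a * g a) := by
  intro u
  induction u using FreeMonoid.inductionOn' with
  | one =>
    intro v h
    induction v using FreeMonoid.casesOn with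
    | one => rfl
    | of_mul a v =>
      have := congrArg FreeMonoid.length h
      simp at this
      omega
  | of_mul a u ih =>
    intro v h
    induction v using FreeMonoid.casesOn with
    | one => simpa using congrArg FreeMonoid.length h
    | of_mul b v =>
      have hab : a = b := by
        simpa using congrArg (fun w => (FreeMonoid.toList w).head?) h
      subst hab
      rw [map_mul, map_mul] at h
      rw [ih (mul_left_cancel h)]

theorem FreeMonoid.lift_mul_of_injective {α : Type*} (g : α → FreeMonoid α) :
    Function.Injective (FreeMonoid.lift fun a => g a * FreeMonoid.of a) := by
  have key : ∀ u, (FreeMonoid.lift fun a => g a * FreeMonoid.of a) u =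
      ((FreeMonoid.lift fun a => FreeMonoid.of a * (g a).reverse) u.reverse).reverse := by
    intro u
    induction u using FreeMonoid.inductionOn' with
    | one => rfl
    | of_mul a u ih => simp [ih, FreeMonoid.reverse_mul]
  intro u v h
  rw [key, key] at h
  exact List.reverse_injective (FreeMonoid.lift_of_mul_injective _ (List.reverse_injective h))

theorem le_of_mem_zimWord {a k : ℕ} (h : a ∈ (zimWord k).toList) : a ≤ k := by
  unfold zimWord at h
  induction k with
  | zero => simpa [zim] using h
  | succ k ih =>
    simp only [zim, FreeMonoid.toList_mul, FreeMonoid.toList_of, List.mem_append,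
      List.mem_singleton] at h
    rcases h with (h | h) | h
    · exact (ih h).trans k.le_succ
    · exact h.le
    · exact (ih h).trans k.le_succ

theorem exists_zimWord_eq_mul_of_le {k l : ℕ} (h : k ≤ l) : ∃ q, zimWord l = zimWord k * q := by
  induction l, h using Nat.le_induction with
  | base => exact ⟨1, (mul_one _).symm⟩
  | succ l _ ih =>
    obtain ⟨q, hq⟩ := ih
    refine ⟨q * FreeMonoid.of (l + 1) * zimWord l, ?_⟩
    rw [← mul_assoc, ← mul_assoc, ← hq]
    rfl

theorem exists_zimWord_eq_mul_zero (k : ℕ) : ∃ p, zimWord k = p * FreeMonoid.of 0 := by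
  induction k with
  | zero => exact ⟨1, rfl⟩
  | succ k ih =>
    obtain ⟨p, hp⟩ := ih
    refine ⟨zimWord k * FreeMonoid.of (k + 1) * p, ?_⟩
    rw [mul_assoc _ p, ← hp]
    rfl

theorem exists_zimWord_eq_mul_block {a k : ℕ} (ha : 0 < a) (hak : a ≤ k) :
    ∃ p q, zimWord k = p * (FreeMonoid.of 0 * FreeMonoid.of a * FreeMonoid.of 0) * q := by
  obtain ⟨a, rfl⟩ := Nat.exists_eq_succ_of_ne_zero ha.ne'
  obtain ⟨p, hp⟩ := exists_zimWord_eq_mul_zero a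
  obtain ⟨q, hq⟩ := exists_zimWord_eq_mul_of_le (Nat.zero_le a)
  obtain ⟨r, hr⟩ := exists_zimWord_eq_mul_of_le hak
  refine ⟨p, q * r, ?_⟩
  calc zimWord k = zimWord a * FreeMonoid.of (a + 1) * zimWord a * r := hr
    _ = p * FreeMonoid.of 0 * FreeMonoid.of (a + 1) * (FreeMonoid.of 0 * q) * r := by
      conv_lhs => enter [1, 2]; rw [hq]
      rw [hp]
      rfl
    _ = _ := by simp only [mul_assoc]

theorem FreeMonoid.lift_eq_self {α : Type*} {g : α → FreeMonoid α} {w : FreeMonoid α}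
    (h : ∀ a ∈ w.toList, g a = FreeMonoid.of a) : FreeMonoid.lift g w = w := by
  induction w using FreeMonoid.inductionOn' with
  | one => rfl
  | of_mul a w ih =>
    simp only [FreeMonoid.toList_of_mul, List.mem_cons, forall_eq_or_imp] at h
    rw [map_mul, FreeMonoid.lift_eval_of, h.1, ih h.2]

/-- The word `0 y₀ 0 t₀ 0 y₁ 0 t₁ … 0 yₖ 0`, in which each `tᵢ = 8i + 6` is a separate letter. -/
def chainWord (y : ℕ → ℕ) : ℕ → Word
  | 0 => FreeMonoid.of 0 * FreeMonoid.of (y 0) * FreeMonoid.of 0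
  | k + 1 => chainWord y k * FreeMonoid.of (8 * k + 6) *
      (FreeMonoid.of 0 * FreeMonoid.of (y (k + 1)) * FreeMonoid.of 0)

theorem exists_injective_chainWord {y : ℕ → ℕ} (hpos : ∀ i, 0 < y i) (hmod : ∀ i, y i % 8 ≠ 6)
    (hle : ∀ i, y i ≤ 4 * i + 1) (k : ℕ) :
    ∃ φ : Word →* Word, Function.Injective φ ∧
      (∀ a, a % 8 ≠ 6 ∨ 8 * k + 6 ≤ a → φ (FreeMonoid.of a) = FreeMonoid.of a) ∧
      ∃ p q, zimWord (8 * k + 5) = p * φ (chainWord y k) * q := by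
  induction k with
  | zero =>
    refine ⟨MonoidHom.id _, Function.injective_id, fun _ _ => rfl, ?_⟩
    exact exists_zimWord_eq_mul_block (hpos 0) ((hle 0).trans (by norm_num))
  | succ k ih =>
    obtain ⟨φ, hinj, hfix, p, q, hpq⟩ := ih
    obtain ⟨g, g', hg⟩ := exists_zimWord_eq_mul_block (k := 8 * k + 5) (hpos (k + 1))
      (show y (k + 1) ≤ 8 * k + 5 by have := hle (k + 1); omega)
    have hmem : ∀ x y z : Word, zimWord (8 * k + 5) = x * y * z →
        ∀ a ∈ y.toList, a ≠ 8 * k + 6 := by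
      rintro x y z hxyz a ha rfl
      have : 8 * k + 6 ∈ (zimWord (8 * k + 5)).toList := by simp [hxyz, ha]
      have := le_of_mem_zimWord this
      omega
    let R : Word →* Word := FreeMonoid.lift fun a =>
      FreeMonoid.of a * Function.update (1 : ℕ → Word) (8 * k + 6) g a
    let L : Word →* Word := FreeMonoid.lift fun a =>
      Function.update (1 : ℕ → Word) (8 * k + 6) q a * FreeMonoid.of a
    have hR : ∀ w : Word, (∀ a ∈ w.toList, a ≠ 8 * k + 6) → R w = w := fun w hw =>
      FreeMonoid.lift_eq_self fun a ha => by simp [Function.update_of_ne (hw a ha)]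
    have hL : ∀ w : Word, (∀ a ∈ w.toList, a ≠ 8 * k + 6) → L w = w := fun w hw =>
      FreeMonoid.lift_eq_self fun a ha => by simp [Function.update_of_ne (hw a ha)]
    have hRL : ∀ w : Word, (∀ a ∈ w.toList, a ≠ 8 * k + 6) → R (L w) = w := fun w hw => by
      rw [hL w hw, hR w hw]
    have hRLt : R (L (FreeMonoid.of (8 * k + 6))) = q * FreeMonoid.of (8 * k + 6) * g := by
      have : L (FreeMonoid.of (8 * k + 6)) = q * FreeMonoid.of (8 * k + 6) := by simp [L]
      rw [this, map_mul, hR q (hmem (p * φ (chainWord y k)) q 1 (by rw [hpq, mul_one]))]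
      simp [R, mul_assoc]
    have hnot : 8 * (k + 1) + 6 ≠ 8 * k + 6 := by omega
    refine ⟨R.comp (L.comp φ), ?_, fun a ha => ?_, ?_⟩
    · exact (FreeMonoid.lift_of_mul_injective _).comp
        ((FreeMonoid.lift_mul_of_injective _).comp hinj)
    · rw [MonoidHom.comp_apply, MonoidHom.comp_apply, hfix a (by omega)]
      refine hRL _ fun b hb => ?_
      simp only [FreeMonoid.toList_of, List.mem_singleton] at hb
      omega
    · have hy : φ (FreeMonoid.of 0 * FreeMonoid.of (y (k + 1)) * FreeMonoid.of 0) =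
          FreeMonoid.of 0 * FreeMonoid.of (y (k + 1)) * FreeMonoid.of 0 := by
        rw [map_mul, map_mul, hfix 0 (by simp), hfix _ (Or.inl (hmod _))]
      obtain ⟨r, hr⟩ := exists_zimWord_eq_mul_of_le (show 8 * k + 5 + 1 ≤ 8 * (k + 1) + 5 by omega)
      refine ⟨p, g' * r, ?_⟩
      simp only [MonoidHom.comp_apply, chainWord, map_mul _ (_ * FreeMonoid.of (8 * k + 6)),
        map_mul _ (chainWord y k), hy]
      rw [hfix (8 * k + 6) (by simp), hRLt, hRL _ (hmem _ _ _ hpq),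
        hRL _ (hmem _ _ _ hg), hr]
      change zimWord (8 * k + 5) * FreeMonoid.of (8 * k + 6) * zimWord (8 * k + 5) * r = _
      conv_lhs => enter [1, 2]; rw [hg]
      rw [hpq]
      simp only [mul_assoc]

theorem isoterm_chainWord {M : Type*} [Monoid M] (h : ∀ k, Isoterm M (zimWord k)) {y : ℕ → ℕ}
    (hpos : ∀ i, 0 < y i) (hmod : ∀ i, y i % 8 ≠ 6) (hle : ∀ i, y i ≤ 4 * i + 1) (k : ℕ) :
    Isoterm M (chainWord y k) := by
  obtain ⟨φ, hinj, -, p, q, hpq⟩ := exists_injective_chainWord hpos hmod hle k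
  have := h (8 * k + 5)
  rw [hpq] at this
  exact this.of_factor.of_map hinj

/-! ### Chain words that do not contain values of one another -/

/-- The letter at position `p` of a sufficiently long word `chainWord y k`. -/
def chainLetter (y : ℕ → ℕ) (p : ℕ) : ℕ :=
  if p % 2 = 0 then 0 else if p % 4 = 1 then y (p / 4) else 2 * p

theorem toList_chainWord (y : ℕ → ℕ) (k : ℕ) :
    (chainWord y k).toList = (List.range (4 * k + 3)).map (chainLetter y) := by
  have h0 : ∀ i, chainLetter y (4 * i) = 0 := fun i => if_pos (by omega)
  have h2 : ∀ i, chainLetter y (4 * i + 2) = 0 := fun i => if_pos (by omega)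
  have h1 : ∀ i, chainLetter y (4 * i + 1) = y i := fun i => by
    rw [chainLetter, if_neg (by omega), if_pos (by omega)]
    congr 1
    omega
  have h3 : ∀ i, chainLetter y (4 * i + 3) = 8 * i + 6 := fun i => by
    rw [chainLetter, if_neg (by omega), if_neg (by omega)]
    omega
  induction k with
  | zero => simp [chainWord, List.range_succ, h0 0, h1 0, h2 0]
  | succ k ih =>
    have h4 := h0 (k + 1)
    have h5 := h1 (k + 1)
    have h6 := h2 (k + 1)
    rw [mul_add] at h4 h5 h6 ⊢
    simp only [chainWord, FreeMonoid.toList_mul, FreeMonoid.toList_of, ih, mul_one, add_assoc,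
      Nat.reduceAdd, List.range_succ, List.map_append, List.map_cons, List.map_nil,
      List.append_assoc] at h4 h5 h6 ⊢
    rw [h3, h4, h5, h6]

/-- The sequence of letters in which `2` marks the places `1`, `2n + 2` and `2n + 4`, and the
other places `i ≤ 2n + 3` are matched in pairs `{i, i + 3}` with `i` even. -/
def cycleLetter (n i : ℕ) : ℕ :=
  if i = 1 ∨ i = 2 * n + 2 ∨ i = 2 * n + 4 then 2 else if i % 2 = 1 then 4 * i - 11 else 4 * i + 1

/-- The `n`-th member of an infinite family of words none of which contains a value of another. -/
def cycleWord (n : ℕ) : Word := chainWord (cycleLetter n) (2 * n + 4)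

theorem isoterm_cycleWord {M : Type*} [Monoid M] (h : ∀ k, Isoterm M (zimWord k)) (n : ℕ) :
    Isoterm M (cycleWord n) := by
  refine isoterm_chainWord h (fun i => ?_) (fun i => ?_) (fun i => ?_) _ <;>
    unfold cycleLetter <;> split_ifs <;> omega

theorem toList_cycleWord (n : ℕ) :
    (cycleWord n).toList = (List.range (8 * n + 19)).map (chainLetter (cycleLetter n)) := by
  rw [cycleWord, toList_chainWord]
  congr 2
  ring

theorem cases_of_chainLetter_eq {n x y : ℕ} (hxy : x < y)
    (h : chainLetter (cycleLetter n) x = chainLetter (cycleLetter n) y) :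
    (x % 2 = 0 ∧ y % 2 = 0) ∨
    ((x = 5 ∨ x = 8 * n + 9 ∨ x = 8 * n + 17) ∧ (y = 5 ∨ y = 8 * n + 9 ∨ y = 8 * n + 17)) ∨
    (x % 8 = 1 ∧ y = x + 12 ∧ x ≠ 8 * n + 9 ∧ x ≠ 8 * n + 17) := by
  unfold chainLetter cycleLetter at h
  split_ifs at h <;> omega

theorem chainLetter_cycleLetter_even (n : ℕ) {p : ℕ} (hp : p % 2 = 0) :
    chainLetter (cycleLetter n) p = 0 := if_pos hp

theorem chainLetter_cycleLetter_mark {n p : ℕ} (hp : p = 5 ∨ p = 8 * n + 9 ∨ p = 8 * n + 17) :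
    chainLetter (cycleLetter n) p = 2 := by
  unfold chainLetter cycleLetter
  rw [if_neg (by omega), if_pos (by omega), if_pos (by omega)]

theorem chainLetter_cycleLetter_add_twelve {n k : ℕ} (hk : k ≤ n) :
    chainLetter (cycleLetter n) (8 * k + 13) = chainLetter (cycleLetter n) (8 * k + 1) := by
  unfold chainLetter cycleLetter
  split_ifs <;> omega

/-- An embedding of a value of `cycleWord m` into `cycleWord n` that does not erase `0`, given by
the places `F p` at which the values of the letters begin and by their lengths, forces `m = n`. -/
theorem eq_of_cycleWord_places {m n : ℕ} {F len : ℕ → ℕ} (h0 : 0 < len 0)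
    (hF : ∀ p < 8 * m + 19, F (p + 1) = F p + len (chainLetter (cycleLetter m) p))
    (hval : ∀ p < 8 * m + 19, ∀ q < 8 * m + 19,
      chainLetter (cycleLetter m) p = chainLetter (cycleLetter m) q →
      ∀ r < len (chainLetter (cycleLetter m) p),
        chainLetter (cycleLetter n) (F p + r) = chainLetter (cycleLetter n) (F q + r)) :
    m = n := by
  have heven : ∀ p < 8 * m + 19, p % 2 = 0 → F (p + 1) = F p + len 0 := fun p hp hp2 => by
    rw [hF p hp, chainLetter_cycleLetter_even m hp2]
  have hlt : ∀ p, p + 2 < 8 * m + 19 → p % 2 = 0 → F p < F (p + 2) := fun p hp hp2 => by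
    have := heven p (by omega) hp2
    have : F (p + 2) = _ := hF (p + 1) (by omega)
    omega
  have hzero : ∀ r < len 0, (F 0 + r) % 2 = 0 := by
    intro r hr
    have hv : ∀ p < 8 * m + 19, ∀ q < 8 * m + 19, p % 2 = 0 → q % 2 = 0 →
        chainLetter (cycleLetter n) (F p + r) = chainLetter (cycleLetter n) (F q + r) :=
      fun p hp q hq hp2 hq2 => hval p hp q hq
        (by rw [chainLetter_cycleLetter_even m hp2, chainLetter_cycleLetter_even m hq2]) r
        (by rwa [chainLetter_cycleLetter_even m hp2])
    have h := fun p hp hp2 => cases_of_chainLetter_eq (n := n) (x := F p + r) (y := F (p + 2) + r)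
      (Nat.add_lt_add_right (hlt p hp hp2) r) (hv _ (by omega) _ hp hp2 (by omega))
    have h02 := h 0 (by omega) rfl
    have h24 := h 2 (by omega) rfl
    have h46 := h 4 (by omega) rfl
    have h2 := hlt 0 (by omega) rfl
    have h4 := hlt 2 (by omega) rfl
    have h6 := hlt 4 (by omega) rfl
    simp only [zero_add, Nat.reduceAdd] at h02 h24 h46 h2 h4 h6
    omega
  have hlen : len 0 = 1 := by
    have := hzero 0 h0
    by_contra hne
    have := hzero 1 (by omega)
    omega
  have hpar : ∀ p < 8 * m + 19, p % 2 = 0 → F p % 2 = 0 := by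
    intro p hp hp2
    rcases Nat.eq_zero_or_pos p with rfl | hpos
    · simpa using hzero 0 h0
    · have hle : F 0 < F p := by
        have hmono : ∀ q, 1 ≤ q → q ≤ p → F 0 < F q := fun q hq => by
          induction q, hq using Nat.le_induction with
          | base =>
            have : F 1 = _ := heven 0 (by omega) rfl
            omega
          | succ q _ ih =>
            intro hq
            have := ih (by omega)
            have := hF q (by omega)
            omega
        exact hmono p hpos le_rfl
      have := cases_of_chainLetter_eq hle (by
        have := hval 0 (by omega) p hp (by
          rw [chainLetter_cycleLetter_even m hp2, chainLetter_cycleLetter_even m rfl]) 0 (by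
            rwa [chainLetter_cycleLetter_even m rfl])
        exact this)
      have := hzero 0 h0
      omega
  have hstep : ∀ p, p + 1 < 8 * m + 19 → F p < F (p + 1) := by
    intro p hp
    rcases Nat.mod_two_eq_zero_or_one p with hp2 | hp2
    · have := heven p (by omega) hp2
      omega
    · obtain ⟨q, rfl⟩ : ∃ q, p = q + 1 := ⟨p - 1, by omega⟩
      have h1 := heven q (by omega) (by omega)
      have h2 := hpar q (by omega) (by omega)
      have h3 := hpar (q + 1 + 1) (by omega) (by omega)
      have h4 := hF (q + 1) (by omega)
      omega
  have hodd : ∀ p < 8 * m + 19, p % 2 = 1 → F p % 2 = 1 := by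
    intro p hp hp2
    obtain ⟨q, rfl⟩ : ∃ q, p = q + 1 := ⟨p - 1, by omega⟩
    have h1 := heven q (by omega) (by omega)
    have h2 := hpar q (by omega) (by omega)
    omega
  have hadd : ∀ d p, p + d < 8 * m + 19 → F p + d ≤ F (p + d) := by
    intro d
    induction d with
    | zero => exact fun _ _ => le_rfl
    | succ d ih =>
      intro p hp
      have := ih p (by omega)
      have : _ < F (p + (d + 1)) := hstep (p + d) (by omega)
      omega
  have hsame : ∀ p q, p < q → q < 8 * m + 19 → p % 2 = 1 →
      chainLetter (cycleLetter m) p = chainLetter (cycleLetter m) q →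
      chainLetter (cycleLetter n) (F p) = chainLetter (cycleLetter n) (F q) := by
    intro p q hpq hq hp2 h
    have := hF p (by omega)
    have := hstep p (by omega)
    exact hval p (by omega) q hq h 0 (by omega)
  have hmark1 := hadd (8 * m + 4) 5 (by omega)
  have hmark2 := hadd 8 (8 * m + 9) (by omega)
  have hc1 := cases_of_chainLetter_eq (n := n) (x := F 5) (y := F (8 * m + 9))
    (by rw [show 5 + (8 * m + 4) = 8 * m + 9 by ring] at hmark1; omega)
    (hsame _ _ (by omega) (by omega) rfl (by
      rw [chainLetter_cycleLetter_mark (by omega), chainLetter_cycleLetter_mark (by omega)]))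
  have hc2 := cases_of_chainLetter_eq (n := n) (x := F (8 * m + 9)) (y := F (8 * m + 17))
    (by rw [show 8 * m + 9 + 8 = 8 * m + 17 by ring] at hmark2; omega)
    (hsame _ _ (by omega) (by omega) (by omega) (by
      rw [chainLetter_cycleLetter_mark (by omega), chainLetter_cycleLetter_mark (by omega)]))
  rw [show 5 + (8 * m + 4) = 8 * m + 9 by ring] at hmark1
  rw [show 8 * m + 9 + 8 = 8 * m + 17 by ring] at hmark2
  have h5odd := hodd 5 (by omega) rfl
  have h9odd := hodd (8 * m + 9) (by omega) (by omega)
  have hplace : F 5 = 5 ∧ F (8 * m + 9) = 8 * n + 9 ∧ F (8 * m + 17) = 8 * n + 17 := by omega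
  have htwelve : ∀ k ≤ m, F (8 * k + 13) = F (8 * k + 1) + 12 := by
    intro k hk
    have h1 := hadd 12 (8 * k + 1) (by omega)
    rw [show 8 * k + 1 + 12 = 8 * k + 13 by ring] at h1
    have hcase := cases_of_chainLetter_eq (n := n) (x := F (8 * k + 1)) (y := F (8 * k + 13))
      (by omega) (hsame _ _ (by omega) (by omega) (by omega)
        (chainLetter_cycleLetter_add_twelve hk).symm)
    have h2 := hodd (8 * k + 1) (by omega) (by omega)
    have h3 := hadd (8 * m + 9 - (8 * k + 1)) (8 * k + 1) (by omega)
    rw [show 8 * k + 1 + (8 * m + 9 - (8 * k + 1)) = 8 * m + 9 by omega] at h3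
    have h4 := hadd (8 * m + 17 - (8 * k + 13)) (8 * k + 13) (by omega)
    rw [show 8 * k + 13 + (8 * m + 17 - (8 * k + 13)) = 8 * m + 17 by omega] at h4
    rcases Nat.eq_zero_or_pos k with rfl | hk0
    · have := hadd 4 1 (by omega)
      simp only [mul_zero, zero_add, Nat.reduceAdd] at *
      omega
    · have h6 := hadd (8 * k + 1 - 5) 5 (by omega)
      rw [show 5 + (8 * k + 1 - 5) = 8 * k + 1 by omega] at h6
      omega
  have hshift : ∀ k ≤ m + 1, F (8 * k + 1) = F 1 + 8 * k := by
    intro k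
    induction k with
    | zero => simp
    | succ k ih =>
      intro hk
      have h1 := ih (by omega)
      have h2 := htwelve k (by omega)
      have h3 := hadd 8 (8 * k + 1) (by omega)
      have h4 := hadd 4 (8 * k + 9) (by omega)
      rw [show 8 * k + 1 + 8 = 8 * k + 9 by ring] at h3
      rw [show 8 * k + 9 + 4 = 8 * k + 13 by ring] at h4
      rw [show 8 * (k + 1) + 1 = 8 * k + 9 by ring]
      omega
  have h1 := hshift (m + 1) le_rfl
  rw [show 8 * (m + 1) + 1 = 8 * m + 9 by ring] at h1
  have h2 := htwelve 0 (by omega)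
  have h3 := hadd 4 1 (by omega)
  have h4 := hadd 8 5 (by omega)
  simp only [mul_zero, zero_add, Nat.reduceAdd] at h2 h3 h4
  omega

theorem eq_of_cycleWord_eq {m n : ℕ} {θ : Word →* Word} {p q : Word}
    (h : cycleWord n = p * θ (cycleWord m) * q) (h0 : θ (FreeMonoid.of 0) ≠ 1) : m = n := by
  let len (a : ℕ) : ℕ := (θ (FreeMonoid.of a)).length
  let F (k : ℕ) : ℕ :=
    p.length + (((List.range k).map (chainLetter (cycleLetter m))).map len).sum
  have key : ∀ k < 8 * m + 19, ∀ r < len (chainLetter (cycleLetter m) k),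
      (θ (FreeMonoid.of (chainLetter (cycleLetter m) k))).toList[r]? =
        some (chainLetter (cycleLetter n) (F k + r)) := by
    intro k hk r hr
    obtain ⟨d, hd⟩ := Nat.exists_eq_add_of_lt hk
    obtain ⟨z, hz⟩ : ∃ z, cycleWord m =
        FreeMonoid.ofList ((List.range k).map (chainLetter (cycleLetter m))) *
          FreeMonoid.of (chainLetter (cycleLetter m) k) * z := by
      refine ⟨FreeMonoid.ofList (((List.range d).map (k + 1 + ·)).map
        (chainLetter (cycleLetter m))), FreeMonoid.toList.injective ?_⟩
      rw [toList_cycleWord, hd, show k + d + 1 = k + 1 + d by ring, List.range_add,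
        List.range_succ]
      simp
    have hF : F k + r = p.toList.length + ((θ (FreeMonoid.ofList ((List.range k).map
        (chainLetter (cycleLetter m))))).toList.length + r) := by
      rw [← add_assoc]
      exact congrArg (p.length + · + r) (FreeMonoid.length_map θ _).symm
    have hlist := congrArg FreeMonoid.toList h
    rw [toList_cycleWord, hz] at hlist
    simp only [map_mul, FreeMonoid.toList_mul, List.append_assoc] at hlist
    have hget : ((List.range (8 * n + 19)).map (chainLetter (cycleLetter n)))[F k + r]? =
        (θ (FreeMonoid.of (chainLetter (cycleLetter m) k))).toList[r]? := by
      rw [hlist, hF, List.getElem?_append_right (Nat.le_add_right _ _), Nat.add_sub_cancel_left,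
        List.getElem?_append_right (Nat.le_add_right _ _), Nat.add_sub_cancel_left,
        List.getElem?_append_left hr]
    have hlt : F k + r < 8 * n + 19 := by
      by_contra hge
      rw [List.getElem?_eq_none (by simpa using hge), List.getElem?_eq_getElem hr] at hget
      exact Option.some_ne_none _ hget.symm
    rw [← hget, List.getElem?_map, List.getElem?_range hlt, Option.map_some]
  refine eq_of_cycleWord_places (F := F) (len := len) ?_ (fun k _ => ?_)
    fun k hk l hl hkl r hr => ?_
  · exact Nat.pos_of_ne_zero fun hlen => h0 (by simpa [len] using hlen)
  · simp [F, List.range_succ, add_assoc]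
  · have hk' := key k hk r hr
    rw [hkl] at hk' hr
    rw [key l hl r hr] at hk'
    exact (Option.some.inj hk').symm

/-- The syntactic congruence of a single word. -/
def syntacticCon (w : Word) : Con Word where
  r u v := ∀ p q, w = p * u * q ↔ w = p * v * q
  iseqv := ⟨fun _ _ _ => Iff.rfl, fun h p q => (h p q).symm, fun h h' p q => (h p q).trans (h' p q)⟩
  mul' {u u' v v'} h h' p q := by
    have h1 := h p (v * q)
    have h2 := h' (p * u') q
    simp only [mul_assoc] at h1 h2 ⊢
    exact h1.trans h2

theorem satisfies_syntacticCon {w u v : Word}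
    (h : ∀ (θ : Word →* Word) (p q : Word), w = p * θ u * q ↔ w = p * θ v * q) :
    Satisfies (syntacticCon w).Quotient u v := by
  intro f
  choose g hg using fun a => (syntacticCon w).mk'_surjective (f (FreeMonoid.of a))
  have hf : f = (syntacticCon w).mk'.comp (FreeMonoid.lift g) :=
    FreeMonoid.hom_eq fun a => by
      rw [MonoidHom.comp_apply, FreeMonoid.lift_eval_of, hg]
  rw [hf]
  exact (Con.eq _).2 (h _)

theorem not_satisfies_syntacticCon {w v : Word} (h : w ≠ v) :
    ¬ Satisfies (syntacticCon w).Quotient w v := fun hsat => by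
  have := ((Con.eq _).1 (hsat (syntacticCon w).mk') : syntacticCon w w v) 1 1
  simp only [one_mul, mul_one, true_iff] at this
  exact h this

/-- The identities of the monoids satisfying the identities of `M` and
`cycleWord i ≈ 0 · cycleWord i` for all `i ∈ I`. -/
def cycleTheory (M : Type) [Monoid M] (I : Set ℕ) : Set (Word × Word) :=
  {p | ∀ (N : Type) [Monoid N], (∀ p ∈ Th M, Satisfies N p.1 p.2) →
    (∀ i ∈ I, Satisfies N (cycleWord i) (FreeMonoid.of 0 * cycleWord i)) → Satisfies N p.1 p.2}

theorem birkhoffClosed_cycleTheory (M : Type) [Monoid M] (I : Set ℕ) :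
    BirkhoffClosed (cycleTheory M I) := fun _ _ h N _ hM hI =>
  h N fun _ hp => hp N hM hI

theorem th_subset_cycleTheory (M : Type) [Monoid M] (I : Set ℕ) : Th M ⊆ cycleTheory M I :=
  fun p hp _ _ hM _ => hM p hp

theorem mem_cycleTheory_iff {M : Type} [Monoid M] (h : ∀ k, Isoterm M (zimWord k)) {I : Set ℕ}
    {j : ℕ} : (cycleWord j, FreeMonoid.of 0 * cycleWord j) ∈ cycleTheory M I ↔ j ∈ I := by
  refine ⟨fun hj => ?_, fun hj N _ _ hI => hI j hj⟩
  by_contra hjI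
  refine not_satisfies_syntacticCon ?_ (hj (syntacticCon (cycleWord j)).Quotient ?_ ?_)
  · intro heq
    simpa [FreeMonoid.length_mul] using congrArg FreeMonoid.length heq
  · rintro ⟨u, v⟩ huv
    have hiso := isoterm_cycleWord h j
    refine satisfies_syntacticCon fun θ p q => ⟨fun heq => ?_, fun heq => ?_⟩
    · refine (hiso _ fun f => ?_).symm
      have := huv (f.comp θ)
      simp only [MonoidHom.comp_apply] at this
      simp only [heq, map_mul, this]
    · refine (hiso _ fun f => ?_).symm
      have := huv (f.comp θ)
      simp only [MonoidHom.comp_apply] at this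
      simp only [heq, map_mul, this]
  · intro i hi
    refine satisfies_syntacticCon fun θ p q => ?_
    by_cases h0 : θ (FreeMonoid.of 0) = 1
    · rw [map_mul, h0, one_mul]
    · refine iff_of_false (fun heq => hjI ?_) fun heq => hjI ?_
      · exact eq_of_cycleWord_eq heq h0 ▸ hi
      · rw [map_mul, ← mul_assoc] at heq
        exact eq_of_cycleWord_eq heq h0 ▸ hi

/-- Any inherently non-finitely based finite monoid generates a monoid variety
with continuum many subvarieties. -/
theorem statement11 (M : Type) [Monoid M] [Finite M]
    (h : ¬ ∃ Sig : Set (Word × Word), Sig.Finite ∧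
        (∀ p ∈ Sig, Satisfies M p.1 p.2) ∧
        (∀ (N : Type) [Monoid N], MonoidFG N →
          (∀ p ∈ Sig, Satisfies N p.1 p.2) → Finite N)) :
    Cardinal.mk {E : Set (Word × Word) // BirkhoffClosed E ∧ Th M ⊆ E} =
      Cardinal.continuum := by
  have hiso := isoterm_zimWord h
  apply le_antisymm
  · have : Countable (Word × Word) := inferInstanceAs (Countable (List ℕ × List ℕ))
    refine (Cardinal.mk_subtype_le _).trans ?_
    rw [Cardinal.mk_set, ← Cardinal.two_power_aleph0]
    exact Cardinal.power_le_power_left two_ne_zero Cardinal.mk_le_aleph0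
  · rw [← Cardinal.mk_set_nat]
    refine Cardinal.mk_le_of_injective (f := fun I => ⟨cycleTheory M I,
      birkhoffClosed_cycleTheory M I, th_subset_cycleTheory M I⟩) fun I J hIJ => ?_
    ext j
    have hIJ' : cycleTheory M I = cycleTheory M J := congrArg Subtype.val hIJ
    rw [← mem_cycleTheory_iff hiso, hIJ', mem_cycleTheory_iff hiso]
end

section
/- Suppose the Zimin word z₅ is an isoterm for a monoid M. Then for pairwise distinct variables a, b, h, t, y, z ∈ A, the words a h b y z a b y z and y z a b y z a t b are isoterms for M. -/
/-- The Zimin words over the variables `xᵢ = i`: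
`z₁ = x₁` and `zₙ₊₁ = zₙ·xₙ₊₁·zₙ`. -/
def zimin : ℕ → Word
  | 0 => 1
  | 1 => FreeMonoid.of 1
  | n + 2 => zimin (n + 1) * FreeMonoid.of (n + 2) * zimin (n + 1)

theorem lift_ofList_eq_flatMap (f : ℕ → List ℕ) (l : List ℕ) :
    FreeMonoid.lift (fun c => FreeMonoid.ofList (f c)) (FreeMonoid.ofList l) =
      FreeMonoid.ofList (l.flatMap f) := by
  induction l with
  | nil => rfl
  | cons c l ih =>
    rw [FreeMonoid.ofList_cons, map_mul, ih, FreeMonoid.lift_eval_of, List.flatMap_cons,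
      FreeMonoid.ofList_append]

/-- If a substitution sends `u` to a factor of an isoterm, then it identifies the two sides of
every identity `u ≈ v` satisfied by the monoid. -/
theorem Isoterm.flatMap_eq {M : Type*} [Monoid M] {w : Word} (hw : Isoterm M w)
    {u v : List ℕ} (h : Satisfies M (FreeMonoid.ofList u) (FreeMonoid.ofList v))
    (f : ℕ → List ℕ) (p s : List ℕ)
    (hf : w = FreeMonoid.ofList (p ++ u.flatMap f ++ s)) :
    v.flatMap f = u.flatMap f := by
  have key := hw (FreeMonoid.ofList (p ++ v.flatMap f ++ s)) fun g => by
    have e := h (g.comp (FreeMonoid.lift fun c => FreeMonoid.ofList (f c)))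
    simp only [MonoidHom.comp_apply, lift_ofList_eq_flatMap] at e
    simp only [hf, FreeMonoid.ofList_append, map_mul, e]
  rw [hf] at key
  simpa using FreeMonoid.ofList.injective key

/-- The substitution `a ↦ p`, `h ↦ q`, `b ↦ 1`, `y ↦ 2`, `z ↦ r`; all other variables are
sent to `6`. -/
def ziminSubst (a h b y z : ℕ) (p q r : List ℕ) (c : ℕ) : List ℕ :=
  if c = a then p else if c = h then q else if c = b then [1]
  else if c = y then [2] else if c = z then r else [6]

theorem ziminSubst_values {a h b y z : ℕ} (hd : List.Pairwise Ne [a, h, b, y, z])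
    (p q r : List ℕ) :
    ziminSubst a h b y z p q r a = p ∧ ziminSubst a h b y z p q r h = q ∧
      ziminSubst a h b y z p q r b = [1] ∧ ziminSubst a h b y z p q r y = [2] ∧
      ziminSubst a h b y z p q r z = r := by
  simp only [List.pairwise_cons, List.mem_cons, forall_eq_or_imp] at hd
  simp only [ziminSubst]
  grind

section Parsing

variable {a h b y z : ℕ} {l xs : List ℕ}

theorem eq_nil_of_flatMap_ziminSubst
    (H : l.flatMap (ziminSubst a h b y z [3] [1, 2, 1, 4] [1]) = []) : l = [] := by
  rcases l with _ | ⟨c, l⟩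
  · rfl
  · simp only [List.flatMap_cons, ziminSubst] at H
    split_ifs at H <;> simp at H

theorem head_three_of_flatMap_ziminSubst
    (H : l.flatMap (ziminSubst a h b y z [3] [1, 2, 1, 4] [1]) = 3 :: xs) :
    ∃ l', l = a :: l' ∧ l'.flatMap (ziminSubst a h b y z [3] [1, 2, 1, 4] [1]) = xs := by
  rcases l with _ | ⟨c, l⟩
  · simp at H
  · rw [List.flatMap_cons] at H
    nth_rw 1 [ziminSubst] at H
    split_ifs at H <;> simp_all

theorem head_two_of_flatMap_ziminSubst
    (H : l.flatMap (ziminSubst a h b y z [3] [1, 2, 1, 4] [1]) = 2 :: xs) :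
    ∃ l', l = y :: l' ∧ l'.flatMap (ziminSubst a h b y z [3] [1, 2, 1, 4] [1]) = xs := by
  rcases l with _ | ⟨c, l⟩
  · simp at H
  · rw [List.flatMap_cons] at H
    nth_rw 1 [ziminSubst] at H
    split_ifs at H <;> simp_all

theorem head_four_of_flatMap_ziminSubst
    (H : l.flatMap (ziminSubst a h b y z [3] [1, 2, 1, 4] [1]) = 4 :: xs) : False := by
  rcases l with _ | ⟨c, l⟩
  · simp at H
  · rw [List.flatMap_cons] at H
    nth_rw 1 [ziminSubst] at H
    split_ifs at H <;> simp_all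

theorem head_one_of_flatMap_ziminSubst
    (H : l.flatMap (ziminSubst a h b y z [3] [1, 2, 1, 4] [1]) = 1 :: xs) :
    ∃ c l', l = c :: l' ∧
      ((c = b ∨ c = z) ∧ l'.flatMap (ziminSubst a h b y z [3] [1, 2, 1, 4] [1]) = xs ∨
        c = h ∧ 2 :: 1 :: 4 :: l'.flatMap (ziminSubst a h b y z [3] [1, 2, 1, 4] [1]) = xs) := by
  rcases l with _ | ⟨c, l⟩
  · simp at H
  · refine ⟨c, l, rfl, ?_⟩
    rw [List.flatMap_cons] at H
    nth_rw 1 [ziminSubst] at H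
    split_ifs at H <;> simp_all

theorem head_one_of_flatMap_ziminSubst_of_ne
    (H : l.flatMap (ziminSubst a h b y z [3] [1, 2, 1, 4] [1]) = 1 :: xs) (hx : xs.take 3 ≠ [2, 1, 4]) :
    ∃ c l', l = c :: l' ∧ (c = b ∨ c = z) ∧
      l'.flatMap (ziminSubst a h b y z [3] [1, 2, 1, 4] [1]) = xs := by
  obtain ⟨c, l', rfl, ⟨hc, e⟩ | ⟨-, e⟩⟩ := head_one_of_flatMap_ziminSubst H
  · exact ⟨c, l', rfl, hc, e⟩
  · subst e
    simp at hx

theorem eq_of_flatMap_ziminSubst (hd : List.Pairwise Ne [a, h, b, y, z])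
    (h₁ : l.flatMap (ziminSubst a h b y z [3] [1, 2, 1, 4] [1]) =
      [3, 1, 2, 1, 4, 1, 2, 1, 3, 1, 2, 1])
    (h₂ : l.flatMap (ziminSubst a h b y z [4] [1, 2, 1, 3, 1, 2, 1, 5] [1, 3, 1, 2, 1]) =
      [4, 1, 2, 1, 3, 1, 2, 1, 5, 1, 2, 1, 3, 1, 2, 1, 4, 1, 2, 1, 3, 1, 2, 1]) :
    l = [a, h, b, y, z, a, b, y, z] := by
  obtain ⟨l₁, rfl, k₁⟩ := head_three_of_flatMap_ziminSubst h₁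
  obtain ⟨_, l₂, rfl, ⟨-, k₂⟩ | ⟨rfl, k₂⟩⟩ := head_one_of_flatMap_ziminSubst k₁
  · obtain ⟨l₃, rfl, k₃⟩ := head_two_of_flatMap_ziminSubst k₂
    obtain ⟨_, l₄, rfl, -, k₄⟩ := head_one_of_flatMap_ziminSubst_of_ne k₃ (by simp)
    exact (head_four_of_flatMap_ziminSubst k₄).elim
  simp only [List.cons.injEq, true_and] at k₂
  obtain ⟨p, l₃, rfl, hp, k₃⟩ := head_one_of_flatMap_ziminSubst_of_ne k₂ (by simp)
  obtain ⟨l₄, rfl, k₄⟩ := head_two_of_flatMap_ziminSubst k₃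
  obtain ⟨q, l₅, rfl, hq, k₅⟩ := head_one_of_flatMap_ziminSubst_of_ne k₄ (by simp)
  obtain ⟨l₆, rfl, k₆⟩ := head_three_of_flatMap_ziminSubst k₅
  obtain ⟨r, l₇, rfl, hr, k₇⟩ := head_one_of_flatMap_ziminSubst_of_ne k₆ (by simp)
  obtain ⟨l₈, rfl, k₈⟩ := head_two_of_flatMap_ziminSubst k₇
  obtain ⟨s, l₉, rfl, hs, k₉⟩ := head_one_of_flatMap_ziminSubst_of_ne k₈ (by simp)
  obtain rfl := eq_nil_of_flatMap_ziminSubst k₉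
  clear h₁ k₁ k₂ k₃ k₄ k₅ k₆ k₇ k₈ k₉
  obtain ⟨ea, eh, eb, ey, ez⟩ :=
    ziminSubst_values hd [4] [1, 2, 1, 3, 1, 2, 1, 5] [1, 3, 1, 2, 1]
  rcases hp with rfl | rfl <;> rcases hq with rfl | rfl <;> rcases hr with rfl | rfl <;>
    rcases hs with rfl | rfl <;> simp [ea, eh, eb, ey, ez] at h₂ ⊢

end Parsing

/-- If the Zimin word `z₅` is an isoterm for `M`, then for pairwise distinct
variables `a, b, h, t, y, z` the words `ahbyzabyz` and `yzabyzatb` are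
isoterms for `M`. -/
theorem statement12 (M : Type*) [Monoid M] (h5 : Isoterm M (zimin 5))
    (a b hv t y z : ℕ) (hd : List.Pairwise Ne [a, b, hv, t, y, z]) :
    Isoterm M (FreeMonoid.ofList [a, hv, b, y, z, a, b, y, z]) ∧
    Isoterm M (FreeMonoid.ofList [y, z, a, b, y, z, a, t, b]) := by
  have hd₁ : List.Pairwise Ne [a, hv, b, y, z] := by
    simp at hd ⊢
    grind
  have hd₂ : List.Pairwise Ne [b, t, a, z, y] := by
    simp at hd ⊢
    grind
  refine ⟨fun w hw => ?_, fun w hw => ?_⟩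
  · have image (p q r : List ℕ) :
        [a, hv, b, y, z, a, b, y, z].flatMap (ziminSubst a hv b y z p q r) =
          p ++ q ++ [1, 2] ++ r ++ p ++ [1, 2] ++ r := by
      obtain ⟨ea, eh, eb, ey, ez⟩ := ziminSubst_values hd₁ p q r
      simp [ea, eh, eb, ey, ez]
    have e (p q r c d) (hz) := (h5.flatMap_eq (v := w.toList) hw
      (ziminSubst a hv b y z p q r) c d (by rw [image]; exact hz)).trans (image p q r)
    exact congrArg FreeMonoid.ofList (eq_of_flatMap_ziminSubst hd₁
      (e [3] [1, 2, 1, 4] [1] [1, 2, 1] ([5] ++ (zimin 4).toList) rfl)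
      (e [4] [1, 2, 1, 3, 1, 2, 1, 5] [1, 3, 1, 2, 1] (zimin 3).toList [] rfl))
  · have image (p q r : List ℕ) : [y, z, a, b, y, z, a, t, b].flatMap
        (fun c => (ziminSubst b t a z y p q r c).reverse) =
          (p ++ q ++ [1, 2] ++ r ++ p ++ [1, 2] ++ r).reverse := by
      obtain ⟨eb, et, ea, ez, ey⟩ := ziminSubst_values hd₂ p q r
      simp [ea, et, eb, ey, ez]
    have e (p q r c d : List ℕ) (hz : zimin 5 = FreeMonoid.ofList
        (c ++ (p ++ q ++ [1, 2] ++ r ++ p ++ [1, 2] ++ r).reverse ++ d)) :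
        w.toList.reverse.flatMap (ziminSubst b t a z y p q r) =
        p ++ q ++ [1, 2] ++ r ++ p ++ [1, 2] ++ r := by
      have k := (h5.flatMap_eq (v := w.toList) hw
        (fun x => (ziminSubst b t a z y p q r x).reverse) c d
        (by rw [image]; exact hz)).trans (image p q r)
      rw [← List.reverse_inj, ← k, List.reverse_flatMap]
      simp [Function.comp_def]
    have key := eq_of_flatMap_ziminSubst hd₂
      (e [3] [1, 2, 1, 4] [1] ((zimin 4).toList ++ [5]) [1, 2, 1] rfl)
      (e [4] [1, 2, 1, 3, 1, 2, 1, 5] [1, 3, 1, 2, 1] [] (zimin 3).toList rfl)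
    exact congrArg FreeMonoid.ofList (List.reverse_eq_iff.mp key)
end

section
/- Let n ≥ 3 and suppose the Zimin word zₙ₊₂ is an isoterm for a monoid M. Then for pairwise distinct variables x₀, x₁, …, xₙ, h, t ∈ A, the words x₀hx₁x₀ · x₂x₁ · x₃x₂ ⋯ xₙxₙ₋₁ · xₙ and x₀ · x₁x₀ · x₂x₁ ⋯ xₙxₙ₋₁ · txₙ are isoterms for M. -/
open FreeMonoid

/-- If an injective substitution sends `w` to a factor of an
isoterm, then `w` is an isoterm. -/
theorem Isoterm.of_injective_factor {M : Type*} [Monoid M] {z w a b : Word} (hz : Isoterm M z)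
    (φ : Word →* Word) (hφ : Function.Injective φ) (h : a * φ w * b = z) : Isoterm M w := by
  intro w' hw
  have key : a * φ w' * b = z := by
    apply hz
    intro f
    rw [← h]
    simp only [map_mul]
    rw [show f (φ w) = f (φ w') from hw (f.comp φ)]
  exact hφ (mul_left_cancel (mul_right_cancel (key.trans h.symm)))

theorem lift_op_reverse {M : Type*} [Monoid M] (f : Word →* M) (w : Word) :
    FreeMonoid.lift (fun i => MulOpposite.op (f (of i))) w.reverse = MulOpposite.op (f w) := by
  induction w using FreeMonoid.inductionOn' with
  | one => rw [map_one]; exact map_one _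
  | of_mul i w ih => simp [reverse_mul, ih]

theorem lift_unop_reverse {M : Type*} [Monoid M] (f : Word →* Mᵐᵒᵖ) (w : Word) :
    FreeMonoid.lift (fun i => MulOpposite.unop (f (of i))) w.reverse = MulOpposite.unop (f w) := by
  induction w using FreeMonoid.inductionOn' with
  | one => rw [map_one]; exact map_one _
  | of_mul i w ih => simp [reverse_mul, ih]

theorem satisfies_op_reverse {M : Type*} [Monoid M] {u v : Word} :
    Satisfies Mᵐᵒᵖ u.reverse v.reverse ↔ Satisfies M u v := by
  constructor
  · intro h f
    have := h (FreeMonoid.lift (fun i => MulOpposite.op (f (of i))))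
    rw [lift_op_reverse, lift_op_reverse] at this
    exact MulOpposite.op_injective this
  · intro h f
    have := h (FreeMonoid.lift (fun i => MulOpposite.unop (f (of i))))
    rw [← reverse_reverse (a := u), ← reverse_reverse (a := v), lift_unop_reverse,
      lift_unop_reverse] at this
    exact MulOpposite.unop_injective this

theorem isoterm_op_reverse {M : Type*} [Monoid M] {w : Word} :
    Isoterm Mᵐᵒᵖ w.reverse ↔ Isoterm M w := by
  constructor
  · intro h w' hw
    have := congrArg reverse (h _ (satisfies_op_reverse.2 hw))
    simpa using this
  · intro h w' hw
    rw [← reverse_reverse (a := w'), satisfies_op_reverse] at hw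
    rw [← h _ hw, reverse_reverse]

theorem zimin_succ (j : ℕ) : zimin (j + 1) = zimin j * of (j + 1) * zimin j := by
  cases j <;> simp [zimin]

theorem reverse_zimin (j : ℕ) : (zimin j).reverse = zimin j := by
  induction j with
  | zero => rfl
  | succ j ih =>
    simp only [zimin_succ, reverse_mul, ih, mul_assoc]
    rfl

theorem le_of_mem_zimin {j a : ℕ} (h : a ∈ zimin j) : a ≤ j := by
  induction j with
  | zero => exact absurd h notMem_one
  | succ j ih =>
    simp only [zimin_succ, mem_mul, mem_of] at h
    grind

/-- The part of `stairBlock j` to the right of its largest variable. -/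
def stairRight : ℕ → Word
  | 0 => 1
  | 1 => 1
  | 2 => 1
  | j + 3 => zimin j * of (j + 1) * stairRight j

/-- The part of `stairBlock j` to the left of its largest variable. -/
def stairLeft : ℕ → Word
  | 0 => 1
  | 1 => 1
  | 2 => of 1
  | j + 3 => stairLeft j * of (j + 1) * zimin j * of (j + 2) * zimin (j + 1)

/-- Blocks with largest variable `j + 1` into which the Zimin words decompose in a staircase
pattern. -/
def stairBlock (j : ℕ) : Word := stairLeft j * of (j + 1) * stairRight j

theorem le_of_mem_stairRight {j a : ℕ} (h : a ∈ stairRight j) : a ≤ j := by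
  induction j using stairRight.induct with
  | case1 => exact absurd h notMem_one
  | case2 => exact absurd h notMem_one
  | case3 => exact absurd h notMem_one
  | case4 j ih =>
    simp only [stairRight, mem_mul, mem_of] at h
    have := @le_of_mem_zimin j a
    grind

theorem le_of_mem_stairLeft {j a : ℕ} (h : a ∈ stairLeft j) : a ≤ j := by
  induction j using stairLeft.induct with
  | case1 => exact absurd h notMem_one
  | case2 => exact absurd h notMem_one
  | case3 => simp only [stairLeft, mem_of] at h; omega
  | case4 j ih =>
    simp only [stairLeft, mem_mul, mem_of] at h
    have := @le_of_mem_zimin j a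
    have := @le_of_mem_zimin (j + 1) a
    grind

theorem stairRight_mul_stairLeft_succ (j : ℕ) :
    stairRight j * stairLeft (j + 1) = zimin j := by
  induction j using stairRight.induct with
  | case1 => rfl
  | case2 => rfl
  | case3 => rfl
  | case4 j ih =>
    rw [stairLeft, stairRight, zimin_succ (j + 2)]
    calc _ = zimin j * of (j + 1) * (stairRight j * stairLeft (j + 1)) * of (j + 1 + 1) *
          zimin (j + 1) * of (j + 2 + 1) * zimin (j + 2) := by simp only [mul_assoc]
      _ = _ := by rw [ih, zimin_succ (j + 1), zimin_succ j]

theorem stairRight_add_two_mul_stairLeft (j : ℕ) :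
    stairRight (j + 2) * stairLeft j = zimin j := by
  induction j using stairLeft.induct with
  | case1 => rfl
  | case2 => rfl
  | case3 => rfl
  | case4 j ih =>
    rw [stairLeft, stairRight, zimin_succ (j + 2)]
    calc _ = zimin (j + 2) * of (j + 2 + 1) * ((stairRight (j + 2) * stairLeft j) * of (j + 1) *
          zimin j * of (j + 1 + 1) * zimin (j + 1)) := by simp only [mul_assoc]
      _ = _ := by rw [ih, zimin_succ (j + 1), zimin_succ j]

theorem List.append_cons_inj_of_notMem_left {α : Type*} {a : α} {l₁ l₂ m₁ m₂ : List α}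
    (h₁ : a ∉ l₁) (h₂ : a ∉ l₂) (h : l₁ ++ a :: m₁ = l₂ ++ a :: m₂) : l₁ = l₂ ∧ m₁ = m₂ := by
  induction l₁ generalizing l₂ with
  | nil => cases l₂ <;> grind
  | cons b l ih =>
    cases l₂ with
    | nil => grind
    | cons c l' =>
      simp only [List.cons_append, List.cons.injEq, List.mem_cons, not_or] at *
      have := ih h₁.2 h₂.2 h.2
      grind

theorem FreeMonoid.mul_of_mul_inj_of_notMem {α : Type*} {a : α} {l₁ l₂ m₁ m₂ : FreeMonoid α}
    (h₁ : a ∉ l₁) (h₂ : a ∉ l₂) (h : l₁ * of a * m₁ = l₂ * of a * m₂) : l₁ = l₂ ∧ m₁ = m₂ := by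
  rw [mul_assoc, mul_assoc] at h
  exact List.append_cons_inj_of_notMem_left h₁ h₂ h

theorem FreeMonoid.exists_eq_mul_of_mul {α : Type*} {a : α} {w : FreeMonoid α} (h : a ∈ w) :
    ∃ u v : FreeMonoid α, w = u * of a * v ∧ a ∉ u := by
  obtain ⟨u, v, h, hu⟩ := List.eq_append_cons_of_mem (show a ∈ w.toList from h)
  exact ⟨ofList u, ofList v, by rw [mul_assoc]; exact h, hu⟩

/-- A substitution sending each `k` to a word in which `k + 1` occurs once and all other variables
are smaller is injective. -/
theorem injective_lift_of_triangular {s p : ℕ → Word} (hs : ∀ k, ∀ a ∈ s k, a ≤ k)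
    (hp : ∀ k, ∀ a ∈ p k, a ≤ k) :
    Function.Injective (FreeMonoid.lift fun k => s k * of (k + 1) * p k) := by
  set φ := FreeMonoid.lift fun k => s k * of (k + 1) * p k with hφ
  have mem_le : ∀ (w : Word) (a : ℕ), a ∈ φ w → ∃ k ∈ w, a ≤ k + 1 := by
    intro w a
    induction w using FreeMonoid.inductionOn' with
    | one => intro h; rw [map_one] at h; exact absurd h notMem_one
    | of_mul i w ih =>
      intro h
      simp only [hφ, map_mul, mem_mul, lift_eval_of, mem_of] at h ih ⊢
      rcases h with ((h | h) | h) | h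
      · exact ⟨i, Or.inl rfl, (hs i a h).trans i.le_succ⟩
      · exact ⟨i, Or.inl rfl, h.le⟩
      · exact ⟨i, Or.inl rfl, (hp i a h).trans i.le_succ⟩
      · obtain ⟨k, hk, hle⟩ := ih h
        exact ⟨k, Or.inr hk, hle⟩
  have mem_succ : ∀ (w : Word) (k : ℕ), k ∈ w → k + 1 ∈ φ w := by
    intro w k h
    obtain ⟨u, v, rfl, -⟩ := FreeMonoid.exists_eq_mul_of_mul h
    simp [hφ, mem_mul, mem_of]
  have main : ∀ (K N : ℕ) (u v : Word), (∀ k ∈ u, k < K) → (∀ k ∈ v, k < K) → u.length ≤ N →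
      φ u = φ v → u = v := by
    intro K
    induction K with
    | zero =>
      intro N u v hu hv _ _
      have hnil : ∀ w : Word, (∀ k ∈ w, k < 0) → w = 1 := fun w hw =>
        List.eq_nil_iff_forall_not_mem.2 fun k hk => Nat.not_lt_zero k (hw k hk)
      rw [hnil u hu, hnil v hv]
    | succ K ihK =>
      intro N
      induction N with
      | zero =>
        intro u v hu hv hl h
        obtain rfl : u = 1 := length_eq_zero.1 (Nat.le_zero.1 hl)
        by_contra hne
        have : ∃ k, k ∈ v := by
          by_contra! hk
          exact hne (List.eq_nil_iff_forall_not_mem.2 hk).symm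
        obtain ⟨k, hk⟩ := this
        have := mem_succ v k hk
        rw [← h, map_one] at this
        exact notMem_one this
      | succ N ihN =>
        intro u v hu hv hl h
        have transfer : ∀ u v : Word, (∀ k ∈ v, k < K + 1) → φ u = φ v → K ∈ u → K ∈ v := by
          intro u v hv h hu
          obtain ⟨k, hk, hle⟩ := mem_le v (K + 1) (h ▸ mem_succ u K hu)
          have := hv k hk
          obtain rfl : k = K := by omega
          exact hk
        by_cases hK : K ∈ u
        · obtain ⟨u₁, u₂, rfl, hu₁⟩ := FreeMonoid.exists_eq_mul_of_mul hK
          obtain ⟨v₁, v₂, rfl, hv₁⟩ := FreeMonoid.exists_eq_mul_of_mul (transfer _ _ hv h hK)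
          have small : ∀ w w' : Word, (∀ k ∈ w * of K * w', k < K + 1) → K ∉ w →
              ∀ k ∈ w, k < K := by
            intro w w' hw hK k hk
            have := hw k (by simp [mem_mul, hk])
            have : k ≠ K := fun e => hK (e ▸ hk)
            omega
          have su := small u₁ u₂ hu hu₁
          have sv := small v₁ v₂ hv hv₁
          have notMem : ∀ w : Word, (∀ k ∈ w, k < K) → K + 1 ∉ φ w * s K := by
            intro w hw hmem
            rcases mem_mul.1 hmem with hm | hm
            · obtain ⟨k, hk, hle⟩ := mem_le w _ hm
              have := hw k hk
              omega
            · have := hs K _ hm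
              omega
          have hofK : φ (of K) = s K * of (K + 1) * p K := by simp [hφ]
          have h' : (φ u₁ * s K) * of (K + 1) * (p K * φ u₂) =
              (φ v₁ * s K) * of (K + 1) * (p K * φ v₂) := by
            simpa only [map_mul, hofK, mul_assoc] using h
          obtain ⟨e₁, e₂⟩ := FreeMonoid.mul_of_mul_inj_of_notMem (notMem u₁ su) (notMem v₁ sv) h'
          rw [ihK _ u₁ v₁ su sv le_rfl (mul_right_cancel e₁)]
          have : u₂.length ≤ N := by
            simp only [length_mul, length_of] at hl
            omega
          rw [ihN u₂ v₂ (fun k hk => hu k (by simp [mem_mul, hk]))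
            (fun k hk => hv k (by simp [mem_mul, hk])) this (mul_left_cancel e₂)]
        · have hK' : K ∉ v := fun hmem => hK (transfer v u hu h.symm hmem)
          refine ihK _ u v (fun k hk => ?_) (fun k hk => ?_) le_rfl h
          · have := hu k hk
            have : k ≠ K := fun e => hK (e ▸ hk)
            omega
          · have := hv k hk
            have : k ≠ K := fun e => hK' (e ▸ hk)
            omega
  intro u v h
  obtain ⟨K, hK⟩ : ∃ K, ∀ k ∈ u * v, k < K := by
    refine ⟨(u * v).toList.sum + 1, fun k hk => ?_⟩
    exact Nat.lt_succ_of_le (List.le_sum_of_mem (show k ∈ (u * v).toList from hk))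
  exact main K u.length u v (fun k hk => hK k (mem_mul.2 (Or.inl hk)))
    (fun k hk => hK k (mem_mul.2 (Or.inr hk))) le_rfl h

theorem injective_lift_stairBlock : Function.Injective (FreeMonoid.lift stairBlock) :=
  injective_lift_of_triangular (fun _ _ => le_of_mem_stairLeft) fun _ _ => le_of_mem_stairRight

theorem stairRight_mul_stairBlocks (φ : Word →* Word) (m : ℕ) (x : ℕ → ℕ)
    (hφ : ∀ i ≤ m + 1, φ (of (x i)) = stairBlock (m + 1 - i)) :
    stairRight (m + 1) *
      φ (((List.range m).map (fun i => ofList [x (i + 2), x (i + 1)])).prod * of (x (m + 1))) =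
      zimin (m + 1) := by
  induction m generalizing x with
  | zero =>
    simp only [List.range_zero, List.map_nil, List.prod_nil, one_mul]
    rw [hφ 1 le_rfl]
    rfl
  | succ m ih =>
    have ih' := ih (fun i => x (i + 1)) (fun i hi => by
      rw [hφ (i + 1) (by omega)]; congr 1; omega)
    rw [List.range_succ_eq_map, List.map_cons, List.prod_cons, List.map_map]
    have e : ofList [x (0 + 2), x (0 + 1)] = of (x 2) * of (x 1) := rfl
    rw [e, mul_assoc, map_mul, map_mul, hφ 2 (by omega), hφ 1 (by omega)]
    simp only [show m + 1 + 1 - 2 = m by omega, show m + 1 + 1 - 1 = m + 1 by omega]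
    calc _ = (stairRight (m + 2) * stairLeft m) * of (m + 1) *
          (stairRight m * stairLeft (m + 1)) * of (m + 1 + 1) * (stairRight (m + 1) * _) := by
            simp only [stairBlock, mul_assoc]; rfl
      _ = zimin m * of (m + 1) * zimin m * of (m + 1 + 1) * zimin (m + 1) := by
            rw [stairRight_add_two_mul_stairLeft, stairRight_mul_stairLeft_succ]
            congr 1
      _ = _ := by rw [zimin_succ (m + 1)]; congr 2; rw [zimin_succ]

theorem exists_injective_rank (n : ℕ) (x : ℕ → ℕ) (h : ℕ)
    (hx : ∀ i j : ℕ, i ≤ n → j ≤ n → x i = x j → i = j) (hxh : ∀ i : ℕ, i ≤ n → x i ≠ h) :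
    ∃ r : ℕ → ℕ, Function.Injective r ∧ (∀ i ≤ n, r (x i) = n - i) ∧ r h = n + 1 := by
  classical
  let r : ℕ → ℕ := fun v =>
    if v = h then n + 1 else if hv : ∃ i ≤ n, x i = v then n - hv.choose else n + 2 + v
  have hrx : ∀ i ≤ n, r (x i) = n - i := by
    intro i hi
    have hv : ∃ j ≤ n, x j = x i := ⟨i, hi, rfl⟩
    simp only [r, if_neg (hxh i hi), dif_pos hv]
    rw [hx _ _ hv.choose_spec.1 hi hv.choose_spec.2]
  have hrh : r h = n + 1 := by simp [r]
  have cases : ∀ v, v = h ∨ (∃ i ≤ n, x i = v) ∨ r v = n + 2 + v := by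
    intro v
    by_cases h₁ : v = h
    · exact Or.inl h₁
    · by_cases h₂ : ∃ i ≤ n, x i = v
      · exact Or.inr (Or.inl h₂)
      · exact Or.inr (Or.inr (by simp only [r, if_neg h₁, dif_neg h₂]))
  refine ⟨r, fun u v huv => ?_, hrx, hrh⟩
  rcases cases u with rfl | ⟨i, hi, rfl⟩ | hu <;> rcases cases v with rfl | ⟨j, hj, rfl⟩ | hv
  · rfl
  · rw [hrh, hrx j hj] at huv; omega
  · omega
  · rw [hrh, hrx i hi] at huv; omega
  · rw [hrx i hi, hrx j hj] at huv
    rw [show i = j by omega]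
  · rw [hrx i hi] at huv; omega
  · omega
  · rw [hrx j hj] at huv; omega
  · omega

theorem isoterm_staircase {M : Type*} [Monoid M] (m : ℕ) (hz : Isoterm M (zimin (m + 3)))
    (x : ℕ → ℕ) (h : ℕ) (hx : ∀ i j : ℕ, i ≤ m + 1 → j ≤ m + 1 → x i = x j → i = j)
    (hxh : ∀ i : ℕ, i ≤ m + 1 → x i ≠ h) :
    Isoterm M (ofList [x 0, h, x 1, x 0] *
      ((List.range m).map (fun i => ofList [x (i + 2), x (i + 1)])).prod * of (x (m + 1))) := by
  obtain ⟨r, hr, hrx, hrh⟩ := exists_injective_rank (m + 1) x h hx hxh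
  let φ : Word →* Word := (FreeMonoid.lift stairBlock).comp (FreeMonoid.map r)
  have hφ : ∀ i ≤ m + 1, φ (of (x i)) = stairBlock (m + 1 - i) := fun i hi => by
    simp [φ, hrx i hi]
  have hφh : φ (of h) = stairBlock (m + 2) := by simp [φ, hrh]
  refine hz.of_injective_factor φ
    (injective_lift_stairBlock.comp (List.map_injective_iff.2 hr))
    (a := stairRight (m + 3)) (b := 1) ?_
  have e : ofList [x 0, h, x 1, x 0] = of (x 0) * of h * of (x 1) * of (x 0) := rfl
  rw [mul_assoc (ofList _), map_mul, e]
  simp only [map_mul φ (_ * of (x 1)), map_mul φ (_ * of h), map_mul φ (of (x 0)) (of h)]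
  rw [hφ 0 (by omega), hφ 1 (by omega), hφh, mul_one]
  simp only [Nat.sub_zero, Nat.add_sub_cancel]
  have ht := stairRight_mul_stairBlocks φ m x hφ
  set T := φ (_ * of (x (m + 1)))
  calc _ = (stairRight (m + 3) * stairLeft (m + 1)) * of (m + 2) *
        (stairRight (m + 1) * stairLeft (m + 2)) * of (m + 3) *
        ((stairRight (m + 2) * stairLeft m) * of (m + 1) * (stairRight m * stairLeft (m + 1)) *
          of (m + 2) * (stairRight (m + 1) * T)) := by
          simp only [stairBlock, mul_assoc]
    _ = _ := by
          rw [ht, stairRight_add_two_mul_stairLeft, stairRight_add_two_mul_stairLeft,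
            stairRight_mul_stairLeft_succ, stairRight_mul_stairLeft_succ, zimin_succ (m + 2),
            zimin_succ (m + 1), zimin_succ m]

theorem reverse_prod_range_pairs (m : ℕ) (x : ℕ → ℕ) :
    (((List.range m).map (fun i => ofList [x (i + 1), x i])).prod : Word).reverse =
      ((List.range m).map (fun i => ofList [x (m + 1 - (i + 2)), x (m + 1 - (i + 1))])).prod := by
  induction m with
  | zero => rfl
  | succ m ih =>
    rw [List.range_succ, List.map_append, List.prod_append, reverse_mul, ih, List.map_singleton,
      List.prod_singleton, ← List.range_succ, List.range_succ_eq_map, List.map_cons, List.prod_cons, List.map_map]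
    congr 2
    apply List.map_congr_left
    intro i _
    rw [Function.comp, show m + 1 + 1 - (i.succ + 2) = m + 1 - (i + 2) by omega,
      show m + 1 + 1 - (i.succ + 1) = m + 1 - (i + 1) by omega]

/-- If `n ≥ 3` and the Zimin word `zₙ₊₂` is an isoterm for `M`, then for pairwise
distinct variables `x₀, …, xₙ, h, t` the words
`x₀hx₁x₀·x₂x₁·x₃x₂⋯xₙxₙ₋₁·xₙ` and `x₀·x₁x₀·x₂x₁⋯xₙxₙ₋₁·txₙ` are isoterms for `M`. -/
theorem statement13 (M : Type*) [Monoid M] (n : ℕ) (hn : 3 ≤ n)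
    (hz : Isoterm M (zimin (n + 2)))
    (x : ℕ → ℕ) (hv t : ℕ)
    (hx : ∀ i j : ℕ, i ≤ n → j ≤ n → x i = x j → i = j)
    (hxh : ∀ i : ℕ, i ≤ n → x i ≠ hv)
    (hxt : ∀ i : ℕ, i ≤ n → x i ≠ t)
    (hht : hv ≠ t) :
    Isoterm M (FreeMonoid.ofList [x 0, hv, x 1, x 0] *
      ((List.range (n - 1)).map (fun i => FreeMonoid.ofList [x (i + 2), x (i + 1)])).prod *
      FreeMonoid.of (x n)) ∧
    Isoterm M (FreeMonoid.of (x 0) *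
      ((List.range n).map (fun i => FreeMonoid.ofList [x (i + 1), x i])).prod *
      FreeMonoid.ofList [t, x n]) := by
  obtain ⟨m, rfl⟩ : ∃ m, n = m + 1 := ⟨n - 1, by omega⟩
  refine ⟨isoterm_staircase m hz x hv hx hxh, ?_⟩
  have hz' : Isoterm Mᵐᵒᵖ (zimin (m + 3)) := by
    rw [← reverse_zimin, isoterm_op_reverse]
    exact hz
  have key := isoterm_staircase m hz' (fun i => x (m + 1 - i)) t
    (fun i j hi hj hij => by
      have := hx _ _ (Nat.sub_le _ _) (Nat.sub_le _ _) hij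
      omega)
    (fun i _ => hxt _ (Nat.sub_le _ _))
  rw [← isoterm_op_reverse]
  convert key using 1
  rw [List.range_succ, List.map_append, List.prod_append, reverse_mul, reverse_mul, reverse_mul,
    reverse_prod_range_pairs]
  simp only [Nat.sub_self, Nat.sub_zero, Nat.add_sub_cancel, ← mul_assoc]
  rfl
end

section
/- Let M be a monoid for which every Zimin word zₙ (n ≥ 1) is an isoterm. Then for each n ≥ 3, the words ŵₙ and ŵₙ' are isoterms for M. -/
/-- The fixed pairwise distinct variables: `y = 0`, `z = 1`, `h = 2`, `t = 3`, `xᵢ = i + 4`. -/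
def xh (i : ℕ) : ℕ := i + 4

/-- `ŵₙ = x₀hx₁yzx₀ · x₂x₁ · x₃x₂ ⋯ xₙ₋₁xₙ₋₂ · xₙyzxₙ₋₁txₙ`. -/
def wh (n : ℕ) : Word :=
  FreeMonoid.ofList [xh 0, 2, xh 1, 0, 1, xh 0] *
    ((List.range (n - 2)).map (fun i => FreeMonoid.ofList [xh (i + 2), xh (i + 1)])).prod *
    FreeMonoid.ofList [xh n, 0, 1, xh (n - 1), 3, xh n]

/-- `ŵₙ' = x₀hx₁zyx₀ · x₂x₁ · x₃x₂ ⋯ xₙ₋₁xₙ₋₂ · xₙzyxₙ₋₁txₙ`. -/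
def wh' (n : ℕ) : Word :=
  FreeMonoid.ofList [xh 0, 2, xh 1, 1, 0, xh 0] *
    ((List.range (n - 2)).map (fun i => FreeMonoid.ofList [xh (i + 2), xh (i + 1)])).prod *
    FreeMonoid.ofList [xh n, 1, 0, xh (n - 1), 3, xh n]

/-- The endomorphism of the free monoid replacing each letter `c` by the word `σ c`. -/
def substHom (σ : ℕ → List ℕ) : Word →* Word :=
  FreeMonoid.lift fun c => FreeMonoid.ofList (σ c)

theorem substHom_ofList (σ : ℕ → List ℕ) (w : List ℕ) :
    substHom σ (FreeMonoid.ofList w) = FreeMonoid.ofList (w.flatMap σ) := by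
  induction w with
  | nil => simp
  | cons c w ih =>
    rw [FreeMonoid.ofList_cons, map_mul, ih, List.flatMap_cons, FreeMonoid.ofList_append]
    simp [substHom]

theorem Satisfies.subst {M : Type*} [Monoid M] {u v : List ℕ}
    (h : Satisfies M (FreeMonoid.ofList u) (FreeMonoid.ofList v)) (σ : ℕ → List ℕ) :
    Satisfies M (FreeMonoid.ofList (u.flatMap σ)) (FreeMonoid.ofList (v.flatMap σ)) := by
  intro f
  simpa [substHom_ofList] using h (f.comp (substHom σ))

theorem Satisfies.context {M : Type*} [Monoid M] {u v : List ℕ}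
    (h : Satisfies M (FreeMonoid.ofList u) (FreeMonoid.ofList v)) (p q : List ℕ) :
    Satisfies M (FreeMonoid.ofList (p ++ u ++ q)) (FreeMonoid.ofList (p ++ v ++ q)) := by
  intro f
  simp [FreeMonoid.ofList_append, h f]

theorem flatMap_eq_filter_ne (x : ℕ) (w : List ℕ) :
    w.flatMap (fun c => if c = x then [] else [c]) = w.filter (· ≠ x) := by
  induction w with
  | nil => rfl
  | cons c w ih => by_cases hc : c = x <;> simpa [hc] using ih

/-- Shift every letter by one and insert the letter `0` after it. -/
def spread (u : List ℕ) : List ℕ := u.flatMap fun i => [i + 1, 0]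

/-- Shift every letter by one and insert the letter `0` between consecutive letters. -/
def interleave : List ℕ → List ℕ
  | [] => []
  | a :: u => (a + 1) :: u.flatMap fun i => [0, i + 1]

theorem spread_append (u v : List ℕ) : spread (u ++ v) = spread u ++ spread v := by
  simp [spread]

theorem cons_spread (u : List ℕ) :
    0 :: spread u = (u.flatMap fun i => [0, i + 1]) ++ [0] := by
  induction u with
  | nil => rfl
  | cons a u ih => simpa [spread] using ih

theorem interleave_append_zero {u : List ℕ} (hu : u ≠ []) : interleave u ++ [0] = spread u := by
  cases u with
  | nil => exact absurd rfl hu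
  | cons a u =>
    have := cons_spread u
    simp only [interleave, spread, List.cons_append, List.flatMap_cons, List.nil_append] at this ⊢
    rw [← this]

/-- The Zimin words over the variables `0, 1, 2, …`. -/
def ziminList : ℕ → List ℕ
  | 0 => []
  | m + 1 => 0 :: spread (ziminList m)

theorem ziminList_succ (m : ℕ) : ziminList (m + 1) = ziminList m ++ m :: ziminList m := by
  induction m with
  | zero => rfl
  | succ m ih =>
    have h : spread (m :: ziminList m) = (m + 1) :: ziminList (m + 1) := rfl
    rw [ziminList, ih, spread_append, ← List.cons_append, h, ← ih]
    rfl

theorem ofList_map_succ_ziminList (m : ℕ) :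
    FreeMonoid.ofList ((ziminList (m + 1)).map Nat.succ) = zimin (m + 1) := by
  induction m with
  | zero => rfl
  | succ m ih =>
    rw [ziminList_succ, zimin, ← ih, List.map_append, List.map_cons, FreeMonoid.ofList_append,
      FreeMonoid.ofList_cons, mul_assoc]

theorem eq_of_satisfies_ziminList {M : Type*} [Monoid M]
    (hz : ∀ m : ℕ, 1 ≤ m → Isoterm M (zimin m)) {m : ℕ} {v : List ℕ}
    (h : Satisfies M (FreeMonoid.ofList (ziminList (m + 1))) (FreeMonoid.ofList v)) :
    v = ziminList (m + 1) := by
  have h' := h.subst fun c => [c.succ]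
  rw [← List.map_eq_flatMap, ← List.map_eq_flatMap, ofList_map_succ_ziminList] at h'
  have := hz (m + 1) (by omega) _ h'
  rw [← ofList_map_succ_ziminList] at this
  exact List.map_injective_iff.2 Nat.succ_injective (FreeMonoid.ofList.injective this)

/-- In every factor `cd` of `w`, exactly one of `e c` and `b d` holds. -/
abbrev Alternates (e b : ℕ → Prop) (w : List ℕ) : Prop :=
  w.IsChain fun c d => e c ↔ ¬ b d

/-- Words that can be emptied by successively deleting letters `x` that are free: there is a
marking of the ends (`e`) and beginnings (`b`) of letters which marks both sides of `x` and in
which every factor `cd` has exactly one mark at the junction. -/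
inductive Reducible : List ℕ → Prop
  | nil : Reducible []
  | delete (x : ℕ) (e b : ℕ → Prop) {w w' : List ℕ} (he : e x) (hb : b x)
      (hw : Alternates e b w) (hw' : w.filter (· ≠ x) = w') (h : Reducible w') : Reducible w

open Classical in
/-- Extend a substitution `σ` to one mapping the free letter `x` to `0`, placing `0` before or
after the interleaved image of any other letter as prescribed by the marking. -/
noncomputable def extendSubst (x : ℕ) (e b : ℕ → Prop) (σ : ℕ → List ℕ) (c : ℕ) : List ℕ :=
  if c = x then [0]
  else (if b c then [0] else []) ++ interleave (σ c) ++ (if e c then [0] else [])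

section ExtendSubst

variable {x : ℕ} {e b : ℕ → Prop} {σ : ℕ → List ℕ}

theorem extendSubst_self : extendSubst x e b σ x = [0] := by
  simp [extendSubst]

theorem extendSubst_of_mark {c : ℕ} (hc : c ≠ x) (hσ : σ c ≠ []) (hb : b c) :
    ∃ i l, extendSubst x e b σ c = 0 :: (i + 1) :: l := by
  cases h : σ c with
  | nil => exact absurd h hσ
  | cons a u => simp [extendSubst, hc, hb, h, interleave]

theorem extendSubst_of_not_mark {c : ℕ} (hc : c ≠ x) (hσ : σ c ≠ []) (hb : ¬ b c) :
    ∃ i l, extendSubst x e b σ c = (i + 1) :: l := by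
  cases h : σ c with
  | nil => exact absurd h hσ
  | cons a u => simp [extendSubst, hc, hb, h, interleave]

theorem extendSubst_ne_nil {c : ℕ} (hσ : σ c ≠ []) : extendSubst x e b σ c ≠ [] := by
  by_cases hc : c = x
  · simp [hc, extendSubst_self]
  by_cases hb : b c
  · obtain ⟨i, l, h⟩ := extendSubst_of_mark (e := e) hc hσ hb
    simp [h]
  · obtain ⟨i, l, h⟩ := extendSubst_of_not_mark (e := e) hc hσ hb
    simp [h]

open Classical in
theorem flatMap_extendSubst (hσ : ∀ c, σ c ≠ []) (he : e x) (hb : b x) (c : ℕ) (w : List ℕ)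
    (hw : Alternates e b (c :: w)) :
    ∃ q, (if b c then [] else [0]) ++ (c :: w).flatMap (extendSubst x e b σ) ++ q =
      0 :: spread (((c :: w).filter (· ≠ x)).flatMap σ) := by
  induction w generalizing c with
  | nil =>
    by_cases hc : c = x
    · exact ⟨[], by simp [hc, hb, extendSubst, spread]⟩
    · refine ⟨if e c then [] else [0], ?_⟩
      have := interleave_append_zero (hσ c)
      by_cases h1 : b c <;> by_cases h2 : e c <;> simp [hc, h1, h2, extendSubst, this]
  | cons d w ih =>
    obtain ⟨q, hq⟩ := ih d hw.of_cons
    refine ⟨q, ?_⟩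
    have hcd : e c ↔ ¬ b d := hw.rel
    by_cases hc : c = x
    · subst hc
      have hd : ¬ b d := hcd.1 he
      simp only [hd, if_false] at hq
      rw [List.flatMap_cons, extendSubst_self]
      simpa [hb] using hq
    · rw [List.filter_cons_of_pos (by simpa using hc), List.flatMap_cons,
        List.flatMap_cons (f := σ), spread_append, ← interleave_append_zero (hσ c),
        List.append_assoc (interleave _), List.singleton_append, ← hq]
      by_cases h1 : b c <;> by_cases h2 : b d <;> simp [hc, h1, h2, hcd, extendSubst]

theorem eq_of_flatMap_extendSubst_eq (hσ : ∀ c, σ c ≠ []) (he : e x) (hb : b x)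
    {w w' : List ℕ} (hw : Alternates e b w) (hf : w'.filter (· ≠ x) = w.filter (· ≠ x))
    (hs : w'.flatMap (extendSubst x e b σ) = w.flatMap (extendSubst x e b σ)) : w' = w := by
  induction w generalizing w' with
  | nil =>
    cases w' with
    | nil => rfl
    | cons c' v' => simp [extendSubst_ne_nil (hσ c')] at hs
  | cons c v ih =>
    cases w' with
    | nil => simp [extendSubst_ne_nil (hσ c)] at hs
    | cons c' v' =>
      have key : c' = c := by
        by_contra hne
        by_cases hc : c = x
        · subst hc
          rw [List.filter_cons_of_pos (by simpa using hne),
            List.filter_cons_of_neg (by simp)] at hf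
          cases v with
          | nil => simp at hf
          | cons d v =>
            have hd : ¬ b d := hw.rel.1 he
            have hdc : d ≠ c := fun h => hd (h ▸ hb)
            rw [List.filter_cons_of_pos (by simpa using hdc)] at hf
            obtain rfl := (List.cons.inj hf).1
            obtain ⟨i, l, h⟩ := extendSubst_of_not_mark (e := e) hne (hσ c') hd
            simp [h, extendSubst_self] at hs
        · by_cases hc' : c' = x
          · subst hc'
            by_cases hbc : b c
            · obtain ⟨i, l, h⟩ := extendSubst_of_mark (e := e) hc (hσ c) hbc
              rw [List.filter_cons_of_neg (by simp),
                List.filter_cons_of_pos (by simpa using hc)] at hf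
              cases v' with
              | nil => simp at hf
              | cons d v' =>
                by_cases hd : d = c'
                · simp [hd, h, extendSubst_self] at hs
                · rw [List.filter_cons_of_pos (by simpa using hd)] at hf
                  obtain rfl := (List.cons.inj hf).1
                  simp [h, extendSubst_self] at hs
            · obtain ⟨i, l, h⟩ := extendSubst_of_not_mark (e := e) hc (hσ c) hbc
              simp [h, extendSubst_self] at hs
          · rw [List.filter_cons_of_pos (by simpa using hc'),
              List.filter_cons_of_pos (by simpa using hc)] at hf
            exact hne (List.cons.inj hf).1
      subst key
      rw [List.flatMap_cons, List.flatMap_cons] at hs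
      rw [ih hw.of_cons ?_ (List.append_cancel_left hs)]
      by_cases hc : c' = x
      · simpa [hc] using hf
      · simpa [hc] using hf

open Classical in
theorem exists_context_extendSubst (hσ : ∀ c, σ c ≠ []) (he : e x) (hb : b x) {w p q : List ℕ}
    {m : ℕ} (hw : Alternates e b w)
    (h : p ++ (w.filter (· ≠ x)).flatMap σ ++ q = ziminList m) :
    ∃ p' q', p' ++ w.flatMap (extendSubst x e b σ) ++ q' = ziminList (m + 1) := by
  cases w with
  | nil => exact ⟨ziminList (m + 1), [], by simp⟩
  | cons c w =>
    obtain ⟨r, hr⟩ := flatMap_extendSubst hσ he hb c w hw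
    refine ⟨(p.flatMap fun i => [0, i + 1]) ++ if b c then [] else [0], r ++ spread q, ?_⟩
    rw [ziminList, ← h, spread_append, spread_append, ← List.cons_append, ← List.cons_append,
      cons_spread, List.append_assoc _ [0], List.singleton_append, ← hr]
    simp only [List.append_assoc]

end ExtendSubst

theorem Reducible.exists_subst {w : List ℕ} (h : Reducible w) :
    ∃ (m : ℕ) (σ : ℕ → List ℕ) (p q : List ℕ), (∀ c, σ c ≠ []) ∧
      p ++ w.flatMap σ ++ q = ziminList (m + 1) := by
  induction h with
  | nil => exact ⟨0, fun _ => [0], [0], [], by simp, rfl⟩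
  | @delete x e b w w' he hb hw hw' _ ih =>
    subst hw'
    obtain ⟨m, σ, p, q, hσ, h⟩ := ih
    obtain ⟨p', q', h'⟩ := exists_context_extendSubst hσ he hb hw h
    exact ⟨m + 1, extendSubst x e b σ, p', q', fun c => extendSubst_ne_nil (hσ c), h'⟩

theorem Reducible.isoterm {M : Type*} [Monoid M]
    (hz : ∀ m : ℕ, 1 ≤ m → Isoterm M (zimin m)) {w : List ℕ} (h : Reducible w) :
    Isoterm M (FreeMonoid.ofList w) := by
  suffices H : ∀ v : List ℕ, Satisfies M (FreeMonoid.ofList w) (FreeMonoid.ofList v) → v = w from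
    fun v hv => congrArg FreeMonoid.ofList (H (FreeMonoid.toList v) hv)
  induction h with
  | nil =>
    intro v hv
    have := eq_of_satisfies_ziminList hz (m := 0) ((hv.subst fun _ => [0]).context [0] [])
    cases v with
    | nil => rfl
    | cons c v => simp [ziminList, spread] at this
  | @delete x e b w w' he hb hw hw' h ih =>
    subst hw'
    intro v hv
    obtain ⟨m, σ, p, q, hσ, hp⟩ := h.exists_subst
    obtain ⟨p', q', h'⟩ := exists_context_extendSubst hσ he hb hw hp
    have hdel := hv.subst fun c => if c = x then [] else [c]
    rw [flatMap_eq_filter_ne, flatMap_eq_filter_ne] at hdel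
    refine eq_of_flatMap_extendSubst_eq hσ he hb hw (ih _ hdel) ?_
    have hsub := (hv.subst (extendSubst x e b σ)).context p' q'
    rw [h'] at hsub
    have heq := eq_of_satisfies_ziminList hz hsub
    rw [← h'] at heq
    exact List.append_cancel_left (List.append_cancel_right heq)

/-- The word `x_{i+1} x_i · x_{i+2} x_{i+1} ⋯` with `l` two-letter blocks. -/
def blocks (i : ℕ) : ℕ → List ℕ
  | 0 => []
  | l + 1 => xh (i + 1) :: xh i :: blocks (i + 1) l

theorem isChain_blocks {R : ℕ → ℕ → Prop} {r : List ℕ} (i l : ℕ)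
    (h1 : ∀ j, i ≤ j → j ≤ i + l → R (xh (j + 1)) (xh j))
    (h2 : ∀ j, i ≤ j → j < i + l → R (xh j) (xh (j + 2)))
    (hr : (xh (i + l) :: r).IsChain R) : (xh i :: (blocks (i + 1) l ++ r)).IsChain R := by
  induction l generalizing i with
  | zero => simpa [blocks] using hr
  | succ l ih =>
    refine .cons_cons (h2 i le_rfl (by omega)) (.cons_cons (h1 (i + 1) (by omega) (by omega)) ?_)
    exact ih (i + 1) (fun j hj hj' => h1 j (by omega) (by omega))
      (fun j hj hj' => h2 j (by omega) (by omega)) (by rwa [Nat.add_right_comm])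

theorem filter_blocks {i k : ℕ} (h : k < i) (l : ℕ) :
    (blocks i l).filter (· ≠ xh k) = blocks i l := by
  induction l generalizing i with
  | zero => rfl
  | succ l ih =>
    rw [blocks, List.filter_cons_of_pos (by simp [xh]; omega),
      List.filter_cons_of_pos (by simp [xh]; omega), ih (by omega)]

theorem reducible_of_pair_deleted {y z p : ℕ} (hyz : y = 0 ∧ z = 1 ∨ y = 1 ∧ z = 0)
    (hp : 5 ≤ p) : Reducible [xh 0, 2, y, z, xh 0, p, y, z, 3, p] := by
  obtain ⟨p, rfl⟩ := Nat.exists_eq_add_of_le' hp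
  have h0 : xh 0 = 4 := rfl
  rw [h0]
  refine .delete y (· = y) (· ≠ z) rfl (by omega) ?_
    (w' := [4, 2, z, 4, p + 5, z, 3, p + 5]) ?_ ?_
  · simp; omega
  · rcases hyz with ⟨rfl, rfl⟩ | ⟨rfl, rfl⟩ <;> simp
  refine .delete (p + 5) (fun c => c = p + 5 ∨ c = 2) (· ≠ z) (by omega) (by omega) ?_
    (w' := [4, 2, z, 4, z, 3]) ?_ ?_
  · simp; omega
  · rcases hyz with ⟨rfl, rfl⟩ | ⟨rfl, rfl⟩ <;> simp
  refine .delete z (· = z) (fun c => c = z ∨ c = 2) rfl (by omega) ?_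
    (w' := [4, 2, 4, 3]) ?_ ?_
  · simp; omega
  · rcases hyz with ⟨rfl, rfl⟩ | ⟨rfl, rfl⟩ <;> simp
  refine .delete 4 (· = 4) (· = 4) rfl rfl ?_ (w' := [2, 3]) rfl ?_
  · simp
  refine .delete 2 (· = 2) (· = 2) rfl rfl ?_ (w' := [3]) rfl ?_
  · simp
  exact .delete 3 (· = 3) (· = 3) rfl rfl (by simp) rfl .nil

theorem reducible_of_blocks {y z m : ℕ} (hyz : y = 0 ∧ z = 1 ∨ y = 1 ∧ z = 0) (k l : ℕ)
    (hk : 2 ≤ k) (hm : m = k + l) :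
    Reducible ([xh 0, 2, y, z, xh 0, xh k] ++ blocks k l ++
      [xh (m + 1), y, z, xh m, 3, xh (m + 1)]) := by
  have hf1 : [xh 0, 2, y, z, xh 0, xh k].filter (· ≠ xh k) = [xh 0, 2, y, z, xh 0] := by
    obtain ⟨k, rfl⟩ := Nat.exists_eq_add_of_le' hk
    rcases hyz with ⟨rfl, rfl⟩ | ⟨rfl, rfl⟩ <;> simp [xh]
  induction l generalizing k with
  | zero =>
    obtain rfl : m = k := hm
    refine .delete (xh m) (fun c => c = xh m ∨ c = 3) (fun c => c = xh m ∨ c ≤ 2 ∨ c = 4)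
      (by omega) (by omega) ?_ ?_ (reducible_of_pair_deleted hyz (p := xh (m + 1)) ?_)
    · simp [blocks, xh]; omega
    · have hf2 : [xh (m + 1), y, z, xh m, 3, xh (m + 1)].filter (· ≠ xh m) =
          [xh (m + 1), y, z, 3, xh (m + 1)] := by
        rcases hyz with ⟨rfl, rfl⟩ | ⟨rfl, rfl⟩ <;> simp [xh]
      rw [List.filter_append, List.filter_append, hf1, hf2]
      rfl
    · simp [xh]
  | succ l ih =>
    have hf1' : [xh 0, 2, y, z, xh 0, xh (k + 1)].filter (· ≠ xh (k + 1)) =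
        [xh 0, 2, y, z, xh 0] := by
      rcases hyz with ⟨rfl, rfl⟩ | ⟨rfl, rfl⟩ <;> simp [xh]
    refine .delete (xh k)
      (fun c => 5 ≤ c ∧ c % 3 ≠ (k + 2) % 3 ∧ c ≠ m + 5 ∨ c = 3 ∧ (m + 2) % 3 ≠ (k + 1) % 3 ∨
        c = z ∧ (m + 1) % 3 ≠ (k + 1) % 3)
      (fun c => 5 ≤ c ∧ c % 3 = (k + 1) % 3 ∨ c = 3 ∧ (m + 1) % 3 = (k + 2) % 3 ∨
        c = 4 ∧ (m + 1) % 3 = (k + 1) % 3 ∨ c ≤ 2)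
      (by simp only [xh]; omega) (by simp only [xh]; omega) ?_ ?_
      (ih (k + 1) (by omega) (by omega) hf1')
    · refine .cons_cons ?_ <| .cons_cons ?_ <| .cons_cons ?_ <| .cons_cons ?_ <|
        .cons_cons ?_ <| .cons_cons ?_ <| .cons_cons ?_ <| isChain_blocks k l ?_ ?_ <|
        .cons_cons ?_ <| .cons_cons ?_ <| .cons_cons ?_ <| .cons_cons ?_ <|
        .cons_cons ?_ <| .cons_cons ?_ <| .singleton _
      all_goals rcases hyz with ⟨rfl, rfl⟩ | ⟨rfl, rfl⟩
      all_goals intros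
      all_goals simp [xh]
      all_goals omega
    · have hf2 : [xh (m + 1), y, z, xh m, 3, xh (m + 1)].filter (· ≠ xh k) =
          [xh (m + 1), y, z, xh m, 3, xh (m + 1)] := by
        rcases hyz with ⟨rfl, rfl⟩ | ⟨rfl, rfl⟩ <;> simp [xh] <;> omega
      rw [List.filter_append, List.filter_append, hf1, hf2, blocks,
        List.filter_cons_of_pos (by simp [xh]), List.filter_cons_of_neg (by simp),
        filter_blocks (Nat.lt_succ_self k)]
      rfl

theorem reducible_wh {y z n : ℕ} (hyz : y = 0 ∧ z = 1 ∨ y = 1 ∧ z = 0) (hn : 3 ≤ n) :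
    Reducible ([xh 0, 2, xh 1, y, z, xh 0] ++ blocks 1 (n - 2) ++
      [xh n, y, z, xh (n - 1), 3, xh n]) := by
  obtain ⟨l, rfl⟩ := Nat.exists_eq_add_of_le' hn
  refine .delete (xh 1)
      (fun c => 5 ≤ c ∧ (c % 3 = 2 ∨ c = l + 7) ∨ c = 3 ∧ l % 3 = 0 ∨ c = z ∧ l % 3 = 1)
      (fun c => 5 ≤ c ∧ c % 3 ≠ 1 ∨ c = 3 ∧ l % 3 ≠ 2 ∨ c = 4 ∧ l % 3 ≠ 1 ∨ c = z ∨ c = 2)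
      (by simp [xh]) (by simp [xh]) ?_ ?_
      (reducible_of_blocks hyz 2 l le_rfl (Nat.add_comm l 2))
  · refine .cons_cons ?_ <| .cons_cons ?_ <| .cons_cons ?_ <| .cons_cons ?_ <|
        .cons_cons ?_ <| .cons_cons ?_ <| .cons_cons ?_ <| isChain_blocks 1 l ?_ ?_ <|
        .cons_cons ?_ <| .cons_cons ?_ <| .cons_cons ?_ <| .cons_cons ?_ <|
        .cons_cons ?_ <| .cons_cons ?_ <| .singleton _
    all_goals rcases hyz with ⟨rfl, rfl⟩ | ⟨rfl, rfl⟩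
    all_goals intros
    all_goals simp [xh]
    all_goals omega
  · have hf1 : [xh 0, 2, xh 1, y, z, xh 0].filter (· ≠ xh 1) = [xh 0, 2, y, z, xh 0] := by
      rcases hyz with ⟨rfl, rfl⟩ | ⟨rfl, rfl⟩ <;> simp [xh]
    have hf2 : [xh (l + 3), y, z, xh (l + 2), 3, xh (l + 3)].filter (· ≠ xh 1) =
        [xh (l + 3), y, z, xh (l + 2), 3, xh (l + 3)] := by
      rcases hyz with ⟨rfl, rfl⟩ | ⟨rfl, rfl⟩ <;> simp [xh]
    change List.filter _ (_ ++ blocks 1 (l + 1) ++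
      [xh (l + 3), y, z, xh (l + 2), 3, xh (l + 3)]) = _
    rw [List.filter_append, List.filter_append, hf1, hf2, blocks,
      List.filter_cons_of_pos (by simp [xh]), List.filter_cons_of_neg (by simp),
      filter_blocks (by omega)]
    rfl

theorem prod_map_range_eq_blocks (l i : ℕ) :
    ((List.range l).map (fun j => FreeMonoid.ofList [xh (j + i + 1), xh (j + i)])).prod =
      FreeMonoid.ofList (blocks i l) := by
  induction l generalizing i with
  | zero => rfl
  | succ l ih =>
    have hb : blocks i (l + 1) = [xh (i + 1), xh i] ++ blocks (i + 1) l := rfl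
    rw [List.range_succ_eq_map, List.map_cons, List.prod_cons, List.map_map, hb,
      FreeMonoid.ofList_append, ← ih (i + 1)]
    simp only [Function.comp_def, Nat.zero_add, Nat.succ_add, Nat.add_succ, Nat.add_zero]

/-- If every Zimin word is an isoterm for `M`, then for each `n ≥ 3` the words
`ŵₙ` and `ŵₙ'` are isoterms for `M`. -/
theorem statement14 (M : Type*) [Monoid M]
    (hz : ∀ m : ℕ, 1 ≤ m → Isoterm M (zimin m)) (n : ℕ) (hn : 3 ≤ n) :
    Isoterm M (wh n) ∧ Isoterm M (wh' n) := by
  have h := prod_map_range_eq_blocks (n - 2) 1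
  constructor
  · have := (reducible_wh (.inl ⟨rfl, rfl⟩) hn).isoterm hz
    rwa [FreeMonoid.ofList_append, FreeMonoid.ofList_append, ← h] at this
  · have := (reducible_wh (.inr ⟨rfl, rfl⟩) hn).isoterm hz
    rwa [FreeMonoid.ofList_append, FreeMonoid.ofList_append, ← h] at this
end

section
/- Let n, k ≥ 3 be natural numbers with n ≠ k and let θ be any substitution (monoid endomorphism of A*). If θ(ŵₙ) is a factor of ŵ_k, then θ(ŵₙ) = θ(ŵₙ'); likewise, if θ(ŵₙ') is a factor of ŵ_k, then θ(ŵₙ) = θ(ŵₙ'). -/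
/-- `u` is a factor of `v`. -/
def IsFactor (u v : Word) : Prop := ∃ a b : Word, v = a * u * b

/-- The word `(j+1) j (j+2) (j+1) ⋯ (j+m) (j+m-1) (j+m+1)`. -/
def zigzag : ℕ → ℕ → List ℕ
  | 0, j => [j + 1]
  | m + 1, j => (j + 1) :: j :: zigzag m (j + 1)

/-- The list form of `ŵₘ₊₂`, with the letters `y`, `z` replaced by `p`, `q`. -/
def hatList (p q m : ℕ) : List ℕ :=
  [4, 2, 5] ++ [p, q] ++ (4 :: zigzag m 5) ++ [p, q] ++ [m + 5, 3, m + 6]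

theorem length_zigzag (m j : ℕ) : (zigzag m j).length = 2 * m + 1 := by
  induction m generalizing j with
  | zero => rfl
  | succ m ih => simp [zigzag, ih]; ring

theorem getElem?_zigzag (m j i : ℕ) (hi : i < 2 * m + 1) :
    (zigzag m j)[i]? = some (if i % 2 = 0 then j + 1 + i / 2 else j + i / 2) := by
  induction m generalizing i j with
  | zero => obtain rfl : i = 0 := by omega
            rfl
  | succ m ih =>
    match i with
    | 0 => rfl
    | 1 => rfl
    | i + 2 =>
      simp only [zigzag, List.getElem?_cons_succ]
      rw [ih _ _ (by omega)]
      congr 1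
      split_ifs <;> omega

theorem le_of_mem_zigzag {m j a : ℕ} (ha : a ∈ zigzag m j) : j ≤ a := by
  induction m generalizing j with
  | zero => simp [zigzag] at ha; omega
  | succ m ih =>
    simp only [zigzag, List.mem_cons] at ha
    rcases ha with rfl | rfl | ha
    · omega
    · omega
    · have := ih ha
      omega

theorem last_mem_zigzag (m j : ℕ) : m + j + 1 ∈ zigzag m j := by
  induction m generalizing j with
  | zero => simp [zigzag]
  | succ m ih =>
    have := ih (j + 1)
    simp only [zigzag, List.mem_cons]
    right; right
    convert this using 1
    ring

theorem penultimate_mem_zigzag (m j : ℕ) : m + 1 + j ∈ zigzag (m + 1) j := by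
  induction m generalizing j with
  | zero => simp [zigzag, add_comm]
  | succ m ih =>
    have := ih (j + 1)
    rw [zigzag, List.mem_cons, List.mem_cons]
    right; right
    convert this using 1
    ring

theorem zigzag_trichotomy {m j a : ℕ} (ha : a ∈ zigzag m j) :
    a = j ∨ a = m + j ∨ a = m + j + 1 ∨
      ∃ P Q R, zigzag m j = P ++ [a] ++ Q ++ [a] ++ R := by
  induction m generalizing j with
  | zero => simp [zigzag] at ha; omega
  | succ m ih =>
    have step : a ∈ zigzag m (j + 1) → a = j ∨ a = m + 1 + j ∨ a = m + 1 + j + 1 ∨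
        ∃ P Q R, zigzag (m + 1) j = P ++ [a] ++ Q ++ [a] ++ R := by
      intro ha
      rcases ih ha with h | h | h | ⟨P, Q, R, h⟩
      · match m with
        | 0 => omega
        | m + 1 =>
          right; right; right
          exact ⟨[], [j, j + 2], zigzag m (j + 2), by simp [zigzag, h]⟩
      · omega
      · omega
      · right; right; right
        exact ⟨(j + 1) :: j :: P, Q, R, by simp [zigzag, h]⟩
    simp only [zigzag, List.mem_cons] at ha
    rcases ha with h | h | h
    · match m with
      | 0 => omega
      | m + 1 => exact step (by simp [zigzag, h])
    · omega
    · exact step h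

theorem hatList_letter_at {k i v : ℕ} (h : (hatList 0 1 k)[i]? = some v) :
    i = 0 ∧ v = 4 ∨ i = 1 ∧ v = 2 ∨ i = 2 ∧ v = 5 ∨ i = 3 ∧ v = 0 ∨ i = 4 ∧ v = 1 ∨
    (5 ≤ i ∧ i ≤ 2 * k + 6 ∧ (i + 6 = 2 * v ∨ i + 3 = 2 * v)) ∨
    i = 2 * k + 7 ∧ v = 0 ∨ i = 2 * k + 8 ∧ v = 1 ∨ i = 2 * k + 9 ∧ v = k + 5 ∨
    i = 2 * k + 10 ∧ v = 3 ∨ i = 2 * k + 11 ∧ v = k + 6 := by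
  match i with
  | 0 | 1 | 2 | 3 | 4 | 5 =>
    simp only [hatList, List.append_assoc, List.cons_append, List.nil_append,
      List.getElem?_cons_succ, List.getElem?_cons_zero, Option.some_inj] at h
    subst h
    simp
  | i + 6 =>
    simp only [hatList, List.append_assoc, List.cons_append, List.nil_append,
      List.getElem?_cons_succ] at h
    by_cases hi : i < 2 * k + 1
    · rw [List.getElem?_append_left (by rwa [length_zigzag]), getElem?_zigzag _ _ _ hi,
        Option.some_inj] at h
      iterate 5 right
      left
      split_ifs at h <;> omega
    · obtain ⟨d, rfl⟩ : ∃ d, i = 2 * k + 1 + d := ⟨i - (2 * k + 1), by omega⟩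
      rw [List.getElem?_append_right (by simp [length_zigzag]), length_zigzag,
        Nat.add_sub_cancel_left] at h
      iterate 6 right
      match d with
      | 0 | 1 | 2 | 3 | 4 =>
        simp only [List.getElem?_cons_succ, List.getElem?_cons_zero, Option.some_inj] at h
        subst h
        simp; try omega
      | d + 5 => simp at h

theorem hatList_repeated_letter {k i i' v : ℕ} (hk : 1 ≤ k) (hlt : i < i')
    (h : (hatList 0 1 k)[i]? = some v) (h' : (hatList 0 1 k)[i']? = some v) :
    i = 3 ∧ i' = 2 * k + 7 ∨ i = 4 ∧ i' = 2 * k + 8 ∨ i % 2 = 0 ∧ i ≠ 4 ∧ i' % 2 = 1 := by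
  have h₁ := hatList_letter_at h
  have h₂ := hatList_letter_at h'
  clear h h'
  rcases h₁ with h₁ | h₁ | h₁ | h₁ | h₁ | h₁ | h₁ | h₁ | h₁ | h₁ | h₁ <;>
    rcases h₂ with h₂ | h₂ | h₂ | h₂ | h₂ | h₂ | h₂ | h₂ | h₂ | h₂ | h₂ <;> omega

/-- `yz` is the only word of length two that occurs twice in `ŵₖ₊₂`. -/
theorem hatList_repeated_pair {k i i' v w : ℕ} (hk : 1 ≤ k) (hlt : i < i')
    (h₀ : (hatList 0 1 k)[i]? = some v) (h₀' : (hatList 0 1 k)[i']? = some v)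
    (h₁ : (hatList 0 1 k)[i + 1]? = some w) (h₁' : (hatList 0 1 k)[i' + 1]? = some w) :
    i = 3 ∧ i' = 2 * k + 7 := by
  have a := hatList_repeated_letter hk hlt h₀ h₀'
  have b := hatList_repeated_letter hk (by omega) h₁ h₁'
  omega

theorem length_hatList (p q k : ℕ) : (hatList p q k).length = 2 * k + 12 := by
  simp [hatList, length_zigzag]

theorem hatList_repeated_factor {k : ℕ} {A U B C : List ℕ} (hk : 1 ≤ k) (hU : 2 ≤ U.length)
    (h : hatList 0 1 k = A ++ U ++ B ++ U ++ C) :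
    A = [4, 2, 5] ∧ U = [0, 1] ∧ B = 4 :: zigzag k 5 ∧ C = [k + 5, 3, k + 6] := by
  have hlen := congrArg List.length h
  rw [length_hatList] at hlen
  simp only [List.length_append] at hlen
  have key : ∀ d, (hd : d < U.length) → (hatList 0 1 k)[A.length + d]? = some U[d] ∧
      (hatList 0 1 k)[A.length + U.length + B.length + d]? = some U[d] := by
    intro d hd
    rw [h, ← List.getElem?_eq_getElem hd]
    constructor
    · simp only [List.append_assoc]
      rw [List.getElem?_append_right (by omega), Nat.add_sub_cancel_left,
        List.getElem?_append_left hd]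
    · rw [List.append_assoc, List.getElem?_append_right (by simp; omega),
        List.getElem?_append_left (by simp; omega)]
      congr 1
      simp; omega
  obtain ⟨h₀, h₀'⟩ := key 0 (by omega)
  obtain ⟨h₁, h₁'⟩ := key 1 (by omega)
  obtain ⟨a₁, a₂⟩ := hatList_repeated_pair hk (by omega) h₀ h₀' h₁ h₁'
  have hU2 : U.length = 2 := by
    by_contra hne
    obtain ⟨h₂, h₂'⟩ := key 2 (by omega)
    obtain ⟨b₁, b₂⟩ := hatList_repeated_pair hk (by omega) h₁ h₁' h₂ h₂'
    omega
  have hlz := length_zigzag k 5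
  rw [hatList] at h
  obtain ⟨e₁, hC⟩ := List.append_inj h (by simp; omega)
  obtain ⟨e₂, -⟩ := List.append_inj e₁ (by simp; omega)
  obtain ⟨e₃, hB⟩ := List.append_inj e₂ (by simp; omega)
  obtain ⟨hA, hU'⟩ := List.append_inj e₃ (by simp; omega)
  exact ⟨hA.symm, hU'.symm, hB.symm, hC.symm⟩

theorem eq_nil_or_singleton_of_length_le_one {l : List ℕ} (h : l.length ≤ 1) :
    l = [] ∨ ∃ a, l = [a] := by
  match l with
  | [] => exact .inl rfl
  | [a] => exact .inr ⟨a, rfl⟩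
  | _ :: _ :: _ => simp at h

theorem flatMap_zigzag_index_eq {f : ℕ → List ℕ} {m m' j : ℕ} (hj : f j = [j])
    (hf : ∀ a ∈ zigzag m j, (f a).length ≤ 1)
    (h : (zigzag m j).flatMap f = zigzag m' j) : m = m' := by
  induction m generalizing m' j with
  | zero =>
    have := congrArg List.length h
    have h1 := hf (j + 1) (by simp [zigzag])
    simp [zigzag, length_zigzag] at this
    omega
  | succ m ih =>
    have h1 := hf (j + 1) (by simp [zigzag])
    rcases eq_nil_or_singleton_of_length_le_one h1 with h2 | ⟨a, h2⟩ <;>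
    cases m' with
    | zero => simp [zigzag, h2, hj] at h
    | succ m' =>
      simp [zigzag, h2, hj] at h
      try
        obtain ⟨rfl, h⟩ := h
        rw [ih h2 (fun a ha => hf a (by simp [zigzag, ha])) h]

theorem flatMap_zigzag_ne {f : ℕ → List ℕ} {m j a b c : ℕ} {l : List ℕ} (hj : f j = [])
    (hf : ∀ a ∈ zigzag m j, (f a).length ≤ 1) (hab : a ≠ b) (hac : a ≠ c) :
    (zigzag m j).flatMap f ≠ a :: b :: c :: l := by
  intro h
  induction m generalizing j with
  | zero =>
    have := congrArg List.length h
    have h1 := hf (j + 1) (by simp [zigzag])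
    simp [zigzag] at this
    omega
  | succ m ih =>
    have h1 := hf (j + 1) (by simp [zigzag])
    rcases eq_nil_or_singleton_of_length_le_one h1 with h2 | ⟨d, h2⟩
    · exact ih h2 (fun a ha => hf a (by simp [zigzag, ha])) (by simpa [zigzag, h2, hj] using h)
    · simp only [zigzag, List.flatMap_cons, h2, hj, List.cons_append, List.nil_append,
        List.cons.injEq] at h
      obtain ⟨rfl, h⟩ := h
      cases m with
      | zero =>
        have h3 := hf (j + 2) (by simp [zigzag])
        rcases eq_nil_or_singleton_of_length_le_one h3 with h4 | ⟨e, h4⟩ <;>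
          simp [zigzag, h4] at h
      | succ p =>
        have h3 := hf (j + 2) (by simp [zigzag])
        rcases eq_nil_or_singleton_of_length_le_one h3 with h4 | ⟨e, h4⟩ <;>
          simp [zigzag, h2, h4] at h
        · exact hab h.1
        · exact hac h.2.1

theorem length_le_one_of_infix_triple {A U B : List ℕ} {a b c : ℕ}
    (h : A ++ U ++ B = [a, b, c]) (hU : b ∉ U) : U.length ≤ 1 := by
  match U with
  | [] => simp
  | [_] => simp
  | u :: v :: U =>
    match A with
    | [] => simp_all
    | [_] => simp_all
    | _ :: _ :: A =>
      have := congrArg List.length h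
      simp at this
      omega

theorem flatMap_hatList_comm {f : ℕ → List ℕ} {p q m m' : ℕ} {A C : List ℕ} (hm : 1 ≤ m)
    (hm' : 1 ≤ m') (hne : m ≠ m') (h : hatList 0 1 m' = A ++ (hatList p q m).flatMap f ++ C) :
    f p ++ f q = f q ++ f p := by
  by_contra hpq
  have hp : f p ≠ [] := by rintro h; simp [h] at hpq
  have hq : f q ≠ [] := by rintro h; simp [h] at hpq
  have hlen : 2 ≤ (f p ++ f q).length := by
    have := List.length_pos_iff.2 hp
    have := List.length_pos_iff.2 hq
    simp; omega
  obtain ⟨h1, h2, h3, h4⟩ := hatList_repeated_factor hm' (A := A ++ f 4 ++ f 2 ++ f 5)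
    (B := f 4 ++ (zigzag m 5).flatMap f) (C := f (m + 5) ++ f 3 ++ f (m + 6) ++ C) hlen
    (by rw [h]; simp [hatList])
  have hmem : ∀ a, a = 4 ∨ a ∈ zigzag m 5 → ∀ b ∈ f a, 4 ≤ b := by
    intro a ha b hb
    have : b ∈ f 4 ++ (zigzag m 5).flatMap f := by
      rcases ha with rfl | ha
      · simp [hb]
      · exact List.mem_append_right _ (List.mem_flatMap.2 ⟨a, ha, hb⟩)
    rw [h3, List.mem_cons] at this
    rcases this with rfl | this
    · rfl
    · have := le_of_mem_zigzag this
      omega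
  have m5 : 5 ∈ zigzag m 5 := by
    obtain ⟨m, rfl⟩ := Nat.exists_eq_add_of_le' hm
    simp [zigzag]
  have mn : m + 6 ∈ zigzag m 5 := last_mem_zigzag m 5
  have mn' : m + 5 ∈ zigzag m 5 := by
    obtain ⟨m, rfl⟩ := Nat.exists_eq_add_of_le' hm
    exact penultimate_mem_zigzag m 5
  have h42 : 2 ∉ f 4 := fun hb => by have := hmem 4 (.inl rfl) 2 hb; omega
  have h52 : 2 ∉ f 5 := fun hb => by have := hmem 5 (.inr m5) 2 hb; omega
  have hn3 : 3 ∉ f (m + 6) := fun hb => by have := hmem _ (.inr mn) 3 hb; omega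
  have hn3' : 3 ∉ f (m + 5) := fun hb => by have := hmem _ (.inr mn') 3 hb; omega
  have l4 : (f 4).length ≤ 1 :=
    length_le_one_of_infix_triple (A := A) (B := f 2 ++ f 5) (by simpa using h1) h42
  have l5 : f 5 = [] ∨ f 5 = [5] := by
    have := length_le_one_of_infix_triple (A := A ++ f 4 ++ f 2) (B := []) (by simpa using h1) h52
    rcases eq_nil_or_singleton_of_length_le_one this with h5 | ⟨a, h5⟩
    · exact .inl h5
    · right
      rw [h5] at h1
      rw [h5, (List.append_inj' (h1.trans (List.append_cons [4] 2 [5])) rfl).2]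
  have hf : ∀ a ∈ zigzag m 5, (f a).length ≤ 1 := by
    intro a ha
    rcases zigzag_trichotomy ha with rfl | rfl | rfl | ⟨P, Q, R, hz⟩
    · rcases l5 with h | h <;> simp [h]
    · exact length_le_one_of_infix_triple (A := []) (B := f 3 ++ f (m + 6) ++ C)
        (by simpa using h4) hn3'
    · exact length_le_one_of_infix_triple (A := f (m + 5) ++ f 3) (B := C) h4 hn3
    · by_contra hl
      have := (hatList_repeated_factor hm' (U := f a) (B := Q.flatMap f)
        (A := A ++ f 4 ++ f 2 ++ f 5 ++ f p ++ f q ++ f 4 ++ P.flatMap f)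
        (C := R.flatMap f ++ f p ++ f q ++ f (m + 5) ++ f 3 ++ f (m + 6) ++ C) (by omega)
        (by rw [h]; simp [hatList, hz])).1
      have h5 := congrArg List.length this
      have h6 := congrArg List.length h1
      simp at h5 h6 hlen
      omega
  obtain ⟨k, rfl⟩ := Nat.exists_eq_add_of_le' hm'
  obtain ⟨m, rfl⟩ := Nat.exists_eq_add_of_le' hm
  have hz : ∃ l, zigzag k 6 = 7 :: l := by cases k <;> simp [zigzag]
  obtain ⟨l, hz⟩ := hz
  rcases eq_nil_or_singleton_of_length_le_one l4 with h4 | ⟨a, h4⟩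
  · rcases l5 with l5 | l5
    · refine flatMap_zigzag_ne (a := 4) (b := 6) (c := 5) l5 hf (by omega) (by omega)
        (l := zigzag k 6) ?_
      simpa [h4, zigzag] using h3
    · rcases eq_nil_or_singleton_of_length_le_one (hf 6 (by simp [zigzag])) with h6 | ⟨b, h6⟩ <;>
        simp [zigzag, h4, l5, h6] at h3
  · simp only [h4, List.cons_append, List.nil_append, List.cons.injEq] at h3
    rcases l5 with l5 | l5
    · exact flatMap_zigzag_ne (a := 6) (b := 5) (c := 7) l5 hf (by omega) (by omega)
        (l := l) (by rw [h3.2, zigzag, hz])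
    · exact hne (flatMap_zigzag_index_eq l5 hf h3.2)

theorem toList_prod_range (m j : ℕ) :
    FreeMonoid.toList ((List.range m).map
      (fun i => FreeMonoid.ofList [i + j + 1, i + j])).prod ++ [m + j + 1] = zigzag m j := by
  induction m generalizing j with
  | zero => simp [zigzag]
  | succ m ih =>
    rw [List.range_succ_eq_map, zigzag, ← ih (j + 1)]
    simp [Function.comp_def, add_assoc, add_comm, add_left_comm]

theorem toList_wh (m : ℕ) : FreeMonoid.toList (wh (m + 2)) = hatList 0 1 m := by
  rw [hatList, ← toList_prod_range]
  simp [wh, xh, add_assoc]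

theorem toList_wh' (m : ℕ) : FreeMonoid.toList (wh' (m + 2)) = hatList 1 0 m := by
  rw [hatList, ← toList_prod_range]
  simp [wh', xh, add_assoc]

theorem toList_map_eq_flatMap (θ : Word →* Word) (w : Word) :
    FreeMonoid.toList (θ w) =
      (FreeMonoid.toList w).flatMap fun v => FreeMonoid.toList (θ (FreeMonoid.of v)) := by
  induction w using FreeMonoid.inductionOn' with
  | one => simp
  | of_mul a w ih => simp [ih]

/-- If `n, k ≥ 3` with `n ≠ k` and `θ` is a substitution such that `θ(ŵₙ)`
(resp. `θ(ŵₙ')`) is a factor of `ŵ_k`, then `θ(ŵₙ) = θ(ŵₙ')`. -/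
theorem statement15 (n k : ℕ) (hn : 3 ≤ n) (hk : 3 ≤ k) (hnk : n ≠ k)
    (θ : Word →* Word) :
    (IsFactor (θ (wh n)) (wh k) → θ (wh n) = θ (wh' n)) ∧
    (IsFactor (θ (wh' n)) (wh k) → θ (wh n) = θ (wh' n)) := by
  obtain ⟨m, rfl⟩ := Nat.exists_eq_add_of_le' (show 2 ≤ n by omega)
  obtain ⟨m', rfl⟩ := Nat.exists_eq_add_of_le' (show 2 ≤ k by omega)
  set f : ℕ → List ℕ := fun v => FreeMonoid.toList (θ (FreeMonoid.of v)) with hf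
  have of_comm (hc : f 0 ++ f 1 = f 1 ++ f 0) : θ (wh (m + 2)) = θ (wh' (m + 2)) := by
    apply FreeMonoid.toList.injective
    have hc' (l : List ℕ) : f 0 ++ (f 1 ++ l) = f 1 ++ (f 0 ++ l) := by
      rw [← List.append_assoc, hc, List.append_assoc]
    rw [toList_map_eq_flatMap, toList_map_eq_flatMap, toList_wh, toList_wh', ← hf]
    simp [hatList, hc']
  constructor
  · rintro ⟨a, b, h⟩
    apply of_comm
    have h := congrArg FreeMonoid.toList h
    rw [FreeMonoid.toList_mul, FreeMonoid.toList_mul, toList_map_eq_flatMap, toList_wh,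
      toList_wh] at h
    exact flatMap_hatList_comm (by omega) (by omega) (by omega) h
  · rintro ⟨a, b, h⟩
    apply of_comm
    have h := congrArg FreeMonoid.toList h
    rw [FreeMonoid.toList_mul, FreeMonoid.toList_mul, toList_map_eq_flatMap, toList_wh,
      toList_wh'] at h
    exact (flatMap_hatList_comm (by omega) (by omega) (by omega) h).symm
end

section
/- Let M be a finite monoid with m elements that satisfies the identities x³ ≈ x², x²yx ≈ xyx, xyx² ≈ xyx, xy²x ≈ x²y² and σ∞. Then M satisfies the identity σ_{2(m+1)}. (Consequently, the subvariety of the monoid variety generated by E¹ defined by σ∞ is not generated by any finite monoid.) -/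
/-- The square `v²` of a variable, as a word (variables: `x = 0`, `y = 1`,
`h = 2`, and `hᵢ = i + 2`). -/
def sqw (v : ℕ) : Word := FreeMonoid.of v * FreeMonoid.of v

/-- `eᵢ = x²` if `i` is odd and `eᵢ = y²` if `i` is even. -/
def ee (i : ℕ) : Word := if i % 2 = 1 then sqw 0 else sqw 1

/-- The common prefix `e₁h₁e₂h₂⋯eₙhₙ` of the two sides of `σₙ`. -/
def spre (n : ℕ) : Word :=
  ((List.range n).map (fun j => ee (j + 1) * FreeMonoid.of (j + 3))).prod

/-- The left-hand side `e₁h₁e₂h₂⋯eₙhₙ·x²y²` of the identity `σₙ`. -/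
def sL (n : ℕ) : Word := spre n * (sqw 0 * sqw 1)

/-- The right-hand side `e₁h₁e₂h₂⋯eₙhₙ·y²x²` of the identity `σₙ`. -/
def sR (n : ℕ) : Word := spre n * (sqw 1 * sqw 0)

/-- The left-hand side `x²y²hx²y²` of the identity `σ∞`. -/
def sInfL : Word := sqw 0 * sqw 1 * FreeMonoid.of 2 * (sqw 0 * sqw 1)

/-- The right-hand side `x²y²hy²x²` of the identity `σ∞`. -/
def sInfR : Word := sqw 0 * sqw 1 * FreeMonoid.of 2 * (sqw 1 * sqw 0)

/-- In a monoid satisfying `x³ ≈ x²` and `xy²x ≈ x²y²`, a square `(eu)²` absorbs an idempotent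
`e = a²` on the right. -/
theorem sq_mul_absorb {M : Type*} [Monoid M]
    (hcube : ∀ x : M, x ^ 3 = x ^ 2) (hsq : ∀ x y : M, x * (y * y) * x = x * x * (y * y))
    (a u : M) :
    (a * a * u) * (a * a * u) * (a * a) = (a * a * u) * (a * a * u) := by
  have idem : (a * a) * (a * a) = a * a := by
    calc (a * a) * (a * a) = a ^ 3 * a := by simp only [pow_succ, pow_zero, one_mul, mul_assoc]
      _ = a ^ 2 := by rw [hcube, ← pow_succ]; exact hcube a
      _ = a * a := pow_two a
  have absorb : (a * a) * (a * a * u) = a * a * u := by rw [← mul_assoc, idem]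
  have key := hsq (a * a) (a * a * u)
  rwa [idem, ← mul_assoc (a * a) (a * a * u), absorb] at key

/-- If right multiplication by `a²sb²v` fixes `p`, then so do right multiplication by `a²` and
by `b²`. -/
theorem mul_sq_eq_of_mul_eq {M : Type*} [Monoid M]
    (hcube : ∀ x : M, x ^ 3 = x ^ 2) (hxyx : ∀ x y : M, x * y * (x * x) = x * y * x)
    (hsq : ∀ x y : M, x * (y * y) * x = x * x * (y * y))
    {p a b s v : M} (hp : p * (a * a * (s * (b * b * v))) = p) :
    p * (a * a) = p ∧ p * (b * b) = p := by
  have fixed_sq {w : M} (h : p * w = p) : p * (w * w) = p := by rw [← mul_assoc, h, h]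
  constructor
  · have key := sq_mul_absorb hcube hsq a (s * (b * b * v))
    rw [← fixed_sq hp, mul_assoc, key]
  · have repeated : p * (b * b * v) = p := by
      have key : (a * a * (s * (b * b * v))) * (a * a * (s * (b * b * v))) * (b * b * v)
          = (a * a * (s * (b * b * v))) * (a * a * (s * (b * b * v))) := by
        have := congrArg (fun t => a * a * s * t) (hxyx (b * b * v) (a * a * s))
        simpa only [mul_assoc] using this
      generalize a * a * (s * (b * b * v)) = w at hp key
      calc p * (b * b * v) = p * (w * w * (b * b * v)) := by
            rw [← mul_assoc p (w * w), fixed_sq hp]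
        _ = p := by rw [key, fixed_sq hp]
    have key := sq_mul_absorb hcube hsq b v
    rw [← fixed_sq repeated, mul_assoc, key]

theorem spre_succ (n : ℕ) : spre (n + 1) = spre n * (ee (n + 1) * FreeMonoid.of (n + 3)) := by
  simp [spre, List.range_succ]

theorem exists_spre_add (n k : ℕ) : ∃ r : Word, spre (n + k) = spre n * r := by
  induction k with
  | zero => exact ⟨1, by simp⟩
  | succ k ih =>
    obtain ⟨r, hr⟩ := ih
    exact ⟨r * (ee (n + k + 1) * FreeMonoid.of (n + k + 3)), by
      rw [← add_assoc, spre_succ, hr, mul_assoc]⟩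

theorem exists_spre_of_lt {i j : ℕ} (hij : i < j) :
    ∃ s v : Word, spre (2 * j) = spre (2 * i) * (sqw 0 * (s * (sqw 1 * v))) := by
  obtain ⟨k, rfl⟩ := Nat.exists_eq_add_of_lt hij
  obtain ⟨r, hr⟩ := exists_spre_add (2 * i + 1 + 1) (2 * k)
  refine ⟨FreeMonoid.of (2 * i + 3), FreeMonoid.of (2 * i + 1 + 3) * r, ?_⟩
  have hodd : ee (2 * i + 1) = sqw 0 := if_pos (by omega)
  have heven : ee (2 * i + 1 + 1) = sqw 1 := if_neg (by omega)
  rw [show 2 * (i + k + 1) = 2 * i + 1 + 1 + 2 * k by ring, hr, spre_succ, spre_succ, hodd, heven]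
  simp only [mul_assoc]

/-- Any finite monoid with `m` elements satisfying `x³ ≈ x²`, `x²yx ≈ xyx`,
`xyx² ≈ xyx`, `xy²x ≈ x²y²`, and `σ∞` also satisfies `σ_{2(m+1)}`. -/
theorem statement19 (M : Type) [Monoid M] [Fintype M]
    (h1 : Satisfies M (FreeMonoid.of 0 ^ 3) (FreeMonoid.of 0 ^ 2))
    (h2 : Satisfies M (sqw 0 * FreeMonoid.of 1 * FreeMonoid.of 0)
            (FreeMonoid.of 0 * FreeMonoid.of 1 * FreeMonoid.of 0))
    (h3 : Satisfies M (FreeMonoid.of 0 * FreeMonoid.of 1 * sqw 0)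
            (FreeMonoid.of 0 * FreeMonoid.of 1 * FreeMonoid.of 0))
    (h4 : Satisfies M (FreeMonoid.of 0 * sqw 1 * FreeMonoid.of 0) (sqw 0 * sqw 1))
    (h5 : Satisfies M sInfL sInfR) :
    Satisfies M (sL (2 * (Fintype.card M + 1)))
      (sR (2 * (Fintype.card M + 1))) := by
  have hcube (x : M) : x ^ 3 = x ^ 2 := by
    simpa using h1 (FreeMonoid.lift fun _ => x)
  have hxyx (x y : M) : x * y * (x * x) = x * y * x := by
    simpa [sqw] using h3 (FreeMonoid.lift fun n => if n = 0 then x else y)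
  have hsq (x y : M) : x * (y * y) * x = x * x * (y * y) := by
    simpa [sqw] using h4 (FreeMonoid.lift fun n => if n = 0 then x else y)
  have hinf (x y z : M) :
      x * x * (y * y) * z * (x * x * (y * y)) = x * x * (y * y) * z * (y * y * (x * x)) := by
    simpa [sInfL, sInfR, sqw] using
      h5 (FreeMonoid.lift fun n => if n = 0 then x else if n = 1 then y else z)
  intro f
  set m := Fintype.card M
  obtain ⟨i, j, hij, heq⟩ : ∃ i j : Fin (m + 1), i < j ∧
      f (spre (2 * i)) = f (spre (2 * j)) := by
    obtain ⟨i, j, hne, heq⟩ := Fintype.exists_ne_map_eq_of_card_lt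
      (fun i : Fin (m + 1) => f (spre (2 * i))) (by simp [m])
    rcases lt_or_gt_of_ne hne with h | h
    · exact ⟨i, j, h, heq⟩
    · exact ⟨j, i, h, heq.symm⟩
  obtain ⟨s, v, hsv⟩ := exists_spre_of_lt (i := i) (j := j) hij
  obtain ⟨r, hr⟩ := exists_spre_add (2 * i) (2 * (m + 1) - 2 * i)
  rw [Nat.add_sub_cancel' (by omega)] at hr
  rw [hsv] at heq
  simp only [sL, sR, hr, sqw, map_mul] at heq ⊢
  obtain ⟨hx, hy⟩ := mul_sq_eq_of_mul_eq hcube hxyx hsq heq.symm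
  have key := congrArg (f (spre (2 * i)) * ·)
    (hinf (f (FreeMonoid.of 0)) (f (FreeMonoid.of 1)) (f r))
  generalize f (FreeMonoid.of 0) * f (FreeMonoid.of 0) = e at hx key ⊢
  generalize f (FreeMonoid.of 1) * f (FreeMonoid.of 1) = e' at hy key ⊢
  simpa only [← mul_assoc (f (spre (2 * i))), hx, hy] using key
end
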